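/- arXiv:1906.11808 — 2 statements merged into one kernel-verified Lean document; each statement's English description precedes it below -/
import Mathlib

section
/- For any constant c < 1/4, there is no sequence of intervals of length n^c which contain the chromatic number of the uniform random graph G(n,m) with m = ⌊n²/4⌋ with high probability. Precisely: for every constant c ∈ (0, 1/4) and every pair of sequences s, t : ℕ → ℝ with t_n − s_n ≤ n^c for all n, it is NOT the case that P(χ(G(n,⌊n²/4⌋)) ∈ [s_n, t_n]) → 1 as n → ∞. -/
open Filter

/-- The chromatic number of a graph on `Fin n`, as a natural number. -/
noncomputable def chi (n : ℕ) (G : SimpleGraph (Fin n)) : ℕ := G.chromaticNumber.toNat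

/-- Probability of an event under the uniform random graph `G(n,m)`: the uniform
measure on all simple graphs on `{1,…,n}` with exactly `m` edges. -/
noncomputable def PrM (n m : ℕ) (B : SimpleGraph (Fin n) → Prop) : ℝ :=
  (Nat.card {G : SimpleGraph (Fin n) // Nat.card G.edgeSet = m ∧ B G} : ℝ) /
    (Nat.card {G : SimpleGraph (Fin n) // Nat.card G.edgeSet = m} : ℝ)

namespace NC
open Finset
open scoped Classical

/-- all non-loop pairs -/
noncomputable def EE (V : Type) [Fintype V] : Finset (Sym2 V) := univ.filter (fun p => ¬ p.IsDiag)

lemma mem_EE {V : Type} [Fintype V] (p : Sym2 V) : p ∈ EE V ↔ ¬ p.IsDiag := by simp [EE]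

lemma card_EE (V : Type) [Fintype V] : (EE V).card = (Fintype.card V).choose 2 := by
  rw [← Sym2.card_subtype_not_diag, Fintype.card_subtype, EE]

def Col {V : Type} (F : Finset (Sym2 V)) (k : ℕ) : Prop :=
  ∃ f : V → Fin k, ∀ p ∈ F, ¬ (p.map f).IsDiag

lemma Col.mono {V : Type} {F F' : Finset (Sym2 V)} {k : ℕ} (h : F ⊆ F') (h' : Col F' k) : Col F k := by
  obtain ⟨f, hf⟩ := h'
  exact ⟨f, fun p hp => hf p (h hp)⟩

/-- number of colorable graphs -/
noncomputable def cc (V : Type) [Fintype V] (m k : ℕ) : ℕ :=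
  ((powersetCard m (EE V)).filter (fun F => Col F k)).card

lemma card_avoid {α : Type} (P D : Finset α) (m : ℕ) (hD : D ⊆ P)
    [DecidablePred (fun F : Finset α => Disjoint F D)] :
    ((powersetCard m P).filter (fun F => Disjoint F D)).card = (P.card - D.card).choose m := by
  rw [← card_sdiff_of_subset hD, ← card_powersetCard]
  congr 1
  ext F
  simp only [mem_filter, mem_powersetCard, subset_sdiff]
  tauto

lemma choose_sub_le (N m f : ℕ) (hm : N ≤ 2 * m) (hf : f ≤ N) :
    2 ^ f * (N - f).choose m ≤ N.choose m := by
  induction f with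
  | zero => simp
  | succ f ih =>
    refine le_trans ?_ (ih (by omega))
    obtain ⟨k, hk⟩ : ∃ k, N - f = k + 1 := ⟨N - f - 1, by omega⟩
    have hk2 : N - (f + 1) = k := by omega
    rw [hk, hk2, pow_succ, mul_assoc]
    refine Nat.mul_le_mul_left _ ?_
    have h := Nat.choose_mul_succ_eq k m
    have h2 : 2 * (k + 1 - m) ≤ k + 1 := by omega
    have : 2 * (k.choose m) * (k+1) ≤ (k+1).choose m * (k+1) := by nlinarith
    exact Nat.le_of_mul_le_mul_right this (by omega)

lemma exists_surj {V : Type} [Fintype V] (F : Finset (Sym2 V)) (hF : F ⊆ EE V) (k : ℕ)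
    (hk : k ≤ Fintype.card V) (h : Col F k) :
    ∃ f : V → Fin k, Function.Surjective f ∧ ∀ p ∈ F, ¬ (p.map f).IsDiag := by
  obtain ⟨f, hf, hmax⟩ := Finset.exists_max_image
    (univ.filter (fun f : V → Fin k => ∀ p ∈ F, ¬ (p.map f).IsDiag))
    (fun f => (univ.image f).card) (by
      obtain ⟨f, hf⟩ := h
      exact ⟨f, by simpa using hf⟩)
  simp only [mem_filter, mem_univ, true_and] at hf hmax
  refine ⟨f, ?_, hf⟩
  by_contra hs
  simp only [Function.Surjective, not_forall, not_exists] at hs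
  obtain ⟨c, hc⟩ := hs
  have hni : ¬ Function.Injective f := by
    intro hi
    have := (Fintype.bijective_iff_injective_and_card f).2 ⟨hi, by
      have := Fintype.card_le_of_injective f hi
      simp only [Fintype.card_fin] at *
      omega⟩
    obtain ⟨v, hv⟩ := this.2 c
    exact hc v hv
  simp only [Function.Injective, not_forall] at hni
  obtain ⟨u, v, huv, hne⟩ := hni
  have := hmax (Function.update f u c) (by
    intro p hp
    induction p with
    | _ x y =>
      have h1 := hf _ hp
      have h2 := (mem_EE _).1 (hF hp)
      simp only [Sym2.map_mk, Sym2.mk_isDiag_iff] at h1 h2 ⊢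
      by_cases hx : x = u
      · subst hx
        have : y ≠ x := fun h => h2 h.symm
        simp [Function.update_of_ne this]
        exact fun h => hc y h.symm
      · by_cases hy : y = u
        · subst hy
          simp [Function.update_of_ne hx]
          exact fun h => hc x h
        · simpa [Function.update_of_ne hx, Function.update_of_ne hy] using h1)
  have hlt : (univ.image f).card < (univ.image (Function.update f u c)).card := by
    apply Finset.card_lt_card
    rw [Finset.ssubset_iff]
    refine ⟨c, by simpa using hc, ?_⟩
    intro z hz
    simp only [mem_insert, mem_image, mem_univ, true_and] at hz ⊢
    rcases hz with rfl | ⟨x, rfl⟩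
    · exact ⟨u, by simp⟩
    · by_cases hx : x = u
      · subst hx
        exact ⟨v, by rw [Function.update_of_ne (Ne.symm hne), huv]⟩
      · exact ⟨x, by rw [Function.update_of_ne hx]⟩
  omega

/-- monochromatic pairs -/
noncomputable def Mono {V : Type} [Fintype V] {k : ℕ} (f : V → Fin k) : Finset (Sym2 V) :=
  (EE V).filter (fun p => (p.map f).IsDiag)

lemma mono_card {V : Type} [Fintype V] {k : ℕ} (f : V → Fin k) :
    (Fintype.card V) ^ 2 ≤ k * (2 * (Mono f).card + Fintype.card V) := by
  have h1 : (Fintype.card V) ^ 2 ≤ k * ∑ c : Fin k, ((univ.filter (fun v => f v = c)).card) ^ 2 := by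
    have := sq_sum_le_card_mul_sum_sq (s := (univ : Finset (Fin k)))
      (f := fun c => (univ.filter (fun v => f v = c)).card)
    rw [← Finset.card_eq_sum_card_fiberwise (f := f) (s := univ) (t := univ) (by simp)] at this
    simpa using this
  refine h1.trans (Nat.mul_le_mul_left _ ?_)
  have h2 : ∑ c : Fin k, ((univ.filter (fun v => f v = c)).card) ^ 2 =
      (univ.filter (fun p : V × V => f p.1 = f p.2)).card := by
    rw [Finset.card_eq_sum_card_fiberwise (f := fun p : V × V => f p.1) (t := univ) (by simp)]
    refine Finset.sum_congr rfl fun c _ => ?_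
    rw [sq, ← Finset.card_product]
    congr 1
    ext ⟨x, y⟩
    simp only [mem_product, mem_filter, mem_univ, true_and]
    constructor
    · rintro ⟨a, b⟩; exact ⟨a.trans b.symm, a⟩
    · rintro ⟨a, b⟩; exact ⟨b, a.symm.trans b⟩
  rw [h2]
  have h3 : (univ.filter (fun p : V × V => f p.1 = f p.2)) ⊆
      (univ.filter (fun p : V × V => p.1 ≠ p.2 ∧ f p.1 = f p.2)) ∪ univ.image (fun v => (v, v)) := by
    rintro ⟨x, y⟩ h
    simp at h ⊢
    by_cases hxy : x = y
    · right; exact hxy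
    · left; exact ⟨hxy, h⟩
  refine (card_le_card h3).trans ((card_union_le _ _).trans ?_)
  refine add_le_add ?_ ?_
  · have := Finset.card_le_mul_card_image_of_maps_to (s := univ.filter (fun p : V × V => p.1 ≠ p.2 ∧ f p.1 = f p.2))
      (t := Mono f) (f := fun p => s(p.1, p.2)) (by
        rintro ⟨x, y⟩ h
        simp [Mono, mem_EE] at h ⊢
        exact h) 2 (by
        intro b hb
        induction b with
        | _ x y =>
        refine (card_le_card (t := {(x, y), (y, x)}) ?_).trans card_le_two
        rintro ⟨u, v⟩ h
        simp at h ⊢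
        exact h.2)
    exact this
  · exact card_image_le.trans (by simp)

lemma first_moment (V : Type) [Fintype V] (m k d : ℕ) (hk : k ≤ Fintype.card V)
    (hm : (Fintype.card V).choose 2 ≤ 2 * m) (hk0 : 0 < k)
    (hd : k * (2 * d + Fintype.card V) ≤ Fintype.card V ^ 2) :
    k.factorial * cc V m k * 2 ^ d ≤ k ^ (Fintype.card V) * ((Fintype.card V).choose 2).choose m := by
  have h1 : cc V m k * k.factorial ≤
      (univ : Finset (V → Fin k)).card * (((Fintype.card V).choose 2 - d).choose m) := by
    refine Finset.card_mul_le_card_mul (fun F f => Disjoint F (Mono f)) ?_ ?_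
    · intro F hF
      simp only [mem_filter, mem_powersetCard] at hF
      obtain ⟨f, hs, hf⟩ := exists_surj F hF.1.1 k hk hF.2
      have : (univ.image (fun σ : Equiv.Perm (Fin k) => (σ ∘ f : V → Fin k))).card = k.factorial := by
        rw [Finset.card_image_of_injective]
        · simp [Fintype.card_perm]
        · intro σ τ h
          ext x
          obtain ⟨v, rfl⟩ := hs x
          exact congrArg Fin.val (congrFun h v)
      rw [← this]
      refine card_le_card ?_
      intro g hg
      simp only [mem_image, mem_univ, true_and] at hg
      obtain ⟨σ, rfl⟩ := hg
      simp only [bipartiteAbove, mem_filter, mem_univ, true_and]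
      rw [Finset.disjoint_left]
      intro p hp hp2
      have := hf p hp
      simp only [Mono, mem_filter] at hp2
      apply this
      have h3 := hp2.2
      induction p with
      | _ x y => simpa using h3
    · intro f _
      have h2 : d ≤ (Mono f).card := by
        by_contra hlt
        push Not at hlt
        have := mono_card f
        have h4 : k * (2 * (Mono f).card + Fintype.card V) < k * (2 * d + Fintype.card V) :=
          Nat.mul_lt_mul_of_pos_left (by omega) hk0
        omega
      refine (card_le_card (t := (powersetCard m (EE V)).filter (fun F => Disjoint F (Mono f))) ?_).trans ?_
      · intro F hF
        simp only [bipartiteBelow, mem_filter] at hF ⊢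
        exact ⟨hF.1.1, hF.2⟩
      · rw [card_avoid (EE V) (Mono f) m (filter_subset _ _), card_EE]
        exact Nat.choose_le_choose _ (by omega)
  have hdN : d ≤ (Fintype.card V).choose 2 := by
    have h5 : 2 * (Fintype.card V).choose 2 = Fintype.card V * (Fintype.card V - 1) := by
      rw [Nat.choose_two_right]
      exact Nat.mul_div_cancel' (Nat.even_mul_pred_self _).two_dvd
    have h6 : 2 * d + Fintype.card V ≤ Fintype.card V ^ 2 := le_trans (Nat.le_mul_of_pos_left _ hk0) hd
    rcases Nat.eq_zero_or_pos (Fintype.card V) with h0 | h0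
    · rw [h0] at h6 ⊢; omega
    · obtain ⟨q, hq⟩ : ∃ q, Fintype.card V = q + 1 := ⟨_, (Nat.succ_pred_eq_of_pos h0).symm⟩
      rw [hq] at h5 h6 ⊢
      simp only [Nat.add_sub_cancel] at h5
      nlinarith
  have h7 := choose_sub_le _ m d hm hdN
  simp only [Finset.card_univ, Fintype.card_fun, Fintype.card_fin] at h1
  calc k.factorial * cc V m k * 2 ^ d = (cc V m k * k.factorial) * 2 ^ d := by ring
    _ ≤ (k ^ Fintype.card V * (((Fintype.card V).choose 2 - d).choose m)) * 2 ^ d :=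
      Nat.mul_le_mul_right _ h1
    _ = k ^ Fintype.card V * (2 ^ d * (((Fintype.card V).choose 2 - d).choose m)) := by ring
    _ ≤ _ := Nat.mul_le_mul_left _ h7

end NC

open Filter
namespace NC
open Finset
open scoped Classical

lemma card_graphs (n m : ℕ) (B : SimpleGraph (Fin n) → Prop) :
    Nat.card {G : SimpleGraph (Fin n) // Nat.card G.edgeSet = m ∧ B G} =
      ((powersetCard m (EE (Fin n))).filter
        (fun F : Finset (Sym2 (Fin n)) => B (SimpleGraph.fromEdgeSet (F : Set (Sym2 (Fin n)))))).card := by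
  have key : ∀ F : Finset (Sym2 (Fin n)), F ⊆ EE (Fin n) →
      (SimpleGraph.fromEdgeSet (F : Set (Sym2 (Fin n)))).edgeSet = F := by
    intro F hF
    rw [SimpleGraph.edgeSet_fromEdgeSet]
    ext p
    simp only [Set.mem_sdiff, Finset.mem_coe]
    constructor
    · exact fun h => h.1
    · intro h
      exact ⟨h, by simpa using (mem_EE _).1 (hF h)⟩
  rw [Nat.card_eq_fintype_card, Fintype.card_subtype]
  refine Finset.card_bij' (fun G _ => G.edgeSet.toFinset)
    (fun (F : Finset (Sym2 (Fin n))) _ => SimpleGraph.fromEdgeSet (F : Set (Sym2 (Fin n)))) ?_ ?_ ?_ ?_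
  · intro G hG
    simp only [mem_filter, mem_univ, true_and] at hG
    simp only [mem_filter, mem_powersetCard, Set.coe_toFinset, SimpleGraph.fromEdgeSet_edgeSet]
    refine ⟨⟨?_, ?_⟩, hG.2⟩
    · intro p hp
      rw [mem_EE]
      exact G.not_isDiag_of_mem_edgeSet (by simpa using hp)
    · rw [← hG.1, Nat.card_eq_fintype_card, Set.toFinset_card]
  · intro F hF
    simp only [mem_filter, mem_powersetCard] at hF
    simp only [mem_filter, mem_univ, true_and]
    refine ⟨?_, hF.2⟩
    rw [key F hF.1.1, ← hF.1.2]
    simp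
  · intro G hG
    simp
  · intro F hF
    simp only [mem_filter, mem_powersetCard] at hF
    have := key F hF.1.1
    ext p
    simp only [Set.mem_toFinset, this, Finset.mem_coe]

lemma PrM_eq (n m : ℕ) (B : SimpleGraph (Fin n) → Prop) :
    PrM n m B = (((powersetCard m (EE (Fin n))).filter
        (fun F : Finset (Sym2 (Fin n)) => B (SimpleGraph.fromEdgeSet (F : Set (Sym2 (Fin n)))))).card : ℝ) /
        ((n.choose 2).choose m : ℝ) := by
  have h := card_graphs n m (fun _ => True)
  simp only [and_true, filter_true, card_powersetCard, card_EE, Fintype.card_fin] at h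
  rw [PrM, card_graphs, h]

lemma col_iff (n k : ℕ) (F : Finset (Sym2 (Fin n))) (hF : F ⊆ EE (Fin n)) :
    Col F k ↔ chi n (SimpleGraph.fromEdgeSet (F : Set (Sym2 (Fin n)))) ≤ k := by
  have h1 : Col F k ↔ (SimpleGraph.fromEdgeSet (F : Set (Sym2 (Fin n)))).Colorable k := by
    constructor
    · rintro ⟨f, hf⟩
      refine ⟨SimpleGraph.Coloring.mk f ?_⟩
      intro u v huv
      have := hf s(u, v) (by simpa using ((SimpleGraph.fromEdgeSet_adj _).1 huv).1)
      simpa using this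
    · rintro ⟨f⟩
      refine ⟨f, ?_⟩
      intro p hp
      induction p with
      | _ x y =>
        have h2 := (mem_EE _).1 (hF hp)
        simp only [Sym2.map_mk, Sym2.mk_isDiag_iff] at h2 ⊢
        exact f.valid ((SimpleGraph.fromEdgeSet_adj _).2 ⟨by simpa using hp, h2⟩)
  rw [h1, chi, ← SimpleGraph.chromaticNumber_le_iff_colorable]
  have hc := (SimpleGraph.colorable_of_fintype (SimpleGraph.fromEdgeSet (F : Set (Sym2 (Fin n)))))
  have hne := SimpleGraph.chromaticNumber_ne_top_iff_exists.2 ⟨_, hc⟩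
  rw [← ENat.natCast_toNat hne]
  simp

lemma cc_ge (n m : ℕ) (s t : ℝ) (ε : ℝ) (hN : m ≤ n.choose 2)
    (h : 1 - ε ≤ PrM n m (fun G => (chi n G : ℝ) ∈ Set.Icc s t)) :
    (1 - ε) * ((n.choose 2).choose m : ℝ) ≤ cc (Fin n) m ⌊t⌋₊ ∧
    ∀ k : ℕ, (k : ℝ) < s → (cc (Fin n) m k : ℝ) ≤ ε * ((n.choose 2).choose m : ℝ) := by
  have hpos : (0 : ℝ) < ((n.choose 2).choose m : ℝ) := by exact_mod_cast Nat.choose_pos hN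
  rw [PrM_eq, le_div_iff₀ hpos] at h
  refine ⟨h.trans ?_, ?_⟩
  · rw [cc]
    norm_cast
    refine card_le_card ?_
    intro F hF
    simp only [mem_filter, mem_powersetCard] at hF ⊢
    exact ⟨hF.1, (col_iff n _ F hF.1.1).2 (Nat.le_floor hF.2.2)⟩
  · intro k hk
    set A := ((powersetCard m (EE (Fin n))).filter
        (fun F : Finset (Sym2 (Fin n)) => (chi n (SimpleGraph.fromEdgeSet (F : Set (Sym2 (Fin n)))) : ℝ) ∈ Set.Icc s t)) with hA
    set C := (powersetCard m (EE (Fin n))).filter (fun F => Col F k) with hC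
    have hd : Disjoint A C := by
      rw [Finset.disjoint_left]
      intro F h1 h2
      simp only [hA, hC, mem_filter, mem_powersetCard] at h1 h2
      have := (col_iff n _ F h1.1.1).1 h2.2
      have h3 := h1.2.1
      have h4 : ((chi n (SimpleGraph.fromEdgeSet (F : Set (Sym2 (Fin n)))) : ℕ) : ℝ) ≤ k := by exact_mod_cast this
      linarith
    have hu : (A ∪ C).card ≤ (n.choose 2).choose m := by
      have := card_le_card (s := A ∪ C) (t := powersetCard m (EE (Fin n)))
        (union_subset (filter_subset _ _) (filter_subset _ _))
      simpa [card_EE] using this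
    rw [card_union_of_disjoint hd] at hu
    have hu' : (A.card : ℝ) + C.card ≤ ((n.choose 2).choose m : ℝ) := by exact_mod_cast hu
    have : (cc (Fin n) m k : ℝ) = C.card := rfl
    rw [this]
    have h' : (1 - ε) * ((n.choose 2).choose m : ℝ) ≤ (A.card : ℝ) := by
      refine h.trans (le_of_eq ?_)
      rw [hA]
      congr
    linarith

end NC

open Filter
namespace NC
open Finset
open scoped Classical

lemma desc_aux (n a s t : ℕ) (h : a ≤ n) :
    (a - s).descFactorial t * n.descFactorial t ≤ a.descFactorial t * (n - s).descFactorial t := by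
  induction t with
  | zero => simp
  | succ t ih =>
    simp only [Nat.descFactorial_succ]
    have h1 : (a - s - t) * (n - t) ≤ (a - t) * (n - s - t) := by
      rcases le_or_gt a (s + t) with h2 | h2
      · have : a - s - t = 0 := by omega
        simp [this]
      · obtain ⟨x, rfl⟩ := Nat.exists_eq_add_of_lt h2
        obtain ⟨y, rfl⟩ := Nat.exists_eq_add_of_le h
        have e1 : s + t + x + 1 - s - t = x + 1 := by omega
        have e2 : s + t + x + 1 + y - t = x + 1 + y + s := by omega
        have e3 : s + t + x + 1 - t = x + 1 + s := by omega
        have e4 : s + t + x + 1 + y - s - t = x + 1 + y := by omega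
        rw [e1, e2, e3, e4]
        nlinarith [Nat.zero_le (s*y)]
    calc (a - s - t) * (a - s).descFactorial t * ((n - t) * n.descFactorial t)
        = ((a - s - t) * (n - t)) * ((a - s).descFactorial t * n.descFactorial t) := by ring
      _ ≤ ((a - t) * (n - s - t)) * (a.descFactorial t * (n - s).descFactorial t) := Nat.mul_le_mul h1 ih
      _ = _ := by ring

/-- probability-like weight -/
noncomputable def pw (n a s : ℕ) : ℝ := (a.descFactorial s : ℝ) / (n.descFactorial s : ℝ)

lemma pw_nonneg (n a s : ℕ) : 0 ≤ pw n a s := by unfold pw; positivity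

lemma pw_add (n a s t : ℕ) (h : a ≤ n) : pw n a (s + t) ≤ pw n a s * pw n a t := by
  rcases lt_or_ge a (s + t) with h1 | h1
  · have : pw n a (s + t) = 0 := by
      unfold pw
      rw [Nat.descFactorial_eq_zero_iff_lt.2 h1]; simp
    rw [this]
    exact mul_nonneg (pw_nonneg _ _ _) (pw_nonneg _ _ _)
  · have e1 : ∀ z : ℕ, z.descFactorial (s + t) = z.descFactorial s * (z - s).descFactorial t := by
      intro z
      rcases le_or_gt (s + t) z with hz | hz
      · have := Nat.descFactorial_mul_descFactorial (n := z) (k := s) (m := s + t) (by omega)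
        rw [← this]; simp [mul_comm]
      · rw [Nat.descFactorial_eq_zero_iff_lt.2 hz]
        rcases le_or_gt s z with h2 | h2
        · rw [Nat.descFactorial_eq_zero_iff_lt.2 (show z - s < t by omega)]; simp
        · rw [Nat.descFactorial_eq_zero_iff_lt.2 h2]; simp
    unfold pw
    have p1 : (0:ℝ) < (n.descFactorial s : ℝ) := by exact_mod_cast Nat.descFactorial_pos.2 (by omega)
    have p2 : (0:ℝ) < ((n - s).descFactorial t : ℝ) := by exact_mod_cast Nat.descFactorial_pos.2 (by omega)
    have p3 : (0:ℝ) < (n.descFactorial t : ℝ) := by exact_mod_cast Nat.descFactorial_pos.2 (by omega)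
    have key : ((a - s).descFactorial t : ℝ) * n.descFactorial t ≤ a.descFactorial t * (n - s).descFactorial t := by
      exact_mod_cast desc_aux n a s t h
    rw [e1, e1, div_mul_div_comm, Nat.cast_mul, Nat.cast_mul, div_le_div_iff₀ (by positivity) (by positivity)]
    have : (0:ℝ) ≤ (a.descFactorial s : ℝ) * n.descFactorial s := by positivity
    nlinarith [mul_le_mul_of_nonneg_left key this]

lemma pw_sum (n a : ℕ) (h : a ≤ n) {ι : Type} (I : Finset ι) (l : ι → ℕ) :
    pw n a (∑ i ∈ I, l i) ≤ ∏ i ∈ I, pw n a (l i) := by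
  induction I using Finset.induction_on with
  | empty => simp [pw]
  | insert i I hi ih =>
    rw [sum_insert hi, prod_insert hi]
    exact (pw_add n a _ _ h).trans (mul_le_mul_of_nonneg_left ih (pw_nonneg _ _ _))

lemma card_superset {V : Type} [Fintype V] (a : ℕ) (T : Finset V) (ha : a ≤ Fintype.card V) :
    (((powersetCard a (univ : Finset V)).filter (fun S => T ⊆ S)).card : ℝ) ≤
      (Fintype.card V).choose a * pw (Fintype.card V) a T.card := by
  set n := Fintype.card V
  rcases lt_or_ge a T.card with h | h
  · have : (powersetCard a (univ : Finset V)).filter (fun S => T ⊆ S) = ∅ := by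
      rw [filter_eq_empty_iff]
      intro S hS hT
      rw [mem_powersetCard] at hS
      have := card_le_card hT
      omega
    rw [this]
    simp only [card_empty, Nat.cast_zero]
    exact mul_nonneg (by positivity) (pw_nonneg _ _ _)
  · have h1 : ((powersetCard a (univ : Finset V)).filter (fun S => T ⊆ S)).card ≤
        (n - T.card).choose (a - T.card) := by
      have h2 : (powersetCard (a - T.card) (univ \ T)).card = (n - T.card).choose (a - T.card) := by
        rw [card_powersetCard, card_sdiff_of_subset (subset_univ T), card_univ]
      rw [← h2]
      refine card_le_card_of_injOn (fun S => S \ T) ?_ ?_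
      · intro S hS
        simp only [coe_filter, mem_powersetCard, Set.mem_ofPred_eq] at hS
        simp only [mem_coe, mem_powersetCard]
        exact ⟨sdiff_subset_sdiff hS.1.1 le_rfl, by rw [card_sdiff_of_subset hS.2, hS.1.2]⟩
      · intro S hS S' hS' hh
        simp only [coe_filter, Set.mem_ofPred_eq] at hS hS'
        simp only at hh
        rw [← sdiff_union_of_subset hS.2, hh, sdiff_union_of_subset hS'.2]
    have h3 : n.choose a * a.choose T.card = n.choose T.card * (n - T.card).choose (a - T.card) :=
      Nat.choose_mul h
    have h4 : n.choose a * a.descFactorial T.card = n.descFactorial T.card * (n - T.card).choose (a - T.card) := by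
      rw [Nat.descFactorial_eq_factorial_mul_choose, Nat.descFactorial_eq_factorial_mul_choose]
      calc _ = T.card.factorial * (n.choose a * a.choose T.card) := by ring
        _ = _ := by rw [h3]; ring
    have p1 : (0:ℝ) < (n.descFactorial T.card : ℝ) := by exact_mod_cast Nat.descFactorial_pos.2 (by omega)
    unfold pw
    rw [← mul_div_assoc, le_div_iff₀ p1]
    have h5 : ((powersetCard a (univ : Finset V)).filter (fun S => T ⊆ S)).card * n.descFactorial T.card
      ≤ n.choose a * a.descFactorial T.card := by
      rw [h4, mul_comm]; exact Nat.mul_le_mul_left _ h1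
    exact_mod_cast h5

noncomputable def wt (l : ℕ) : ℝ := if l = 0 then 1 else if l = 1 then 0 else 2 ^ (l.choose 2)

lemma wt_nonneg (l : ℕ) : 0 ≤ wt l := by unfold wt; split_ifs <;> positivity

/-- generating sum -/
noncomputable def Gs (n a : ℕ) : ℝ := ∑ l ∈ range (a + 1), (a.choose l : ℝ) * (wt l * pw n a l)

lemma two_pow_le {V : Type} (A S : Finset V) :
    (2:ℝ) ^ ((A ∩ S).card.choose 2) ≤ ∑ T ∈ A.powerset, if T ⊆ S then wt T.card else 0 := by
  have hnn : ∀ T ∈ A.powerset, 0 ≤ (if T ⊆ S then wt T.card else 0) := by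
    intro T _
    split_ifs
    · exact wt_nonneg _
    · exact le_rfl
  by_cases h : (A ∩ S).card ≤ 1
  · have := single_le_sum hnn (empty_mem_powerset A)
    refine le_trans ?_ this
    have : (A ∩ S).card.choose 2 = 0 := Nat.choose_eq_zero_of_lt (by omega)
    simp [this, wt]
  · have := single_le_sum hnn (mem_powerset.2 (inter_subset_left (s₁ := A) (s₂ := S)))
    refine le_trans ?_ this
    have h0 : (A ∩ S).card ≠ 0 := by omega
    have h1 : (A ∩ S).card ≠ 1 := by omega
    simp [wt, inter_subset_right]
    rw [if_neg (by simpa using h0), if_neg h1]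

lemma Q_bound {V : Type} [Fintype V] (r a : ℕ) (A : Fin r → Finset V) (hA : ∀ i, (A i).card = a)
    (hd : ∀ i j, i ≠ j → Disjoint (A i) (A j)) (ha : a ≤ Fintype.card V) :
    ∑ S ∈ powersetCard a (univ : Finset V), ∏ i, (2:ℝ) ^ ((A i ∩ S).card.choose 2) ≤
      (Fintype.card V).choose a * (Gs (Fintype.card V) a) ^ r := by
  set n := Fintype.card V with hn
  calc ∑ S ∈ powersetCard a (univ : Finset V), ∏ i, (2:ℝ) ^ ((A i ∩ S).card.choose 2)
      ≤ ∑ S ∈ powersetCard a (univ : Finset V), ∏ i, ∑ T ∈ (A i).powerset, (if T ⊆ S then wt T.card else 0) := by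
        refine sum_le_sum fun S _ => prod_le_prod (fun i _ => by positivity) fun i _ => two_pow_le _ _
    _ = ∑ S ∈ powersetCard a (univ : Finset V), ∑ φ ∈ Fintype.piFinset (fun i => (A i).powerset),
          ∏ i, (if φ i ⊆ S then wt (φ i).card else 0) := by
        refine sum_congr rfl fun S _ => ?_
        rw [prod_univ_sum]
    _ = ∑ φ ∈ Fintype.piFinset (fun i => (A i).powerset), ∑ S ∈ powersetCard a (univ : Finset V),
          ∏ i, (if φ i ⊆ S then wt (φ i).card else 0) := sum_comm
    _ ≤ ∑ φ ∈ Fintype.piFinset (fun i => (A i).powerset), (n.choose a : ℝ) * ∏ i, (wt (φ i).card * pw n a (φ i).card) := by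
        refine sum_le_sum fun φ hφ => ?_
        rw [Fintype.mem_piFinset] at hφ
        have h1 : ∀ S ∈ powersetCard a (univ : Finset V),
            ∏ i, (if φ i ⊆ S then wt (φ i).card else 0) =
            if univ.biUnion φ ⊆ S then ∏ i, wt (φ i).card else 0 := by
          intro S _
          rw [Finset.prod_ite_zero]
          congr 1
          simp
        rw [sum_congr rfl h1, ← sum_filter, sum_const, nsmul_eq_mul, prod_mul_distrib]
        have h2 := card_superset a (univ.biUnion φ) ha
        have h3 : (univ.biUnion φ).card = ∑ i, (φ i).card := by
          refine card_biUnion fun i _ j _ hij => ?_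
          exact disjoint_of_subset_left (mem_powerset.1 (hφ i))
            (disjoint_of_subset_right (mem_powerset.1 (hφ j)) (hd i j hij))
        rw [h3] at h2
        have h4 := pw_sum n a ha univ (fun i => (φ i).card)
        have hw : 0 ≤ ∏ i, wt (φ i).card := prod_nonneg fun i _ => wt_nonneg _
        have h5 : (((powersetCard a (univ : Finset V)).filter (fun S => univ.biUnion φ ⊆ S)).card : ℝ) ≤
           n.choose a * ∏ i, pw n a (φ i).card :=
          h2.trans (mul_le_mul_of_nonneg_left h4 (by positivity))
        calc _ ≤ (n.choose a * ∏ i, pw n a (φ i).card) * ∏ i, wt (φ i).card :=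
              mul_le_mul_of_nonneg_right h5 hw
          _ = _ := by ring
    _ = (n.choose a : ℝ) * ∏ i, ∑ T ∈ (A i).powerset, (wt T.card * pw n a T.card) := by
        rw [← mul_sum, prod_univ_sum]
    _ = _ := by
        congr 1
        have : ∀ i, ∑ T ∈ (A i).powerset, (wt T.card * pw n a T.card) = Gs n a := by
          intro i
          rw [Finset.sum_powerset_apply_card (fun l => wt l * pw n a l), hA i, Gs]
          simp [nsmul_eq_mul]
        simp [this]

lemma emb_sum {V : Type} [Fintype V] (a : ℕ) (g : Finset V → ℝ) (hg : ∀ S, 0 ≤ g S) :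
    ∑ b : Fin a ↪ V, g (univ.map b) ≤ a.factorial * ∑ S ∈ powersetCard a (univ : Finset V), g S := by
  rw [← sum_fiberwise_of_maps_to (g := fun b : Fin a ↪ V => (univ : Finset (Fin a)).map b)
    (t := powersetCard a (univ : Finset V)) (by intro b _; simp [mem_powersetCard]), mul_sum]
  refine sum_le_sum fun S hS => ?_
  rw [sum_congr rfl (g := fun _ => g S) (by
    intro b hb
    rw [(mem_filter.1 hb).2])]
  rw [sum_const, nsmul_eq_mul]
  refine mul_le_mul_of_nonneg_right ?_ (hg S)
  have hc := (mem_powersetCard.1 hS).2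
  have h1 : Fintype.card (Fin a ↪ S) = a.factorial := by
    rw [Fintype.card_embedding_eq]
    simp [hc, Nat.descFactorial_self]
  rw [← h1]
  norm_cast
  rw [← Fintype.card_coe]
  refine Fintype.card_le_of_injective
    (fun b => ⟨fun x => ⟨b.1 x, by
      have := (mem_filter.1 b.2).2
      have h2 := mem_map_of_mem b.1 (mem_univ x)
      rwa [this] at h2⟩, by
      intro x y h
      simpa using h⟩) ?_
  rintro ⟨b, hb⟩ ⟨b', hb'⟩ h
  ext x
  exact congrArg Subtype.val (DFunLike.congr_fun h x)

end NC

open Filter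
namespace NC
open Finset
open scoped Classical

noncomputable def pairs {V : Type} [Fintype V] (A : Finset V) : Finset (Sym2 V) :=
  (EE V).filter (fun p => ∀ v ∈ p, v ∈ A)

lemma mem_pairs {V : Type} [Fintype V] (A : Finset V) (x y : V) :
    s(x, y) ∈ pairs A ↔ x ≠ y ∧ x ∈ A ∧ y ∈ A := by
  simp [pairs, mem_EE]

lemma card_pairs {V : Type} [Fintype V] (A : Finset V) : (pairs A).card = A.card.choose 2 := by
  rw [← Sym2.card_image_offDiag]
  congr 1
  ext p
  induction p with
  | _ x y =>
    rw [mem_pairs]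
    simp only [mem_image, mem_offDiag, Prod.exists]
    constructor
    · rintro ⟨h, hx, hy⟩
      exact ⟨x, y, ⟨hx, hy, h⟩, rfl⟩
    · rintro ⟨u, v, ⟨hu, hv, h⟩, he⟩
      have : s(u, v) = s(x, y) := he
      simp only [Sym2.eq_iff] at this
      rcases this with ⟨rfl, rfl⟩ | ⟨rfl, rfl⟩
      · exact ⟨h, hu, hv⟩
      · exact ⟨h.symm, hv, hu⟩

def rowE {V : Type} {r a : ℕ} (e : Fin r × Fin a ↪ V) (i : Fin r) : Fin a ↪ V :=
  ⟨fun x => e (i, x), fun x y h => by simpa using e.injective h⟩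

def row {V : Type} {r a : ℕ} (e : Fin r × Fin a ↪ V) (i : Fin r) : Finset V := univ.map (rowE e i)

lemma mem_row {V : Type} {r a : ℕ} (e : Fin r × Fin a ↪ V) (i : Fin r) (v : V) :
    v ∈ row e i ↔ ∃ x, e (i, x) = v := by
  simp only [row, Finset.mem_map, mem_univ, true_and]
  exact Iff.rfl

lemma card_row {V : Type} {r a : ℕ} (e : Fin r × Fin a ↪ V) (i : Fin r) : (row e i).card = a := by
  simp [row]

lemma row_disj {V : Type} {r a : ℕ} (e : Fin r × Fin a ↪ V) (i j : Fin r) (h : i ≠ j) :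
    Disjoint (row e i) (row e j) := by
  rw [disjoint_left]
  intro v h1 h2
  rw [mem_row] at h1 h2
  obtain ⟨x, rfl⟩ := h1
  obtain ⟨y, hy⟩ := h2
  have := e.injective hy
  simp at this
  exact h this.1.symm

noncomputable def DD {V : Type} [Fintype V] {r a : ℕ} (e : Fin r × Fin a ↪ V) : Finset (Sym2 V) :=
  univ.biUnion (fun i => pairs (row e i))

lemma DD_sub {V : Type} [Fintype V] {r a : ℕ} (e : Fin r × Fin a ↪ V) : DD e ⊆ EE V := by
  simp [DD, pairs]

lemma card_DD {V : Type} [Fintype V] {r a : ℕ} (e : Fin r × Fin a ↪ V) :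
    (DD e).card = r * a.choose 2 := by
  rw [DD, card_biUnion]
  · simp [card_pairs, card_row]
  · intro i _ j _ hij
    refine disjoint_left.2 ?_
    intro p
    induction p with
    | _ x y =>
      rw [mem_pairs, mem_pairs]
      intro h1 h2
      exact disjoint_left.1 (row_disj e i j hij) h1.2.1 h2.2.1

lemma card_DD_inter {V : Type} [Fintype V] {r a : ℕ} (e e' : Fin r × Fin a ↪ V) :
    (DD e ∩ DD e').card ≤ ∑ j, ∑ i, (row e i ∩ row e' j).card.choose 2 := by
  have : DD e ∩ DD e' ⊆ univ.biUnion (fun j => univ.biUnion (fun i => pairs (row e i ∩ row e' j))) := by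
    intro p
    induction p with
    | _ x y =>
      simp only [DD, mem_inter, mem_biUnion, mem_univ, true_and, mem_pairs]
      rintro ⟨⟨i, hi⟩, ⟨j, hj⟩⟩
      exact ⟨j, i, hi.1, ⟨hi.2.1, hj.2.1⟩, ⟨hi.2.2, hj.2.2⟩⟩
  refine (card_le_card this).trans (card_biUnion_le.trans (sum_le_sum fun j _ => ?_))
  refine card_biUnion_le.trans (sum_le_sum fun i _ => ?_)
  rw [card_pairs]

lemma tuple_sum {V : Type} [Fintype V] {r a : ℕ} (e : Fin r × Fin a ↪ V) (ha : a ≤ Fintype.card V) :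
    ∑ e' : Fin r × Fin a ↪ V, (2:ℝ) ^ (DD e ∩ DD e').card ≤
      (((Fintype.card V).descFactorial a : ℝ) * (Gs (Fintype.card V) a) ^ r) ^ r := by
  set g : Finset V → ℝ := fun S => ∏ i, (2:ℝ) ^ ((row e i ∩ S).card.choose 2) with hg
  calc ∑ e' : Fin r × Fin a ↪ V, (2:ℝ) ^ (DD e ∩ DD e').card
      ≤ ∑ e' : Fin r × Fin a ↪ V, ∏ j, g (univ.map (rowE e' j)) := by
        refine sum_le_sum fun e' _ => ?_
        refine (pow_le_pow_right₀ (by norm_num) (card_DD_inter e e')).trans (le_of_eq ?_)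
        rw [← prod_pow_eq_pow_sum]
        refine prod_congr rfl fun j _ => ?_
        rw [hg]
        simp only
        rw [← prod_pow_eq_pow_sum]
        rfl
    _ ≤ ∑ φ : Fin r → (Fin a ↪ V), ∏ j, g (univ.map (φ j)) := by
        rw [← sum_image (s := univ) (g := fun e' : Fin r × Fin a ↪ V => rowE e')
          (f := fun φ => ∏ j, g (univ.map (φ j)))]
        · refine sum_le_sum_of_subset_of_nonneg (subset_univ _) fun φ _ _ => ?_
          exact prod_nonneg fun j _ => prod_nonneg fun i _ => by positivity
        · intro e1 _ e2 _ h
          ext ⟨i, x⟩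
          have := congrArg (fun φ => φ i x) h
          exact this
    _ = (∑ b : Fin a ↪ V, g (univ.map b)) ^ r := by
        have := (Finset.prod_univ_sum (fun _ : Fin r => (univ : Finset (Fin a ↪ V)))
          (fun _ b => g (univ.map b))).symm
        simpa using this
    _ ≤ _ := by
        refine pow_le_pow_left₀ (sum_nonneg fun b _ => prod_nonneg fun i _ => by positivity) ?_ _
        refine (emb_sum a g (fun S => prod_nonneg fun i _ => by positivity)).trans ?_
        have := Q_bound r a (row e) (card_row e) (row_disj e) ha
        rw [Nat.descFactorial_eq_factorial_mul_choose, Nat.cast_mul, mul_assoc]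
        exact mul_le_mul_of_nonneg_left this (by positivity)

lemma choose_logconc (N m f g : ℕ) :
    (N - f - g).choose m * N.choose m ≤ (N - f).choose m * (N - g).choose m := by
  have h := desc_aux N (N - f) g m (by omega)
  simp only [Nat.descFactorial_eq_factorial_mul_choose] at h
  have hp : 0 < m.factorial * m.factorial := by positivity
  refine Nat.le_of_mul_le_mul_left ?_ hp
  calc _ = m.factorial * (N - f - g).choose m * (m.factorial * N.choose m) := by ring
    _ ≤ _ := h
    _ = _ := by ring

lemma choose_ratio (N m f o : ℕ) (ρ : ℝ) (hρ : 1 ≤ ρ) (hfm : f + m ≤ N) (ho : o ≤ f)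
    (h : ((N - f : ℕ) : ℝ) ≤ ρ * ((N - f - m : ℕ) : ℝ)) :
    ((N - (f - o)).choose m : ℝ) ≤ ρ ^ o * ((N - f).choose m : ℝ) := by
  induction o with
  | zero => simp
  | succ o ih =>
    have ih := ih (by omega)
    obtain ⟨k, hk⟩ : ∃ k, N - (f - o) = k := ⟨_, rfl⟩
    have hk2 : N - (f - (o + 1)) = k + 1 := by omega
    rw [hk] at ih
    rw [hk2]
    have h1 := Nat.choose_mul_succ_eq k m
    have h1' : (k.choose m : ℝ) * ((k + 1 : ℕ) : ℝ) = ((k+1).choose m : ℝ) * ((k + 1 - m : ℕ) : ℝ) := by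
      exact_mod_cast h1
    have hpos : (0:ℝ) < ((k + 1 - m : ℕ) : ℝ) := by
      have : 0 < k + 1 - m := by omega
      exact_mod_cast this
    have h2 : ((k + 1 : ℕ) : ℝ) ≤ ρ * ((k + 1 - m : ℕ) : ℝ) := by
      have e1 : k + 1 = (N - f) + (o + 1) := by omega
      have e2 : k + 1 - m = (N - f - m) + (o + 1) := by omega
      rw [e2, e1]
      push_cast at h ⊢
      nlinarith
    have h3 : ((k+1).choose m : ℝ) ≤ ρ * (k.choose m : ℝ) := by
      have : ((k+1).choose m : ℝ) * ((k + 1 - m : ℕ) : ℝ) ≤ (ρ * (k.choose m : ℝ)) * ((k + 1 - m : ℕ) : ℝ) := by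
        rw [← h1']
        nlinarith [Nat.cast_nonneg (α := ℝ) (k.choose m)]
      exact le_of_mul_le_mul_right this hpos
    calc ((k+1).choose m : ℝ) ≤ ρ * (k.choose m : ℝ) := h3
      _ ≤ ρ * (ρ ^ o * ((N - f).choose m : ℝ)) := by gcongr
      _ = _ := by ring

/-- number of planted structures -/
noncomputable def ZZ {V : Type} [Fintype V] (r a : ℕ) (F : Finset (Sym2 V)) : ℕ :=
  (univ.filter (fun e : Fin r × Fin a ↪ V => Disjoint F (DD e))).card

lemma second_moment {V : Type} [Fintype V] (r a m : ℕ) (ρ : ℝ) (hρ : 2 ≤ ρ)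
    (ha : a ≤ Fintype.card V)
    (hfm : r * a.choose 2 + m ≤ (Fintype.card V).choose 2)
    (h : (((Fintype.card V).choose 2 - r * a.choose 2 : ℕ) : ℝ) ≤
      ρ * (((Fintype.card V).choose 2 - r * a.choose 2 - m : ℕ) : ℝ))
    (hρ2 : (ρ / 2) ^ (r * a.choose 2) ≤ 2) :
    (((Fintype.card V).choose 2).choose m : ℝ) * ∑ F ∈ powersetCard m (EE V), (ZZ r a F : ℝ) ^ 2 ≤
      2 * (((Fintype.card V).choose 2 - r * a.choose 2).choose m : ℝ) ^ 2 *
      ((Fintype.card V).descFactorial (r * a) : ℝ) *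
      (((Fintype.card V).descFactorial a : ℝ) * (Gs (Fintype.card V) a) ^ r) ^ r := by
  set n := Fintype.card V with hn
  set N := n.choose 2 with hN
  set f := r * a.choose 2 with hf
  have h1 : ∑ F ∈ powersetCard m (EE V), (ZZ r a F : ℝ) ^ 2 =
      ∑ e : Fin r × Fin a ↪ V, ∑ e' : Fin r × Fin a ↪ V, ((N - (DD e ∪ DD e').card).choose m : ℝ) := by
    have : ∀ F : Finset (Sym2 V), (ZZ r a F : ℝ) ^ 2 =
        ∑ e : Fin r × Fin a ↪ V, ∑ e' : Fin r × Fin a ↪ V, if Disjoint F (DD e ∪ DD e') then (1:ℝ) else 0 := by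
      intro F
      have hz : (ZZ r a F : ℝ) = ∑ e : Fin r × Fin a ↪ V, if Disjoint F (DD e) then (1:ℝ) else 0 := by
        rw [ZZ]; simp
      rw [hz, sq, sum_mul_sum]
      refine sum_congr rfl fun e _ => sum_congr rfl fun e' _ => ?_
      simp only [disjoint_union_right]
      by_cases h1 : Disjoint F (DD e) <;> by_cases h2 : Disjoint F (DD e') <;> simp [h1, h2]
    simp_rw [this]
    rw [sum_comm]
    refine sum_congr rfl fun e _ => ?_
    rw [sum_comm]
    refine sum_congr rfl fun e' _ => ?_
    have h2 := card_avoid (EE V) (DD e ∪ DD e') m (union_subset (DD_sub e) (DD_sub e'))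
    rw [card_EE] at h2
    rw [← h2]
    simp
  rw [h1, mul_sum]
  have h3 : ∀ e e' : Fin r × Fin a ↪ V, (N.choose m : ℝ) * ((N - (DD e ∪ DD e').card).choose m : ℝ) ≤
      2 * ((N - f).choose m : ℝ) ^ 2 * (2:ℝ) ^ (DD e ∩ DD e').card := by
    intro e e'
    set o := (DD e ∩ DD e').card with ho
    have hof : o ≤ f := by
      rw [hf, ← card_DD e]
      exact card_le_card inter_subset_left
    have hu : (DD e ∪ DD e').card = f + (f - o) := by
      have := card_union_add_card_inter (DD e) (DD e')
      rw [card_DD, card_DD, ← ho, ← hf] at this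
      omega
    have e1 : N - (DD e ∪ DD e').card = N - f - (f - o) := by omega
    rw [e1]
    have l1 := choose_logconc N m f (f - o)
    have l1' : ((N - f - (f - o)).choose m : ℝ) * (N.choose m : ℝ) ≤
      ((N - f).choose m : ℝ) * ((N - (f - o)).choose m : ℝ) := by exact_mod_cast l1
    have l2 := choose_ratio N m f o ρ (by linarith) (by omega) hof h
    have l3 : ρ ^ o ≤ 2 * 2 ^ o := by
      have : (ρ / 2) ^ o ≤ 2 := (pow_le_pow_right₀ (by linarith) hof).trans hρ2
      rw [div_pow, div_le_iff₀ (by positivity)] at this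
      exact this
    calc _ = ((N - f - (f - o)).choose m : ℝ) * (N.choose m : ℝ) := mul_comm _ _
      _ ≤ _ := l1'
      _ ≤ ((N - f).choose m : ℝ) * (ρ ^ o * ((N - f).choose m : ℝ)) := by gcongr
      _ ≤ ((N - f).choose m : ℝ) * ((2 * 2 ^ o) * ((N - f).choose m : ℝ)) := by gcongr
      _ = _ := by ring
  calc ∑ e : Fin r × Fin a ↪ V, (N.choose m : ℝ) * ∑ e' : Fin r × Fin a ↪ V, ((N - (DD e ∪ DD e').card).choose m : ℝ)
      ≤ ∑ e : Fin r × Fin a ↪ V, 2 * ((N - f).choose m : ℝ) ^ 2 *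
          ((n.descFactorial a : ℝ) * (Gs n a) ^ r) ^ r := by
        refine sum_le_sum fun e _ => ?_
        rw [mul_sum]
        refine (sum_le_sum fun e' _ => h3 e e').trans ?_
        rw [← mul_sum]
        exact mul_le_mul_of_nonneg_left (tuple_sum e ha) (by positivity)
    _ = _ := by
        rw [sum_const, nsmul_eq_mul, card_univ, Fintype.card_embedding_eq]
        simp only [Fintype.card_prod, Fintype.card_fin]
        ring

/-- Transfer from planted to uniform. -/
lemma planted {V : Type} [Fintype V] (r a m K : ℕ) (δ B : ℝ) (hδ : 0 ≤ δ)
    (hfm : r * a.choose 2 + m ≤ (Fintype.card V).choose 2)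
    (hra : r * a ≤ Fintype.card V)
    (hB : (((Fintype.card V).choose 2).choose m : ℝ) * ∑ F ∈ powersetCard m (EE V), (ZZ r a F : ℝ) ^ 2 ≤
      B * ((((Fintype.card V).choose 2 - r * a.choose 2).choose m : ℝ) *
      ((Fintype.card V).descFactorial (r * a) : ℝ)) ^ 2)
    (hpl : ∀ e : Fin r × Fin a ↪ V,
      δ * (((Fintype.card V).choose 2 - r * a.choose 2).choose m : ℝ) ≤
      (((powersetCard m (EE V)).filter (fun F => Disjoint F (DD e) ∧ Col F K)).card : ℝ)) :
    δ ^ 2 * (((Fintype.card V).choose 2).choose m : ℝ) ≤ B * cc V m K := by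
  set n := Fintype.card V with hn
  set N := n.choose 2 with hN
  set f := r * a.choose 2 with hf
  set X := ((N - f).choose m : ℝ) * (n.descFactorial (r * a) : ℝ) with hX
  have hXpos : 0 < X := by
    have h1 : 0 < (N - f).choose m := Nat.choose_pos (by omega)
    have h2 : 0 < n.descFactorial (r * a) := Nat.descFactorial_pos.2 hra
    positivity
  have h1 : δ * X ≤ ∑ F ∈ (powersetCard m (EE V)).filter (fun F => Col F K), (ZZ r a F : ℝ) := by
    have hz : ∀ F : Finset (Sym2 V), (ZZ r a F : ℝ) = ∑ e : Fin r × Fin a ↪ V, if Disjoint F (DD e) then (1:ℝ) else 0 := by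
      intro F
      rw [ZZ]; simp
    simp_rw [hz]
    rw [sum_comm]
    have : δ * X = ∑ e : Fin r × Fin a ↪ V, δ * ((N - f).choose m : ℝ) := by
      rw [sum_const, nsmul_eq_mul, card_univ, Fintype.card_embedding_eq]
      simp only [Fintype.card_prod, Fintype.card_fin]
      rw [hX]; ring
    rw [this]
    refine sum_le_sum fun e _ => (hpl e).trans (le_of_eq ?_)
    rw [sum_boole, filter_filter]
    congr 3
    ext F
    tauto
  have h2 : (δ * X) ^ 2 ≤ (cc V m K : ℝ) * ∑ F ∈ powersetCard m (EE V), (ZZ r a F : ℝ) ^ 2 := by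
    refine (pow_le_pow_left₀ (by positivity) h1 2).trans ?_
    refine sq_sum_le_card_mul_sum_sq.trans ?_
    refine mul_le_mul_of_nonneg_left ?_ (by positivity)
    exact sum_le_sum_of_subset_of_nonneg (filter_subset _ _) fun _ _ _ => by positivity
  have h3 : (N.choose m : ℝ) * (δ * X) ^ 2 ≤ cc V m K * (B * X ^ 2) := by
    calc _ ≤ (N.choose m : ℝ) * ((cc V m K : ℝ) * ∑ F ∈ powersetCard m (EE V), (ZZ r a F : ℝ) ^ 2) := by gcongr
      _ = (cc V m K : ℝ) * ((N.choose m : ℝ) * ∑ F ∈ powersetCard m (EE V), (ZZ r a F : ℝ) ^ 2) := by ring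
      _ ≤ _ := by gcongr
  have hX2 : 0 < X ^ 2 := by positivity
  refine le_of_mul_le_mul_right ?_ hX2
  calc _ = (N.choose m : ℝ) * (δ * X) ^ 2 := by ring
    _ ≤ _ := h3
    _ = _ := by ring

end NC

open Filter
namespace NC
open Finset
open scoped Classical

lemma choose_mono_half (w x y : ℕ) (hxy : x ≤ y) (hy : y ≤ w / 2) : w.choose x ≤ w.choose y := by
  induction y, hxy using Nat.le_induction with
  | base => exact le_rfl
  | succ y hxy ih =>
    exact (ih (by omega)).trans (Nat.choose_le_succ_of_lt_half_left (by omega))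

lemma choose_uni1 (w x y : ℕ) (hxy : x ≤ y) (h : x + y ≤ w) : w.choose x ≤ w.choose y := by
  rcases le_or_gt y (w / 2) with h1 | h1
  · exact choose_mono_half w x y hxy h1
  · rw [← Nat.choose_symm (show y ≤ w by omega)]
    exact choose_mono_half w x (w - y) (by omega) (by omega)

lemma choose_uni2 (M x y : ℕ) (hxy : x ≤ y) (h : M ≤ x + y) : M.choose y ≤ M.choose x := by
  rcases le_or_gt y M with h1 | h1
  · rw [← Nat.choose_symm h1, ← Nat.choose_symm (show x ≤ M by omega)]
    exact choose_uni1 M (M - y) (M - x) (by omega) (by omega)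
  · rw [Nat.choose_eq_zero_of_lt h1]; exact Nat.zero_le _

lemma vander (M w m' : ℕ) :
    (M + w).choose m' = ∑ j ∈ range (m' + 1), M.choose j * w.choose (m' - j) := by
  rw [Nat.add_choose_eq, Finset.Nat.sum_antidiagonal_eq_sum_range_succ_mk]

lemma reflect (M w m' c : ℕ) (h1 : M ≤ c) (h2 : 2 * m' ≤ w + c) :
    (M + w).choose m' ≤ 2 * ∑ j ∈ (range (m' + 1)).filter (fun j => 2 * j ≤ c), M.choose j * w.choose (m' - j) := by
  rw [vander, ← sum_filter_add_sum_filter_not (range (m' + 1)) (fun j => 2 * j ≤ c), two_mul]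
  refine Nat.add_le_add_left ?_ _
  have hs : ∑ j ∈ (range (m' + 1)).filter (fun j => ¬ 2 * j ≤ c), M.choose j * w.choose (m' - j) =
      ∑ j ∈ (range (m' + 1)).filter (fun j => ¬ 2 * j ≤ c ∧ j ≤ c), M.choose j * w.choose (m' - j) := by
    symm
    refine sum_subset ?_ ?_
    · intro j hj
      simp only [mem_filter] at hj ⊢
      exact ⟨hj.1, hj.2.1⟩
    · intro j hj hj2
      simp only [mem_filter, not_and] at hj hj2
      have := hj2 hj.1 hj.2
      rw [Nat.choose_eq_zero_of_lt (show M < j by omega), zero_mul]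
  rw [hs]
  calc _ ≤ ∑ j ∈ (range (m' + 1)).filter (fun j => ¬ 2 * j ≤ c ∧ j ≤ c), M.choose (c - j) * w.choose (m' - (c - j)) := by
        refine sum_le_sum fun j hj => ?_
        simp only [mem_filter, mem_range] at hj
        refine Nat.mul_le_mul ?_ ?_
        · exact choose_uni2 M (c - j) j (by omega) (by omega)
        · exact choose_uni1 w _ _ (by omega) (by omega)
    _ = ∑ i ∈ ((range (m' + 1)).filter (fun j => ¬ 2 * j ≤ c ∧ j ≤ c)).image (fun j => c - j),
          M.choose i * w.choose (m' - i) := by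
        rw [sum_image]
        intro x hx y hy hxy
        simp only [coe_filter, mem_range, Set.mem_ofPred_eq] at hx hy hxy
        omega
    _ ≤ _ := by
        refine sum_le_sum_of_subset ?_
        intro i hi
        simp only [mem_image, mem_filter, mem_range] at hi ⊢
        obtain ⟨j, hj, rfl⟩ := hi
        omega

lemma window (M w m m' D : ℕ) (ε : ℝ) (hε : 0 ≤ ε) (hDm : D ≤ m) (hmD : m + D ≤ m')
    (hw : m' - m + D ≤ w)
    (h1 : (M : ℝ) - m + D ≤ (1 + ε) * ((m : ℝ) - D + 1))
    (h2 : (m' : ℝ) - m + D ≤ (1 + ε) * ((w : ℝ) - m' + m - D + 1))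
    (h3 : (1 + ε) ^ (2 * D) ≤ 2) (j : ℕ) (hj1 : m ≤ j + D) (hj2 : j ≤ m) :
    ((M.choose (j + D) * w.choose (m' - (j + D)) : ℕ) : ℝ) ≤ 2 * ((M.choose j * w.choose (m' - j) : ℕ) : ℝ) := by
  have key : ∀ i : ℕ, i ≤ D → ((M.choose (j + i) * w.choose (m' - (j + i)) : ℕ) : ℝ) ≤
      (1 + ε) ^ (2 * i) * ((M.choose j * w.choose (m' - j) : ℕ) : ℝ) := by
    intro i
    induction i with
    | zero => intro _; simp
    | succ i ih =>
      intro hi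
      have ih := ih (by omega)
      set k := j + i with hk
      have hkr : (m : ℝ) ≤ k + D := by
        have : m ≤ k + D := by omega
        exact_mod_cast this
      have a1 : (M.choose (k + 1) : ℝ) ≤ (1 + ε) * M.choose k := by
        rcases le_or_gt M k with hMk | hMk
        · rw [Nat.choose_eq_zero_of_lt (show M < k + 1 by omega)]
          simp only [Nat.cast_zero]
          positivity
        have e := Nat.choose_succ_right_eq M k
        have e' : (M.choose (k + 1) : ℝ) * (k + 1) = M.choose k * ((M : ℝ) - k) := by
          rw [← Nat.cast_sub hMk.le]; exact_mod_cast e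
        have h4 : ((M : ℝ) - k) ≤ (1 + ε) * (k + 1) := by nlinarith
        have hp : (0:ℝ) < (k:ℝ) + 1 := by positivity
        refine le_of_mul_le_mul_right ?_ hp
        rw [e']
        nlinarith [Nat.cast_nonneg (α := ℝ) (M.choose k)]
      have a2 : (w.choose (m' - (k + 1)) : ℝ) ≤ (1 + ε) * w.choose (m' - k) := by
        obtain ⟨x, hx⟩ : ∃ x, m' - (k + 1) = x := ⟨_, rfl⟩
        have hx2 : m' - k = x + 1 := by omega
        have hxr : (x : ℝ) = m' - k - 1 := by
          have : x + k + 1 = m' := by omega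
          rw [← this]; push_cast; ring
        rw [hx, hx2]
        have hxw : x < w := by omega
        have e := Nat.choose_succ_right_eq w x
        have e' : (w.choose (x + 1) : ℝ) * (x + 1) = w.choose x * ((w : ℝ) - x) := by
          rw [← Nat.cast_sub hxw.le]; exact_mod_cast e
        have h4 : ((x : ℝ) + 1) ≤ (1 + ε) * ((w : ℝ) - x) := by rw [hxr]; nlinarith
        have hp : (0:ℝ) < (w:ℝ) - x := by
          have : (x : ℝ) < w := by exact_mod_cast hxw
          linarith
        refine le_of_mul_le_mul_right ?_ hp
        rw [← e']
        nlinarith [Nat.cast_nonneg (α := ℝ) (w.choose (x + 1))]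
      have e3 : j + (i + 1) = k + 1 := by omega
      rw [e3]
      calc ((M.choose (k + 1) * w.choose (m' - (k + 1)) : ℕ) : ℝ)
          = (M.choose (k + 1) : ℝ) * w.choose (m' - (k + 1)) := by push_cast; ring
        _ ≤ ((1 + ε) * M.choose k) * ((1 + ε) * w.choose (m' - k)) := by
            exact mul_le_mul a1 a2 (by positivity) (by positivity)
        _ = (1 + ε) ^ 2 * ((M.choose k * w.choose (m' - k) : ℕ) : ℝ) := by push_cast; ring
        _ ≤ (1 + ε) ^ 2 * ((1 + ε) ^ (2 * i) * ((M.choose j * w.choose (m' - j) : ℕ) : ℝ)) := by gcongr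
        _ = _ := by ring
  refine (key D le_rfl).trans ?_
  gcongr

lemma hyper (M w m m' D : ℕ) (ε : ℝ) (hε : 0 ≤ ε) (hDm : D ≤ m) (hmD : m + D ≤ m')
    (hw : m' - m + D ≤ w) (hMw : M + w ≤ 2 * m') (hc : 2 * m' ≤ w + 2 * m + 2 * D)
    (h1 : (M : ℝ) - m + D ≤ (1 + ε) * ((m : ℝ) - D + 1))
    (h2 : (m' : ℝ) - m + D ≤ (1 + ε) * ((w : ℝ) - m' + m - D + 1))
    (h3 : (1 + ε) ^ (2 * D) ≤ 2) :
    ((M + w).choose m' : ℝ) ≤ 6 * ∑ j ∈ range (m + 1), ((M.choose j * w.choose (m' - j) : ℕ) : ℝ) := by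
  have hr := reflect M w m' (2 * m' - w) (by omega) (by omega)
  set h : ℕ → ℕ := fun j => M.choose j * w.choose (m' - j) with hh
  have hs : (range (m' + 1)).filter (fun j => 2 * j ≤ 2 * m' - w) ⊆
      range (m + 1) ∪ ((range (m + 1)).filter (fun j => m ≤ j + D)).image (fun j => j + D) := by
    intro j hj
    simp only [mem_filter, mem_range, mem_union, mem_image] at hj ⊢
    by_cases hjm : j < m + 1
    · left; exact hjm
    · right
      exact ⟨j - D, ⟨by omega, by omega⟩, by omega⟩
  have hr2 : ((M + w).choose m' : ℝ) ≤ 2 * ∑ j ∈ (range (m' + 1)).filter (fun j => 2 * j ≤ 2 * m' - w), (h j : ℝ) := by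
    exact_mod_cast hr
  refine hr2.trans ?_
  have s1 : ∑ j ∈ (range (m' + 1)).filter (fun j => 2 * j ≤ 2 * m' - w), (h j : ℝ) ≤
      ∑ j ∈ range (m + 1), (h j : ℝ) +
      ∑ j ∈ ((range (m + 1)).filter (fun j => m ≤ j + D)).image (fun j => j + D), (h j : ℝ) := by
    refine (sum_le_sum_of_subset_of_nonneg hs fun _ _ _ => by positivity).trans ?_
    rw [← sum_union_inter]
    have : 0 ≤ ∑ x ∈ range (m + 1) ∩ ((range (m + 1)).filter (fun j => m ≤ j + D)).image (fun j => j + D), (h x : ℝ) :=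
      sum_nonneg fun _ _ => by positivity
    linarith
  have s2 : ∑ j ∈ ((range (m + 1)).filter (fun j => m ≤ j + D)).image (fun j => j + D), (h j : ℝ) ≤
      2 * ∑ j ∈ range (m + 1), (h j : ℝ) := by
    rw [sum_image (by intro x _ y _ hxy; simpa using hxy)]
    calc _ ≤ ∑ j ∈ (range (m + 1)).filter (fun j => m ≤ j + D), 2 * (h j : ℝ) := by
          refine sum_le_sum fun j hj => ?_
          simp only [mem_filter, mem_range] at hj
          exact window M w m m' D ε hε hDm hmD hw h1 h2 h3 j hj.2 (by omega)
      _ ≤ ∑ j ∈ range (m + 1), 2 * (h j : ℝ) :=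
          sum_le_sum_of_subset_of_nonneg (filter_subset _ _) fun _ _ _ => by positivity
      _ = _ := by rw [mul_sum]
  linarith

lemma family_mono {α : Type} (P : Finset α) (good : Finset α → Prop)
    (hgood : ∀ F F', F ⊆ F' → good F' → good F) (x : ℝ) (m j : ℕ) (hj : j ≤ m) (hm : m ≤ P.card)
    (h : x * (P.card.choose m : ℝ) ≤ (((powersetCard m P).filter good).card : ℝ)) :
    x * (P.card.choose j : ℝ) ≤ (((powersetCard j P).filter good).card : ℝ) := by
  induction m, hj using Nat.le_induction with
  | base => exact h
  | succ m hjm ih =>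
    refine ih (by omega) ?_
    have hdc : ((powersetCard (m + 1) P).filter good).card * (m + 1) ≤
        ((powersetCard m P).filter good).card * (P.card - m) := by
      refine Finset.card_mul_le_card_mul (fun F' F => F ⊆ F') ?_ ?_
      · intro F' hF'
        simp only [mem_filter, mem_powersetCard] at hF'
        have : (F'.image (fun x => F'.erase x)).card = m + 1 := by
          rw [card_image_of_injOn, hF'.1.2]
          intro x hx y hy hxy
          exact (erase_inj F' hx).1 hxy
        rw [← this]
        refine card_le_card ?_
        intro F hF
        simp only [mem_image] at hF
        obtain ⟨x, hx, rfl⟩ := hF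
        simp only [bipartiteAbove, mem_filter, mem_powersetCard]
        refine ⟨⟨⟨(erase_subset _ _).trans hF'.1.1, ?_⟩, hgood _ _ (erase_subset _ _) hF'.2⟩, erase_subset _ _⟩
        rw [card_erase_of_mem hx, hF'.1.2]; rfl
      · intro F hF
        simp only [mem_filter, mem_powersetCard] at hF
        have : ((P \ F).image (fun x => insert x F)).card ≤ P.card - m := by
          refine card_image_le.trans ?_
          rw [card_sdiff_of_subset hF.1.1, hF.1.2]
        refine le_trans (card_le_card ?_) this
        intro F' hF'
        simp only [bipartiteBelow, mem_filter, mem_powersetCard] at hF'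
        obtain ⟨⟨⟨hP, hc⟩, hg⟩, hs⟩ := hF'
        have : (F' \ F).card = 1 := by
          rw [card_sdiff_of_subset hs]; omega
        obtain ⟨x, hx⟩ := card_eq_one.1 this
        have hx2 : x ∈ F' \ F := by rw [hx]; simp
        have hx3 := Finset.mem_sdiff.1 hx2
        refine Finset.mem_image.2 ⟨x, Finset.mem_sdiff.2 ⟨hP hx3.1, hx3.2⟩, ?_⟩
        rw [← sdiff_union_of_subset hs, hx]
        rfl
    have e := Nat.choose_succ_right_eq P.card m
    have e' : (P.card.choose (m + 1) : ℝ) * ((m + 1 : ℕ) : ℝ) = P.card.choose m * ((P.card - m : ℕ) : ℝ) := by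
      exact_mod_cast e
    have hdc' : (((powersetCard (m + 1) P).filter good).card : ℝ) * ((m + 1 : ℕ) : ℝ) ≤
        (((powersetCard m P).filter good).card : ℝ) * ((P.card - m : ℕ) : ℝ) := by exact_mod_cast hdc
    have hp : (0:ℝ) < ((P.card - m : ℕ) : ℝ) := by
      have : 0 < P.card - m := by omega
      exact_mod_cast this
    refine le_of_mul_le_mul_right ?_ hp
    refine le_trans ?_ hdc'
    rw [mul_assoc, ← e', ← mul_assoc]
    exact mul_le_mul_of_nonneg_right h (by positivity)

end NC

open Filter
namespace NC
open Finset
open scoped Classical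

lemma gU_ge {V : Type} [Fintype V] {n : ℕ} (hn : 0 < n) (ι : Fin n ↪ V) (m τ : ℕ) :
    cc (Fin n) m τ ≤ ((powersetCard m (pairs (univ.map ι))).filter (fun F => Col F τ)).card := by
  unfold cc
  refine card_le_card_of_injOn (fun F => F.map ι.sym2Map) ?_ ?_
  · intro F hF
    have hF' := Finset.mem_filter.1 hF
    obtain ⟨h1, f, hf⟩ := hF'
    rw [mem_powersetCard] at h1
    refine Finset.mem_filter.2 ⟨mem_powersetCard.2 ⟨?_, by rw [card_map]; exact h1.2⟩, ?_⟩
    · intro p hp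
      obtain ⟨q, hq, rfl⟩ := Finset.mem_map.1 hp
      have h2 := (mem_EE _).1 (h1.1 hq)
      induction q with
      | _ x y =>
      have : ι.sym2Map s(x, y) = s(ι x, ι y) := rfl
      rw [this, mem_pairs]
      simp only [Sym2.mk_isDiag_iff] at h2
      refine ⟨fun h => h2 (ι.injective h), ?_, ?_⟩ <;> simp
    · refine ⟨Function.extend ι f (fun _ => f ⟨0, hn⟩), ?_⟩
      intro p hp
      obtain ⟨q, hq, rfl⟩ := Finset.mem_map.1 hp
      have h2 := hf q hq
      induction q with
      | _ x y =>
      have : ι.sym2Map s(x, y) = s(ι x, ι y) := rfl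
      rw [this]
      simp only [Sym2.map_mk, Sym2.mk_isDiag_iff, ι.injective.extend_apply] at h2 ⊢
      exact h2
  · intro F _ F' _ h
    exact Finset.map_injective _ h

lemma split_count {V : Type} [Fintype V] {r a : ℕ} (e : Fin r × Fin a ↪ V) (m m' τ : ℕ)
    (hm : m ≤ m') (U : Finset V) (hU : U = univ \ univ.map e) :
    ∑ j ∈ range (m + 1), ((powersetCard j (pairs U)).filter (fun F => Col F τ)).card *
      ((EE V).card - (DD e).card - (pairs U).card).choose (m' - j) ≤
    ((powersetCard m' (EE V)).filter (fun F => Disjoint F (DD e) ∧ Col F (τ + r))).card := by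
  have hUm : ∀ v, v ∈ U ↔ ∀ x, e x ≠ v := by
    intro v; rw [hU, Finset.mem_sdiff]; simp
  have hpd : Disjoint (pairs U) (DD e) := by
    rw [disjoint_left]
    intro p hp hd
    simp only [DD, mem_biUnion, mem_univ, true_and] at hd
    obtain ⟨i, hi⟩ := hd
    induction p with
    | _ x y =>
    rw [mem_pairs] at hp hi
    obtain ⟨z, hz⟩ := (mem_row _ _ _).1 hi.2.1
    exact (hUm x).1 hp.2.1 _ hz
  have hpE : pairs U ⊆ EE V := filter_subset _ _
  set R := (EE V \ DD e) \ pairs U with hR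
  have hRc : R.card = (EE V).card - (DD e).card - (pairs U).card := by
    rw [hR, card_sdiff_of_subset, card_sdiff_of_subset (DD_sub e)]
    intro p hp
    exact Finset.mem_sdiff.2 ⟨hpE hp, disjoint_left.1 hpd hp⟩
  have hRm : ∀ p, p ∈ R → p ∈ EE V ∧ p ∉ DD e ∧ p ∉ pairs U := by
    intro p hp
    have h1 := Finset.mem_sdiff.1 hp
    have h2 := Finset.mem_sdiff.1 h1.1
    exact ⟨h2.1, h2.2, h1.2⟩
  have hcard : ∑ j ∈ range (m + 1), ((powersetCard j (pairs U)).filter (fun F => Col F τ)).card *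
      ((EE V).card - (DD e).card - (pairs U).card).choose (m' - j) =
      ((range (m+1)).sigma (fun j => ((powersetCard j (pairs U)).filter (fun F => Col F τ)) ×ˢ
        powersetCard (m' - j) R)).card := by
    rw [card_sigma]
    refine sum_congr rfl (fun j _ => ?_)
    rw [card_product, card_powersetCard, hRc]
  rw [hcard]
  have key : ∀ (F1 F2 : Finset (Sym2 V)), F1 ⊆ pairs U → F2 ⊆ R → (F1 ∪ F2) ∩ pairs U = F1 := by
    intro F1 F2 h1 h2
    ext p
    simp only [mem_inter, mem_union]
    constructor
    · rintro ⟨h | h, h3⟩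
      · exact h
      · exact absurd h3 (hRm p (h2 h)).2.2
    · intro h; exact ⟨Or.inl h, h1 h⟩
  have key2 : ∀ (F1 F2 : Finset (Sym2 V)), F1 ⊆ pairs U → F2 ⊆ R → (F1 ∪ F2) ∩ R = F2 := by
    intro F1 F2 h1 h2
    ext p
    simp only [mem_inter, mem_union]
    constructor
    · rintro ⟨h | h, h3⟩
      · exact absurd (h1 h) (hRm p h3).2.2
      · exact h
    · intro h; exact ⟨Or.inr h, h2 h⟩
  refine card_le_card_of_injOn (fun x => x.2.1 ∪ x.2.2) ?_ ?_
  · rintro ⟨j, F1, F2⟩ hx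
    have hx := Finset.mem_sigma.1 hx
    obtain ⟨hj, hx⟩ := hx
    obtain ⟨hF1, hF2⟩ := Finset.mem_product.1 hx
    obtain ⟨hF1, f, hf⟩ := Finset.mem_filter.1 hF1
    have hF1 := mem_powersetCard.1 hF1
    have hF2 := mem_powersetCard.1 hF2
    dsimp only at hF1 hF2 hf hj
    have hj' := Finset.mem_range.1 hj
    refine Finset.mem_filter.2 ⟨mem_powersetCard.2 ⟨?_, ?_⟩, ?_, ?_⟩
    · exact union_subset (hF1.1.trans hpE) (fun p hp => (hRm p (hF2.1 hp)).1)
    · rw [card_union_of_disjoint]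
      · dsimp only; rw [hF1.2, hF2.2]; omega
      · rw [disjoint_left]; intro p h1 h2
        exact (hRm p (hF2.1 h2)).2.2 (hF1.1 h1)
    · rw [disjoint_union_left]
      refine ⟨disjoint_of_subset_left hF1.1 hpd, ?_⟩
      rw [disjoint_left]; intro p h1
      exact (hRm p (hF2.1 h1)).2.1
    · refine ⟨fun v => if h : ∃ x, e x = v then Fin.natAdd τ h.choose.1 else Fin.castAdd r (f v), ?_⟩
      intro p hp
      have hpR : p ∈ F1 ∨ p ∈ R := (Finset.mem_union.1 hp).imp id (fun h => hF2.1 h)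
      induction p with
      | _ x y =>
      simp only [Sym2.map_mk, Sym2.mk_isDiag_iff]
      by_cases hxU : ∃ z, e z = x
      · by_cases hyU : ∃ z, e z = y
        · rw [dif_pos hxU, dif_pos hyU]
          intro h
          have h := Fin.natAdd_injective _ _ h
          have hxr : x ∈ row e hxU.choose.1 := (mem_row _ _ _).2 ⟨hxU.choose.2, hxU.choose_spec⟩
          have hyr : y ∈ row e hxU.choose.1 := by
            rw [h]; exact (mem_row _ _ _).2 ⟨hyU.choose.2, hyU.choose_spec⟩
          rcases hpR with h1 | h1
          · have := (mem_pairs _ _ _).1 (hF1.1 h1)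
            obtain ⟨z, hz⟩ := hxU
            exact (hUm x).1 this.2.1 z hz
          · have h2 := hRm _ h1
            apply h2.2.1
            simp only [DD, mem_biUnion, mem_univ, true_and]
            refine ⟨hxU.choose.1, (mem_pairs _ _ _).2 ⟨?_, hxr, hyr⟩⟩
            have := (mem_EE _).1 h2.1
            simpa using this
        · rw [dif_pos hxU, dif_neg hyU]
          intro h
          have := congrArg Fin.val h
          simp at this
          have := (f y).2
          omega
      · by_cases hyU : ∃ z, e z = y
        · rw [dif_neg hxU, dif_pos hyU]
          intro h
          have := congrArg Fin.val h
          simp at this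
          have := (f x).2
          omega
        · rw [dif_neg hxU, dif_neg hyU]
          intro h
          have h := Fin.castAdd_injective _ _ h
          rcases hpR with h1 | h1
          · have := hf _ h1
            simp only [Sym2.map_mk, Sym2.mk_isDiag_iff] at this
            exact this h
          · have h2 := hRm _ h1
            apply h2.2.2
            refine (mem_pairs _ _ _).2 ⟨?_, (hUm x).2 (fun z hz => hxU ⟨z, hz⟩), (hUm y).2 (fun z hz => hyU ⟨z, hz⟩)⟩
            have := (mem_EE _).1 h2.1
            simpa using this
  · rintro ⟨j, F1, F2⟩ hx ⟨j', F1', F2'⟩ hx' h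
    obtain ⟨hj, hx⟩ := Finset.mem_sigma.1 hx
    obtain ⟨hF1, hF2⟩ := Finset.mem_product.1 hx
    have hF1 := mem_powersetCard.1 (Finset.mem_filter.1 hF1).1
    have hF2 := mem_powersetCard.1 hF2
    obtain ⟨hj', hx'⟩ := Finset.mem_sigma.1 hx'
    obtain ⟨hF1', hF2'⟩ := Finset.mem_product.1 hx'
    have hA := mem_powersetCard.1 (Finset.mem_filter.1 hF1').1
    have hB := mem_powersetCard.1 hF2'
    dsimp only at hF1 hF2 hA hB h
    have e1 : F1 = F1' := by
      rw [← key F1 F2 hF1.1 hF2.1, h, key F1' F2' hA.1 hB.1]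
    have e2 : F2 = F2' := by
      rw [← key2 F1 F2 hF1.1 hF2.1, h, key2 F1' F2' hA.1 hB.1]
    subst e1 e2
    have : j = j' := by rw [← hF1.2, ← hA.2]
    subst this
    rfl

/-- combined -/
lemma split_lb {V : Type} [Fintype V] {n n' r a : ℕ} (hV : Fintype.card V = n') (hn : 0 < n) (e : Fin r × Fin a ↪ V) (hnn : n + r * a = n')
    (m m' D τ : ℕ) (ε : ℝ) (hε : 0 ≤ ε) (hmN : m ≤ n.choose 2)
    (hcc : (1/2 : ℝ) * ((n.choose 2).choose m : ℝ) ≤ cc (Fin n) m τ)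
    (w : ℕ) (hw0 : n.choose 2 + w + r * a.choose 2 = n'.choose 2)
    (hDm : D ≤ m) (hmD : m + D ≤ m') (hw : m' - m + D ≤ w) (hMw : n.choose 2 + w ≤ 2 * m')
    (hc : 2 * m' ≤ w + 2 * m + 2 * D)
    (h1 : ((n.choose 2 : ℕ) : ℝ) - m + D ≤ (1+ε) * ((m:ℝ) - D + 1))
    (h2 : (m':ℝ) - m + D ≤ (1+ε) * ((w:ℝ) - m' + m - D + 1))
    (h3 : (1+ε)^(2*D) ≤ 2) :
    (1/12 : ℝ) * ((n'.choose 2 - r * a.choose 2).choose m' : ℝ) ≤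
      (((powersetCard m' (EE V)).filter (fun F => Disjoint F (DD e) ∧ Col F (τ + r))).card : ℝ) := by
  set U : Finset V := univ \ univ.map e with hU
  have hUc : U.card = n := by
    rw [hU, card_sdiff_of_subset (subset_univ _), card_map]
    simp [hV]; omega
  have hPc : (pairs U).card = n.choose 2 := by rw [card_pairs, hUc]
  have hsp := split_count e m m' τ (by omega) U hU
  have hww : (EE V).card - (DD e).card - (pairs U).card = w := by
    rw [card_EE, card_DD, hPc, hV]; omega
  rw [hww] at hsp
  have hy := hyper (n.choose 2) w m m' D ε hε hDm hmD hw hMw hc h1 h2 h3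
  have hMw2 : n.choose 2 + w = n'.choose 2 - r * a.choose 2 := by omega
  rw [hMw2] at hy
  have hUi : ∃ ι : Fin n ↪ V, univ.map ι = U := by
    refine ⟨(U.equivFinOfCardEq hUc).symm.toEmbedding.trans (Function.Embedding.subtype _), ?_⟩
    ext v
    simp only [Finset.mem_map, mem_univ, true_and]
    constructor
    · rintro ⟨x, rfl⟩
      exact ((U.equivFinOfCardEq hUc).symm x).2
    · intro hv
      exact ⟨U.equivFinOfCardEq hUc ⟨v, hv⟩, by simp⟩
  obtain ⟨ι, hι⟩ := hUi
  have hg := gU_ge hn ι m τ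
  rw [hι] at hg
  have hgj : ∀ j ∈ range (m+1), (1/2 : ℝ) * ((n.choose 2).choose j : ℝ) ≤
      (((powersetCard j (pairs U)).filter (fun F => Col F τ)).card : ℝ) := by
    intro j hj
    have := family_mono (pairs U) (fun F => Col F τ) (fun F F' h h' => Col.mono h h') (1/2) m j
      (by have := Finset.mem_range.1 hj; omega) (by rw [hPc]; exact hmN) (by
        rw [hPc]; exact hcc.trans (by exact_mod_cast hg))
    rw [hPc] at this
    exact this
  calc (1/12 : ℝ) * ((n'.choose 2 - r * a.choose 2).choose m' : ℝ)
      ≤ (1/2) * ∑ j ∈ range (m+1), (((n.choose 2).choose j * w.choose (m' - j) : ℕ) : ℝ) := by linarith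
    _ ≤ ∑ j ∈ range (m + 1), (((powersetCard j (pairs U)).filter (fun F => Col F τ)).card : ℝ) *
      (w.choose (m' - j) : ℝ) := by
        rw [mul_sum]
        refine sum_le_sum (fun j hj => ?_)
        push_cast
        rw [← mul_assoc]
        exact mul_le_mul_of_nonneg_right (hgj j hj) (by positivity)
    _ ≤ _ := by exact_mod_cast hsp

end NC

open Filter
namespace NC
open Finset
open scoped Classical

lemma two_choose (n : ℕ) : 2 * n.choose 2 + n = n ^ 2 := by
  induction n with
  | zero => rfl
  | succ k ih =>
    have := Nat.choose_succ_succ k 1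
    rw [Nat.choose_one_right] at this
    have h : (k+1).choose 2 = k + k.choose 2 := this
    rw [h]; nlinarith

lemma floor4 (n : ℕ) : 4 * (n ^ 2 / 4) ≤ n ^ 2 ∧ n ^ 2 ≤ 4 * (n ^ 2 / 4) + 1 := by
  have : n ^ 2 % 4 ≤ 1 := by
    have h : n % 4 < 4 := Nat.mod_lt _ (by norm_num)
    rw [Nat.pow_mod]
    interval_cases (n % 4) <;> norm_num
  omega

lemma exp_half : Real.exp (1/2) ≤ 2 := by
  have h := Real.exp_one_lt_d9
  have h2 : Real.exp (1/2) ^ 2 = Real.exp 1 := by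
    rw [← Real.exp_nat_mul]; norm_num
  nlinarith [Real.exp_pos (1/2)]

lemma ar1 (n x a m m' w : ℝ) (e2 : n^2 ≤ 4 * m + 1) (e3 : 4 * m' ≤ n^2 + 2 * (n * x) + x^2)
    (e5 : 2 * w + x * a = 2 * (n * x) + x^2) (e6 : 40 * (x * a) ≤ n) (e7 : n ≤ n * x) (e8 : 1 ≤ x * a) :
    n * x / 4 ≤ w - m' + m - x * a + 1 := by
  nlinarith [sq_nonneg x]

lemma ar2 (n f m' N : ℝ) (e3 : 2 * N + n = n^2) (e4 : 4 * m' ≤ n^2) (e5 : 2 * f ≤ n) (e6 : 40 ≤ n) :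
    n^2 / 8 ≤ N - f - m' := by
  nlinarith

set_option maxHeartbeats 2000000 in
lemma planted_gen {V : Type} [Fintype V] (n r a τ : ℕ) (hV : Fintype.card V = n + r * a) (hr : 1 ≤ r) (ha : 1 ≤ a) (h1 : 40 * r * a ^ 3 ≤ n)
    (h2 : 2 * r ^ 2 * a ^ 2 ≤ n) (hG : Gs (n + r * a) a ^ (r * r) ≤ 3)
    (hcc : (1/2 : ℝ) * ((n.choose 2).choose (n^2/4) : ℝ) ≤ cc (Fin n) (n^2/4) τ) :
    (((n + r * a).choose 2).choose ((n + r * a)^2/4) : ℝ) ≤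
      1728 * (cc V ((n + r * a)^2/4) (τ + r) : ℝ) := by
  set n' := n + r * a with hn'
  set m := n^2/4 with hm
  set m' := n'^2/4 with hm'
  obtain ⟨m1, m2⟩ := floor4 n
  obtain ⟨m1', m2'⟩ := floor4 n'
  rw [← hm] at m1 m2
  rw [← hm'] at m1' m2'
  have c1 := two_choose n
  have c2 := two_choose n'
  have c3 := two_choose a
  have c4 := two_choose r
  set M := n.choose 2
  set N := n'.choose 2
  set A := a.choose 2
  set Rr := r.choose 2
  have hra1 : 1 ≤ r * a := Nat.mul_pos hr ha
  have hra2 : r * a ≤ r * a ^ 2 := Nat.mul_le_mul_left _ (Nat.le_self_pow (by norm_num) _)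
  have hra3 : r * a ^ 2 ≤ r * a ^ 3 := by
    have : a ^ 2 ≤ a ^ 3 := Nat.pow_le_pow_right ha (by norm_num)
    exact Nat.mul_le_mul_left _ this
  have h1b : 40 * (r * a ^ 3) ≤ n := by rw [← mul_assoc]; exact h1
  have hD : 40 * (r * a ^ 2) ≤ n := by omega
  have hx : 40 * (r * a) ≤ n := by omega
  have hn40 : 40 ≤ n := by omega
  set x := r * a with hxd
  have hDx : r * a ^ 2 = x * a := by rw [hxd]; ring
  have hfx : 2 * (r * A) + x = x * a := by
    calc 2 * (r * A) + x = r * (2 * A + a) := by rw [hxd]; ring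
      _ = x * a := by rw [c3, hxd]; ring
  have hax : a ≤ x := Nat.le_mul_of_pos_left _ hr
  -- w
  set w := x * n + Rr * a ^ 2 with hw
  have hwx : 2 * w + x * a = 2 * (n * x) + x ^ 2 := by
    rw [hw]
    have : 2 * (Rr * a^2) + x * a = x ^ 2 := by
      have : 2 * (Rr * a^2) + x * a = (2 * Rr + r) * a ^ 2 := by rw [hxd]; ring
      rw [this, c4, hxd]; ring
    have h2 : x * n = n * x := mul_comm _ _
    omega
  have hn2 : n' ^ 2 = n ^ 2 + 2 * (n * x) + x ^ 2 := by rw [hn']; ring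
  rw [hn2] at m1' m2'
  have hxx : 40 * x ^ 2 ≤ n * x := by
    rw [pow_two, ← mul_assoc]; exact Nat.mul_le_mul_right _ hx
  have hxa : 40 * (x * a) ≤ n := by rw [← hDx]; exact hD
  have hnx : n ≤ n * x := Nat.le_mul_of_pos_right _ hra1
  have hw0 : M + w + r * A = N := by
    rw [hn2] at c2; omega
  have hnn : 40 * n ≤ n ^ 2 := by rw [pow_two]; exact Nat.mul_le_mul_right _ hn40
  have hfA : r * A + m' ≤ N := by
    rw [hn2] at c2; omega
  have hnR : (0:ℝ) < n := by exact_mod_cast (by omega : 0 < n)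
  have hnR' : (0:ℝ) < n' := by exact_mod_cast (by omega : 0 < n')
  have hpl : ∀ e : Fin r × Fin a ↪ V, (1/12 : ℝ) * ((N - r * A).choose m' : ℝ) ≤
      (((powersetCard m' (EE (V))).filter (fun F => Disjoint F (DD e) ∧ Col F (τ + r))).card : ℝ) := by
    intro e
    have hh2 : (m':ℝ) - m + (x * a : ℕ) ≤ (1+ 10 * a / n) * ((w:ℝ) - m' + m - (x * a : ℕ) + 1) := by
      have e1 : (4:ℝ) * m ≤ n^2 := by exact_mod_cast m1
      have e2 : (n:ℝ)^2 ≤ 4 * m + 1 := by exact_mod_cast m2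
      have e3 : (4:ℝ) * m' ≤ n^2 + 2 * (n * x) + x^2 := by exact_mod_cast m1'
      have e5 : 2 * (w:ℝ) + x * a = 2 * (n * x) + x^2 := by exact_mod_cast hwx
      have e6 : (40:ℝ) * (x * a) ≤ n := by exact_mod_cast hxa
      have e7 : (n:ℝ) ≤ n * x := by exact_mod_cast hnx
      have e8 : (1:ℝ) ≤ x * a := by exact_mod_cast (Nat.mul_pos hra1 ha)
      have hcx : ((x * a : ℕ) : ℝ) = (x:ℝ) * a := Nat.cast_mul x a
      rw [hcx]
      have key : (n:ℝ) * x / 4 ≤ (w:ℝ) - m' + m - x * a + 1 :=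
         ar1 _ _ _ _ _ _ e2 e3 e5 e6 e7 e8
      have key2 : (10 * a / n : ℝ) * (n * x / 4) = 5 / 2 * (x * a) := by field_simp; ring
      have key3 : (10 * a / n : ℝ) * (n * x / 4) ≤ (10 * a / n) * ((w:ℝ) - m' + m - x * a + 1) :=
        mul_le_mul_of_nonneg_left key (by positivity)
      rw [key2] at key3
      rw [add_mul, one_mul]
      linarith [sq_nonneg (x:ℝ)]
    have := split_lb (n := n) (n' := n') hV (by omega) e rfl m m' (x * a) τ (10 * a / n) (by positivity)
      (by omega) hcc w hw0 (by omega) (by omega) (by omega) (by omega) (by omega) (by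
        have e0 : (M:ℝ) - m + (x * a : ℕ) ≤ (m:ℝ) - (x * a : ℕ) + 1 := by
          have : M + 2 * (x * a) ≤ 2 * m + 1 := by omega
          have : (M:ℝ) + 2 * (x * a : ℕ) ≤ 2 * m + 1 := by exact_mod_cast this
          linarith
        refine e0.trans ?_
        refine le_mul_of_one_le_left ?_ ?_
        · have : x * a ≤ m := by omega
          have : ((x * a : ℕ):ℝ) ≤ m := by exact_mod_cast this
          linarith
        · have : (0:ℝ) ≤ 10 * a / n := by positivity
          linarith) hh2 (by
        have e1 : (1 + 10 * a / n : ℝ) ≤ Real.exp (10 * a / n) := by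
          rw [add_comm]; exact Real.add_one_le_exp _
        have e2 : (1 + 10 * a / n : ℝ) ^ (2 * (x * a)) ≤ Real.exp (10 * a / n) ^ (2 * (x * a)) :=
          pow_le_pow_left₀ (by positivity) e1 _
        rw [← Real.exp_nat_mul] at e2
        refine e2.trans ?_
        have e3 : ((2 * (x * a) : ℕ) : ℝ) * (10 * a / n) ≤ 1/2 := by
          have : (40:ℝ) * (r * a ^ 3) ≤ n := by
            have : 40 * (r * a ^ 3) ≤ n := by rw [← mul_assoc]; exact h1
            exact_mod_cast this
          rw [hxd]; push_cast
          rw [mul_div_assoc', div_le_iff₀ hnR]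
          have e9 : 2 * ((r:ℝ) * a * a) * (10 * a) = 20 * (r * a ^ 3) := by ring
          linarith
        refine (Real.exp_le_exp.2 e3).trans ?_
        exact exp_half)
    exact this
  -- second moment
  have hsm := second_moment (V := V) r a m' (2 * (1 + 4 / n')) (by
      have : (0:ℝ) ≤ 4 / n' := by positivity
      linarith) (by rw [hV]; omega) (by rw [hV]; exact hfA) (by
      rw [hV]
      have e1 : ((N - r * A : ℕ) : ℝ) = N - (r * A : ℕ) := by
        rw [Nat.cast_sub (by omega)]
      have e2 : ((N - r * A - m' : ℕ) : ℝ) = N - (r * A : ℕ) - m' := by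
        rw [Nat.cast_sub (by omega), e1]
      rw [e1, e2]
      have e3 : (2:ℝ) * N + n' = n' ^ 2 := by exact_mod_cast c2
      have e4 : (4:ℝ) * m' ≤ n' ^ 2 := by rw [← hn2] at m1'; exact_mod_cast m1'
      have e5 : 2 * ((r * A : ℕ) : ℝ) ≤ n' := by
        have : 2 * (r * A) ≤ n' := by omega
        exact_mod_cast this
      have e6 : (40:ℝ) ≤ n' := by exact_mod_cast (by omega : 40 ≤ n')
      have key : (n':ℝ)^2 / 8 ≤ N - (r * A : ℕ) - m' := ar2 _ _ _ _ e3 e4 e5 e6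
      have key3 : (4 / n' : ℝ) * ((n':ℝ)^2 / 8) ≤ (4 / n') * (N - (r * A : ℕ) - m') :=
        mul_le_mul_of_nonneg_left key (by positivity)
      have key2 : (4 / n' : ℝ) * ((n':ℝ)^2 / 8) = n' / 2 := by field_simp; ring
      rw [key2] at key3
      rw [mul_assoc, add_mul, one_mul]
      linarith) (by
      have e1 : (2 * (1 + 4 / n' : ℝ)) / 2 = 1 + 4 / n' := by ring
      rw [e1]
      have e1 : (1 + 4 / n' : ℝ) ≤ Real.exp (4 / n') := by
        rw [add_comm]; exact Real.add_one_le_exp _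
      have e2 : (1 + 4 / n' : ℝ) ^ (r * A) ≤ Real.exp (4 / n') ^ (r * A) :=
        pow_le_pow_left₀ (by positivity) e1 _
      rw [← Real.exp_nat_mul] at e2
      refine e2.trans ?_
      have e3 : ((r * A : ℕ) : ℝ) * (4 / n') ≤ 1/2 := by
        have : 8 * (r * A) ≤ n' := by omega
        have : (8:ℝ) * (r * A : ℕ) ≤ n' := by exact_mod_cast this
        rw [mul_div_assoc', div_le_iff₀ hnR']
        linarith
      refine (Real.exp_le_exp.2 e3).trans ?_
      exact exp_half)
  rw [hV] at hsm
  have hGs0 : 0 ≤ Gs n' a ^ (r * r) := by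
    have : 0 ≤ Gs n' a := by
      unfold Gs wt pw
      refine sum_nonneg (fun l _ => ?_)
      split_ifs <;> positivity
    positivity
  have hdesc : ((n'.descFactorial a : ℝ)) ^ r ≤ 2 * (n'.descFactorial (r * a) : ℝ) := by
    have d1 : (n'.descFactorial a : ℝ) ^ r ≤ (n' : ℝ) ^ x := by
      have : (n'.descFactorial a) ≤ n' ^ a := Nat.descFactorial_le_pow _ _
      have : (n'.descFactorial a : ℝ) ≤ (n':ℝ) ^ a := by exact_mod_cast this
      calc (n'.descFactorial a : ℝ) ^ r ≤ ((n':ℝ) ^ a) ^ r := pow_le_pow_left₀ (by positivity) this _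
        _ = _ := by rw [← pow_mul, hxd, mul_comm]
    have d2 : (n:ℝ) ^ x ≤ (n'.descFactorial x : ℝ) := by
      have h := Nat.pow_sub_le_descFactorial n' x
      have : n ^ x ≤ n'.descFactorial x := le_trans (Nat.pow_le_pow_left (by omega) _) h
      exact_mod_cast this
    have d3 : (n':ℝ) ^ x ≤ 2 * (n:ℝ)^x := by
      have e1 : (n' : ℝ) = n * (1 + x / n) := by rw [hn']; push_cast; field_simp
      rw [e1, mul_pow, mul_comm]
      refine mul_le_mul_of_nonneg_right ?_ (by positivity)
      have e1 : (1 + x / n : ℝ) ≤ Real.exp (x / n) := by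
        rw [add_comm]; exact Real.add_one_le_exp _
      have e2 : (1 + x / n : ℝ) ^ x ≤ Real.exp (x / n) ^ x :=
        pow_le_pow_left₀ (by positivity) e1 _
      rw [← Real.exp_nat_mul] at e2
      refine e2.trans ?_
      have e3 : (x : ℝ) * (x / n) ≤ 1/2 := by
        have : 2 * (x * x) ≤ n := by
          calc 2 * (x * x) = 2 * r ^ 2 * a ^ 2 := by rw [hxd]; ring
            _ ≤ n := h2
        have : (2:ℝ) * (x * x) ≤ n := by exact_mod_cast this
        rw [mul_div_assoc', div_le_iff₀ hnR]
        linarith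
      refine (Real.exp_le_exp.2 e3).trans ?_
      exact exp_half
    linarith
  have hB := planted (V := V) r a m' (τ + r) (1/12) 12 (by norm_num) (by rw [hV]; exact hfA)
    (by rw [hV]; omega) (by
      rw [hV]
      refine hsm.trans ?_
      rw [mul_pow, ← pow_mul]
      set C := ((N - r * A).choose m' : ℝ)
      set Q := (n'.descFactorial (r * a) : ℝ)
      have hQ : 0 ≤ Q := by positivity
      calc 2 * C ^ 2 * Q * ((n'.descFactorial a : ℝ) ^ r * Gs n' a ^ (r * r))
          ≤ 2 * C ^ 2 * Q * ((2 * Q) * 3) := by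
            refine mul_le_mul_of_nonneg_left ?_ (by positivity)
            exact mul_le_mul hdesc hG hGs0 (by positivity)
        _ = 12 * (C * Q) ^ 2 := by ring) (by
      rw [hV]; exact hpl)
  rw [hV] at hB
  have : ((1/12:ℝ)^2 * (N.choose m' : ℝ)) ≤ 12 * (cc (V) m' (τ + r) : ℝ) := hB
  linarith

lemma planted_main (n r a τ : ℕ) (hr : 1 ≤ r) (ha : 1 ≤ a) (h1 : 40 * r * a ^ 3 ≤ n)
    (h2 : 2 * r ^ 2 * a ^ 2 ≤ n) (hG : Gs (n + r * a) a ^ (r * r) ≤ 3)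
    (hcc : (1/2 : ℝ) * ((n.choose 2).choose (n^2/4) : ℝ) ≤ cc (Fin n) (n^2/4) τ) :
    (((n + r * a).choose 2).choose ((n + r * a)^2/4) : ℝ) ≤
      1728 * (cc (Fin (n + r * a)) ((n + r * a)^2/4) (τ + r) : ℝ) :=
  planted_gen n r a τ (Fintype.card_fin _) hr ha h1 h2 hG hcc

end NC

open Filter
namespace NC
open Finset
open scoped Classical

lemma desc_pow (a n l : ℕ) (h : a ≤ n) : a.descFactorial l * n ^ l ≤ a ^ l * n.descFactorial l := by
  induction l with
  | zero => simp
  | succ l ih =>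
    rw [Nat.descFactorial_succ, Nat.descFactorial_succ, pow_succ, pow_succ]
    have h1 : (a - l) * n ≤ a * (n - l) := by
      by_cases hl : l ≤ a
      · obtain ⟨b, rfl⟩ := Nat.exists_eq_add_of_le hl
        obtain ⟨c, rfl⟩ := Nat.exists_eq_add_of_le h
        have e1 : l + b - l = b := by omega
        have e2 : l + b + c - l = b + c := by omega
        rw [e1, e2]; nlinarith [Nat.zero_le (l*c)]
      · have : a - l = 0 := by omega
        simp [this]
    calc (a - l) * a.descFactorial l * (n ^ l * n) = ((a - l) * n) * (a.descFactorial l * n ^ l) := by ring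
      _ ≤ (a * (n - l)) * (a ^ l * n.descFactorial l) := Nat.mul_le_mul h1 ih
      _ = _ := by ring

noncomputable def tm (n a l : ℕ) : ℝ :=
  (a.choose l : ℝ) * (2 ^ (l.choose 2) * ((a.descFactorial l : ℝ) / (n.descFactorial l : ℝ)))

lemma tm_nonneg (n a l : ℕ) : 0 ≤ tm n a l := by unfold tm; positivity

lemma tm_small (n a l : ℕ) (ha : 4 ≤ a) (hA : a ^ 40 ≤ 2 ^ a) (g1 : 2 ^ a ≤ n ^ 2) (han : a ≤ n)
    (hl2 : 2 ≤ l) (hl : 4 * l ≤ 3 * a) : (tm n a l) ^ 2 * ((a:ℝ) ^ 2 * 2 ^ a) ≤ 1 := by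
  have hnR : (0:ℝ) < n := by exact_mod_cast (by omega : 0 < n)
  have haR : (4:ℝ) ≤ a := by exact_mod_cast ha
  have hd : (0:ℝ) < n.descFactorial l := by
    have : 0 < n.descFactorial l := Nat.descFactorial_pos.2 (by omega)
    exact_mod_cast this
  have g1R : (2:ℝ) ^ a ≤ (n:ℝ) ^ 2 := by exact_mod_cast g1
  have hAR : (a:ℝ) ^ 40 ≤ 2 ^ a := by exact_mod_cast hA
  have h1 : (a.descFactorial l : ℝ) / n.descFactorial l ≤ (a / n : ℝ) ^ l := by
    rw [div_pow, div_le_div_iff₀ hd (by positivity)]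
    exact_mod_cast desc_pow a n l han
  have h2 : (a.choose l : ℝ) ≤ (a:ℝ) ^ l := by exact_mod_cast Nat.choose_le_pow a l
  have h3 : ((2:ℝ) ^ (l.choose 2)) ^ 2 = (2 ^ (l - 1)) ^ l := by
    rw [← pow_mul, ← pow_mul]
    congr 1
    have := two_choose l
    have e : (l - 1) * l + l = l ^ 2 := by
      obtain ⟨b, rfl⟩ := Nat.exists_eq_add_of_le (show 1 ≤ l by omega)
      have e1 : 1 + b - 1 = b := by omega
      rw [e1]; ring
    omega
  set X : ℝ := (a:ℝ) ^ 4 * 2 ^ (l - 1) / 2 ^ a with hX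
  have hX0 : 0 ≤ X := by positivity
  have hT : (tm n a l) ^ 2 ≤ X ^ l := by
    have : tm n a l ≤ (a:ℝ) ^ l * (2 ^ (l.choose 2) * (a / n : ℝ) ^ l) := by
      unfold tm; gcongr
    calc (tm n a l) ^ 2 ≤ ((a:ℝ) ^ l * (2 ^ (l.choose 2) * (a / n : ℝ) ^ l)) ^ 2 :=
          pow_le_pow_left₀ (tm_nonneg _ _ _) this _
      _ = ((a:ℝ) ^ 4 * 2 ^ (l - 1) / n ^ 2) ^ l := by
          rw [mul_pow, mul_pow, h3]
          have q1 : ((a:ℝ) ^ l) ^ 2 = (a ^ 2) ^ l := by ring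
          have q2 : ((a / n : ℝ) ^ l) ^ 2 = ((a / n) ^ 2) ^ l := by ring
          rw [q1, q2, ← mul_pow, ← mul_pow]
          congr 1
          field_simp
      _ ≤ X ^ l := by
          rw [hX]; gcongr
  have hp : (0:ℝ) < 2 ^ a := by positivity
  have h1a : (1:ℝ) ≤ a := by linarith
  by_cases hl8 : l < 8
  · have hX1 : X ≤ (a:ℝ)^4 * 2 ^ 6 / 2 ^ a := by
      rw [hX]; gcongr
      · norm_num
      · omega
    have hX3 : (a:ℝ)^4 * 2 ^ 6 ≤ (a:ℝ) ^ 7 := by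
      have : (4:ℝ) ^ 3 ≤ a ^ 3 := by gcongr
      calc (a:ℝ)^4 * 2 ^ 6 = (a:ℝ) ^ 4 * 4 ^ 3 := by norm_num
        _ ≤ (a:ℝ) ^ 4 * a ^ 3 := by gcongr
        _ = _ := by ring
    have hX4 : X ≤ (a:ℝ) ^ 7 / 2 ^ a := hX1.trans (by gcongr)
    have hXl : X ≤ 1 := by
      refine hX4.trans ((div_le_one hp).2 (le_trans ?_ hAR))
      exact pow_le_pow_right₀ h1a (by norm_num)
    have : X ^ l ≤ X ^ 2 := pow_le_pow_of_le_one hX0 hXl hl2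
    have h4 : X ^ 2 ≤ ((a:ℝ) ^ 7 / 2 ^ a) ^ 2 := pow_le_pow_left₀ hX0 hX4 _
    calc (tm n a l) ^ 2 * ((a:ℝ) ^ 2 * 2 ^ a) ≤ ((a:ℝ) ^ 7 / 2 ^ a) ^ 2 * ((a:ℝ) ^ 2 * 2 ^ a) := by
          refine mul_le_mul_of_nonneg_right ?_ (by positivity); linarith
      _ = (a:ℝ) ^ 16 / 2 ^ a := by field_simp
      _ ≤ 1 := (div_le_one hp).2 (le_trans (pow_le_pow_right₀ h1a (by norm_num)) hAR)
  · have hY : X ^ 4 ≤ (a:ℝ) ^ 16 / 2 ^ a := by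
      rw [hX, div_pow, mul_pow, ← pow_mul, ← pow_mul, ← pow_mul, div_le_div_iff₀ (by positivity) hp, mul_assoc, ← pow_add]
      gcongr
      · norm_num
      · omega
    have hY1 : (a:ℝ) ^ 16 / 2 ^ a ≤ 1 := (div_le_one hp).2 (le_trans (pow_le_pow_right₀ h1a (by norm_num)) hAR)
    have hX1 : X ≤ 1 := by
      by_contra hc
      push Not at hc
      have := one_lt_pow₀ hc (n := 4) (by norm_num)
      linarith
    have h5 : X ^ l ≤ X ^ 8 := pow_le_pow_of_le_one hX0 hX1 (by omega)
    have h6 : X ^ 8 ≤ ((a:ℝ) ^ 16 / 2 ^ a) ^ 2 := by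
      have : X ^ 8 = (X ^ 4) ^ 2 := by ring
      rw [this]; exact pow_le_pow_left₀ (by positivity) hY _
    calc (tm n a l) ^ 2 * ((a:ℝ) ^ 2 * 2 ^ a) ≤ ((a:ℝ) ^ 16 / 2 ^ a) ^ 2 * ((a:ℝ) ^ 2 * 2 ^ a) := by
          refine mul_le_mul_of_nonneg_right ?_ (by positivity); linarith
      _ = (a:ℝ) ^ 34 / 2 ^ a := by field_simp
      _ ≤ 1 := (div_le_one hp).2 (le_trans (pow_le_pow_right₀ h1a (by norm_num)) hAR)

lemma tm_step (n a l : ℕ) (hl : l < a) (han : a ≤ n) (h : a * n ≤ 2 ^ l) : tm n a l ≤ tm n a (l + 1) := by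
  have e1 := Nat.choose_succ_right_eq a l
  have e1R : (a.choose (l+1) : ℝ) * (l + 1) = a.choose l * ((a - l : ℕ) : ℝ) := by exact_mod_cast e1
  have e2 : ((l+1).choose 2) = l + l.choose 2 := by
    have := Nat.choose_succ_succ l 1
    rw [Nat.choose_one_right] at this
    exact this
  have hd : (0:ℝ) < n.descFactorial l := by
    have : 0 < n.descFactorial l := Nat.descFactorial_pos.2 (by omega)
    exact_mod_cast this
  have hnl : (0:ℝ) < ((n - l : ℕ) : ℝ) := by exact_mod_cast (by omega : 0 < n - l)
  have hal : (1:ℝ) ≤ ((a - l : ℕ) : ℝ) := by exact_mod_cast (by omega : 1 ≤ a - l)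
  have hfac : tm n a (l+1) = tm n a l * ((((a - l : ℕ) : ℝ) / (l + 1)) * 2 ^ l * (((a - l : ℕ) : ℝ) / ((n - l : ℕ) : ℝ))) := by
    unfold tm
    rw [e2, Nat.descFactorial_succ, Nat.descFactorial_succ, pow_add]
    have : (a.choose (l+1) : ℝ) = a.choose l * ((a - l : ℕ) : ℝ) / (l + 1) := by
      rw [eq_div_iff (by positivity)]; exact e1R
    rw [this]
    push_cast
    field_simp
  rw [hfac]
  refine le_mul_of_one_le_right (tm_nonneg _ _ _) ?_
  have hlR : (0:ℝ) < (l:ℝ) + 1 := by positivity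
  have : (((a - l : ℕ) : ℝ) / (l + 1)) * 2 ^ l * (((a - l : ℕ) : ℝ) / ((n - l : ℕ) : ℝ)) =
      (((a - l : ℕ) : ℝ) * ((a - l : ℕ) : ℝ) * 2 ^ l) / ((l + 1) * ((n - l : ℕ) : ℝ)) := by
    field_simp
  rw [this, one_le_div (by positivity)]
  have h3 : ((l:ℝ) + 1) * ((n - l : ℕ) : ℝ) ≤ 2 ^ l := by
    have : (l + 1) * (n - l) ≤ 2 ^ l := le_trans (Nat.mul_le_mul (by omega) (by omega)) h
    exact_mod_cast this
  refine h3.trans ?_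
  refine le_mul_of_one_le_left (by positivity) ?_
  nlinarith

lemma tm_le_top (n a l : ℕ) (hl : l ≤ a) (han : a ≤ n) (h : a * n ≤ 2 ^ l) : tm n a l ≤ tm n a a := by
  obtain ⟨d, rfl⟩ := Nat.exists_eq_add_of_le hl
  have : ∀ i, i ≤ d → tm n (l + d) l ≤ tm n (l + d) (l + i) := by
    intro i
    induction i with
    | zero => intro _; exact le_rfl
    | succ i ih =>
      intro hi
      refine (ih (by omega)).trans ?_
      exact tm_step n (l + d) (l + i) (by omega) han (h.trans (Nat.pow_le_pow_right (by norm_num) (by omega)))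
  exact this d le_rfl

lemma Gs_bound (n a r : ℕ) (hr : 1 ≤ r) (ha : 4 ≤ a) (hA : a ^ 40 ≤ 2 ^ a) (g1 : 2 ^ a ≤ n ^ 2)
    (g2 : n ^ 2 ≤ a ^ 2 * 2 ^ a) (g3 : a * r ^ 2 * 2 ^ (a.choose 2) ≤ n.choose a) (g4 : r ^ 4 ≤ 2 ^ a) :
    Gs n a ^ (r * r) ≤ 3 := by
  have hrR : (1:ℝ) ≤ r := by exact_mod_cast hr
  have haR : (4:ℝ) ≤ a := by exact_mod_cast ha
  have han : a ≤ n := by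
    have : a ^ 2 ≤ n ^ 2 := by
      refine le_trans (Nat.pow_le_pow_right (by omega) (by norm_num)) (hA.trans g1)
    exact (Nat.pow_le_pow_iff_left (by norm_num)).1 this
  have hterm : ∀ l, 2 ≤ l → l ≤ a → tm n a l ≤ 1 / (a * r ^ 2) := by
    intro l hl2 hla
    have hpos : (0:ℝ) < a * r ^ 2 := by positivity
    rw [le_div_iff₀ hpos]
    by_cases hl : 4 * l ≤ 3 * a
    · have h := tm_small n a l ha hA g1 han hl2 hl
      have g4R : (r:ℝ) ^ 4 ≤ 2 ^ a := by exact_mod_cast g4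
      have : (tm n a l * (a * r ^ 2)) ^ 2 ≤ 1 := by
        calc (tm n a l * (a * r ^ 2)) ^ 2 = tm n a l ^ 2 * (a ^ 2 * r ^ 4) := by ring
          _ ≤ tm n a l ^ 2 * (a ^ 2 * 2 ^ a) := by gcongr
          _ ≤ 1 := h
      exact (sq_le_one_iff₀ (mul_nonneg (tm_nonneg _ _ _) hpos.le)).1 this
    · have hl4 : a * n ≤ 2 ^ l := by
        have : (a * n) ^ 4 ≤ (2 ^ l) ^ 4 := by
          calc (a * n) ^ 4 = a ^ 4 * (n ^ 2) ^ 2 := by ring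
            _ ≤ a ^ 4 * (a ^ 2 * 2 ^ a) ^ 2 := by gcongr
            _ = a ^ 8 * 2 ^ (2 * a) := by rw [pow_mul']; ring
            _ ≤ 2 ^ a * 2 ^ (2 * a) := by
              have q : a ^ 8 ≤ a ^ 40 := Nat.pow_le_pow_right (by omega) (by norm_num)
              exact Nat.mul_le_mul_right _ (q.trans hA)
            _ = 2 ^ (3 * a) := by rw [← pow_add]; congr 1; ring
            _ ≤ 2 ^ (l * 4) := Nat.pow_le_pow_right (by norm_num) (by omega)
            _ = _ := by rw [pow_mul]
        exact (Nat.pow_le_pow_iff_left (by norm_num)).1 this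
      have h := tm_le_top n a l hla han hl4
      refine (mul_le_mul_of_nonneg_right h hpos.le).trans ?_
      unfold tm
      have hc : (0:ℝ) < n.choose a := by exact_mod_cast Nat.choose_pos han
      have hd : (0:ℝ) < n.descFactorial a := by
        have : 0 < n.descFactorial a := Nat.descFactorial_pos.2 (by omega)
        exact_mod_cast this
      have e : (n.descFactorial a : ℝ) = a.factorial * n.choose a := by
        exact_mod_cast Nat.descFactorial_eq_factorial_mul_choose n a
      have g3R : (a:ℝ) * r ^ 2 * 2 ^ (a.choose 2) ≤ n.choose a := by exact_mod_cast g3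
      have hf : (0:ℝ) < a.factorial := by positivity
      rw [Nat.choose_self, Nat.descFactorial_self, e]
      have : ((1:ℕ):ℝ) * (2 ^ (a.choose 2) * ((a.factorial : ℝ) / (a.factorial * n.choose a))) * (a * r ^ 2)
        = (a * r ^ 2 * 2 ^ (a.choose 2)) / n.choose a := by
        field_simp; simp
      rw [this, div_le_one hc]
      exact g3R
  have hG : Gs n a ≤ 1 + 1 / (r:ℝ) ^ 2 := by
    unfold Gs
    have h0 : ∀ l ∈ range (a + 1), (a.choose l : ℝ) * (wt l * pw n a l) ≤
        (if l = 0 then 1 else 0) + (if 2 ≤ l then 1 / ((a:ℝ) * r ^ 2) else 0) := by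
      intro l hl
      have hl' := Finset.mem_range.1 hl
      rcases Nat.lt_or_ge l 2 with h | h
      · interval_cases l
        · simp [wt, pw]
        · simp [wt, pw]
      · have := hterm l h (by omega)
        have e0 : l ≠ 0 := by omega
        have e1 : l ≠ 1 := by omega
        simp only [wt, pw, e0, e1, h, if_true, if_false, zero_add]
        exact this
    refine (sum_le_sum h0).trans ?_
    rw [sum_add_distrib]
    have s1 : ∑ l ∈ range (a + 1), (if l = 0 then (1:ℝ) else 0) = 1 := by simp
    have s2 : ∑ l ∈ range (a + 1), (if 2 ≤ l then 1 / ((a:ℝ) * r ^ 2) else 0) ≤ 1 / (r:ℝ)^2 := by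
      rw [← sum_filter, sum_const, nsmul_eq_mul]
      have : ((range (a+1)).filter (fun l => 2 ≤ l)).card ≤ a := by
        have : (range (a+1)).filter (fun l => 2 ≤ l) ⊆ Finset.Ico 2 (a+1) := by
          intro l hl
          simp at hl ⊢; omega
        have := card_le_card this
        simp at this; simp; omega
      have : (((range (a+1)).filter (fun l => 2 ≤ l)).card : ℝ) ≤ a := by exact_mod_cast this
      calc _ ≤ (a:ℝ) * (1 / ((a:ℝ) * r ^ 2)) := by gcongr
        _ = _ := by field_simp
    linarith
  have hG0 : 0 ≤ Gs n a := by
    unfold Gs wt pw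
    refine sum_nonneg (fun l _ => ?_)
    split_ifs <;> positivity
  calc Gs n a ^ (r * r) ≤ (Real.exp (1 / (r:ℝ)^2)) ^ (r * r) := by
        gcongr
        refine hG.trans ?_
        rw [add_comm]; exact Real.add_one_le_exp _
    _ = Real.exp 1 := by
        rw [← Real.exp_nat_mul]; congr 1; push_cast; field_simp
    _ ≤ 3 := by have := Real.exp_one_lt_d9; linarith

end NC

open Filter
namespace NC
open Finset
open scoped Classical

lemma Col.monok {V : Type} {F : Finset (Sym2 V)} {k k' : ℕ} (h : k ≤ k') (h' : Col F k) : Col F k' := by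
  obtain ⟨f, hf⟩ := h'
  refine ⟨fun v => Fin.castLE h (f v), fun p hp => ?_⟩
  have := hf p hp
  induction p with
  | _ x y =>
  simp only [Sym2.map_mk, Sym2.mk_isDiag_iff] at this ⊢
  intro h2
  exact this (Fin.castLE_injective h h2)

lemma cc_mono {V : Type} [Fintype V] (m : ℕ) {k k' : ℕ} (h : k ≤ k') : cc V m k ≤ cc V m k' := by
  unfold cc
  refine card_le_card ?_
  intro F hF
  have hF := Finset.mem_filter.1 hF
  exact Finset.mem_filter.2 ⟨hF.1, hF.2.monok h⟩

lemma cc_full (n m : ℕ) : cc (Fin n) m n = (n.choose 2).choose m := by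
  unfold cc
  rw [filter_true_of_mem, card_powersetCard, card_EE, Fintype.card_fin]
  intro F hF
  refine ⟨id, fun p hp => ?_⟩
  have := (mem_EE _).1 ((mem_powersetCard.1 hF).1 hp)
  simpa using this

lemma m_le (n : ℕ) (hn : 2 ≤ n) : n ^ 2 / 4 ≤ n.choose 2 := by
  have h1 := two_choose n
  have h2 := (floor4 n).1
  have : 2 * n ≤ n ^ 2 := by nlinarith
  omega

def Valid (n r a : ℕ) : Prop :=
  1 ≤ r ∧ 4 ≤ a ∧ a ^ 40 ≤ 2 ^ a ∧ 2 ^ a ≤ (n + r * a) ^ 2 ∧ (n + r * a) ^ 2 ≤ a ^ 2 * 2 ^ a ∧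
  a * r ^ 2 * 2 ^ (a.choose 2) ≤ (n + r * a).choose a ∧ r ^ 4 ≤ 2 ^ a ∧ 40 * r * a ^ 3 ≤ n ∧
  2 * r ^ 2 * a ^ 2 ≤ n

lemma abstract_T (c : ℝ) (s t : ℕ → ℝ) (hlen : ∀ n : ℕ, t n - s n ≤ (n : ℝ) ^ c)
    (h : Tendsto (fun n : ℕ => PrM n (n ^ 2 / 4) (fun G => (chi n G : ℝ) ∈ Set.Icc (s n) (t n)))
      atTop (nhds 1)) :
    ∃ (T : ℕ → ℕ) (n1 : ℕ), (∀ n ≥ n1, (T n : ℝ) ≤ n + (n:ℝ) ^ c) ∧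
      (∀ n ≥ n1, ∀ r a, Valid n r a → (T (n + r * a) : ℝ) ≤ T n + r + ((n + r * a : ℕ) : ℝ) ^ c) ∧
      (∀ n ≥ n1, ∀ k, 2 * (cc (Fin n) (n^2/4) k : ℝ) < ((n.choose 2).choose (n^2/4) : ℝ) → k < T n) := by
  have h0 := h.eventually (lt_mem_nhds (show (1 - 1/4000 : ℝ) < 1 by norm_num))
  obtain ⟨n0, hn0⟩ := eventually_atTop.1 h0
  refine ⟨fun n => ⌊t n⌋₊, max n0 2, ?_⟩
  have key : ∀ n ≥ max n0 2, (1-1/4000)*((n.choose 2).choose (n^2/4):ℝ) ≤ cc (Fin n) (n^2/4) ⌊t n⌋₊ ∧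
      ∀ k:ℕ, (k:ℝ) < s n → (cc (Fin n) (n^2/4) k:ℝ) ≤ (1/4000)*((n.choose 2).choose (n^2/4):ℝ) := by
    intro n hn
    exact cc_ge n (n^2/4) (s n) (t n) (1/4000) (m_le n (le_trans (le_max_right _ _) hn))
      (hn0 n (le_trans (le_max_left _ _) hn)).le
  have hpos : ∀ n ≥ max n0 2, (0:ℝ) < ((n.choose 2).choose (n^2/4):ℝ) := by
    intro n hn
    exact_mod_cast Nat.choose_pos (m_le n (le_trans (le_max_right _ _) hn))
  have fl : ∀ (x y : ℝ), 0 ≤ y → x ≤ y → (⌊x⌋₊ : ℝ) ≤ y := by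
    intro x y hy hxy
    rcases le_or_gt 0 x with hx | hx
    · exact (Nat.floor_le hx).trans hxy
    · rw [Nat.floor_of_nonpos hx.le]; simpa using hy
  refine ⟨?_, ?_, ?_⟩
  · intro n hn
    refine fl _ _ (by positivity) ?_
    have hs : s n ≤ n := by
      by_contra hc
      push Not at hc
      have h1 := (key n hn).2 n hc
      rw [cc_full] at h1
      have := hpos n hn
      linarith
    have := hlen n
    linarith
  · intro n hn r a hv
    obtain ⟨v1, v2, v3, v4, v5, v6, v7, v8, v9⟩ := hv
    have hn' : n + r * a ≥ max n0 2 := le_trans hn (Nat.le_add_right _ _)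
    refine fl _ _ (by positivity) ?_
    have hG := Gs_bound (n + r * a) a r v1 v2 v3 v4 v5 v6 v7
    have hp := planted_main n r a ⌊t n⌋₊ v1 (by omega) v8 v9 hG (by
      have := (key n hn).1
      have := hpos n hn
      linarith)
    have hs : s (n + r * a) ≤ (⌊t n⌋₊ + r : ℕ) := by
      by_contra hc
      push Not at hc
      have h1 := (key _ hn').2 _ hc
      have := hpos _ hn'
      linarith
    have := hlen (n + r * a)
    push_cast at *
    linarith
  · intro n hn k hk
    by_contra hc
    push Not at hc
    have h1 : (cc (Fin n) (n^2/4) ⌊t n⌋₊ : ℝ) ≤ cc (Fin n) (n^2/4) k := by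
      exact_mod_cast cc_mono _ hc
    have := (key n hn).1
    have := hpos n hn
    linarith

end NC

open Filter
namespace NC
open Finset
open scoped Classical

lemma fact_upper (j : ℕ) (hj : 1 ≤ j) : (j.factorial : ℝ) ≤ Real.exp 1 * j * (j / Real.exp 1) ^ j := by
  induction j, hj using Nat.le_induction with
  | base => simp
  | succ j hj ih =>
    have hjR : (0:ℝ) < j := by exact_mod_cast hj
    have he := Real.exp_pos 1
    have key : Real.exp 1 * (j:ℝ) ^ (j + 1) ≤ ((j:ℝ) + 1) ^ (j + 1) := by
      have h1 : ((j:ℝ) / (j + 1)) ≤ Real.exp (-(1 / (j + 1))) := by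
        have := Real.add_one_le_exp (-(1 / ((j:ℝ) + 1)))
        refine le_trans (le_of_eq ?_) this
        field_simp; ring
      have h2 : ((j:ℝ) / (j + 1)) ^ (j + 1) ≤ Real.exp (-(1 / (j + 1))) ^ (j + 1) := by
        gcongr
      rw [← Real.exp_nat_mul] at h2
      have h3 : ((j + 1 : ℕ) : ℝ) * (-(1 / ((j:ℝ) + 1))) = -1 := by push_cast; field_simp
      rw [h3, div_pow, Real.exp_neg, div_le_iff₀ (by positivity)] at h2
      calc Real.exp 1 * (j:ℝ) ^ (j + 1) ≤ Real.exp 1 * ((Real.exp 1)⁻¹ * ((j:ℝ) + 1) ^ (j + 1)) := by gcongr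
        _ = _ := by field_simp
    rw [Nat.factorial_succ]
    push_cast
    calc ((j:ℝ) + 1) * (j.factorial : ℝ) ≤ ((j:ℝ) + 1) * (Real.exp 1 * j * (j / Real.exp 1) ^ j) := by gcongr
      _ = ((j:ℝ) + 1) * (Real.exp 1 * (j:ℝ) ^ (j + 1)) / Real.exp 1 ^ j := by
        rw [div_pow]; field_simp; ring
      _ ≤ ((j:ℝ) + 1) * (((j:ℝ) + 1) ^ (j + 1)) / Real.exp 1 ^ j := by gcongr
      _ = _ := by rw [div_pow]; field_simp; ring

lemma fact_lower (q : ℕ) : (q:ℝ) ^ q ≤ q.factorial * Real.exp q := by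
  have := Real.pow_div_factorial_le_exp (q:ℝ) (by positivity) q
  rw [div_le_iff₀ (by positivity)] at this
  linarith

lemma choose_lb (n j R : ℕ) (hj : 1 ≤ j) (hn : (0.3096:ℝ) * j * Real.sqrt 2 ^ j ≤ n) (hjn : 2 * j ^ 2 ≤ n)
    (hR : (6:ℝ) * j ^ 2 * R ≤ 1.19 ^ j) : j * R * 2 ^ (j.choose 2) ≤ n.choose j := by
  have he := Real.exp_pos 1
  have hjR : (1:ℝ) ≤ j := by exact_mod_cast hj
  have hnj : j ≤ n := by nlinarith
  have hnR : (0:ℝ) < n := by exact_mod_cast (by omega : 0 < n)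
  have d1 : ((n:ℝ) - j) ^ j ≤ (n.descFactorial j : ℝ) := by
    have h := Nat.pow_sub_le_descFactorial n j
    have : (n - j) ^ j ≤ n.descFactorial j := le_trans (Nat.pow_le_pow_left (by omega) _) h
    have h2 : (((n - j : ℕ) : ℝ)) ^ j ≤ (n.descFactorial j : ℝ) := by exact_mod_cast this
    rwa [Nat.cast_sub hnj] at h2
  have d2 : (n:ℝ) ^ j / 2 ≤ ((n:ℝ) - j) ^ j := by
    have hb := one_add_mul_le_pow (a := -((j:ℝ) / n)) (by
      have : (j:ℝ) / n ≤ 1 := (div_le_one hnR).2 (by exact_mod_cast hnj)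
      linarith) j
    have h2 : (j:ℝ) * (j / n) ≤ 1/2 := by
      have : (2:ℝ) * j ^ 2 ≤ n := by exact_mod_cast hjn
      rw [mul_div_assoc', div_le_iff₀ hnR]; nlinarith
    have h3 : ((n:ℝ) - j) = n * (1 + -((j:ℝ)/n)) := by field_simp; ring
    rw [h3, mul_pow]
    have : (1/2:ℝ) ≤ (1 + -((j:ℝ)/n)) ^ j := by linarith
    calc (n:ℝ)^j / 2 = n ^ j * (1/2) := by ring
      _ ≤ _ := by gcongr
  have hs2 : (Real.sqrt 2) ^ 2 = 2 := Real.sq_sqrt (by norm_num)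
  have hsj : (Real.sqrt 2 ^ j) ^ j = 2 ^ (j.choose 2) * Real.sqrt 2 ^ j := by
    rw [← pow_mul, ← pow_two, ← two_choose j, pow_add, pow_mul, hs2]
  have hmu : (1.19:ℝ) ≤ 0.3096 * Real.sqrt 2 * Real.exp 1 := by
    have h1 : (1.41421:ℝ) ≤ Real.sqrt 2 := Real.le_sqrt_of_sq_le (by norm_num)
    have h2 := Real.exp_one_gt_d9
    nlinarith
  have d3 : (1.19:ℝ) ^ j * (j / Real.exp 1) ^ j * 2 ^ (j.choose 2) ≤ (n:ℝ) ^ j := by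
    calc (1.19:ℝ) ^ j * (j / Real.exp 1) ^ j * 2 ^ (j.choose 2)
        ≤ (0.3096 * Real.sqrt 2 * Real.exp 1) ^ j * (j / Real.exp 1) ^ j * 2 ^ (j.choose 2) := by gcongr
      _ = ((0.3096:ℝ) * j) ^ j * (2 ^ (j.choose 2) * Real.sqrt 2 ^ j) := by
        rw [← mul_pow]
        have : 0.3096 * Real.sqrt 2 * Real.exp 1 * (j / Real.exp 1) = (0.3096 * j) * Real.sqrt 2 := by field_simp
        rw [this, mul_pow]; ring
      _ = ((0.3096:ℝ) * j * Real.sqrt 2 ^ j) ^ j := by rw [← hsj, ← mul_pow]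
      _ ≤ _ := by gcongr
  have hc : (n.descFactorial j : ℝ) = j.factorial * n.choose j := by
    exact_mod_cast Nat.descFactorial_eq_factorial_mul_choose n j
  have hfu := fact_upper j hj
  have hfp : (0:ℝ) < j.factorial := by positivity
  have : (j.factorial : ℝ) * (j * R * 2 ^ (j.choose 2)) ≤ j.factorial * n.choose j := by
    rw [← hc]
    refine le_trans ?_ (d2.trans d1)
    have e3 := Real.exp_one_lt_d9
    set X := (j / Real.exp 1 : ℝ) ^ j * 2 ^ (j.choose 2) with hX
    have hX0 : 0 ≤ X := by positivity
    calc (j.factorial : ℝ) * (j * R * 2 ^ (j.choose 2))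
        ≤ (Real.exp 1 * j * (j / Real.exp 1) ^ j) * (j * R * 2 ^ (j.choose 2)) := by gcongr
      _ = Real.exp 1 * (j ^ 2 * R * X) := by rw [hX]; ring
      _ ≤ 3 * (j ^ 2 * R * X) := by gcongr; linarith
      _ = (6 * j ^ 2 * R) * X / 2 := by ring
      _ ≤ 1.19 ^ j * X / 2 := by gcongr
      _ ≤ _ := by rw [hX, ← mul_assoc]; gcongr
  have := le_of_mul_le_mul_left this hfp
  exact_mod_cast this

end NC

open Filter
namespace NC
open Finset
open scoped Classical

lemma find_j (f : ℕ → ℝ) (x : ℝ) (j0 k : ℕ) (h : j0 ≤ k) (h0 : f j0 ≤ x) :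
    ∃ j, j0 ≤ j ∧ j ≤ k ∧ f j ≤ x ∧ (j = k ∨ x ≤ f (j + 1)) := by
  induction k, h using Nat.le_induction with
  | base => exact ⟨j0, le_rfl, le_rfl, h0, Or.inl rfl⟩
  | succ k hk ih =>
    obtain ⟨j, h1, h2, h3, h4⟩ := ih
    rcases h4 with h4 | h4
    · subst h4
      rcases le_total x (f (j+1)) with h5 | h5
      · exact ⟨j, h1, by omega, h3, Or.inr h5⟩
      · exact ⟨j + 1, by omega, le_rfl, h5, Or.inl rfl⟩
    · exact ⟨j, h1, by omega, h3, Or.inr h4⟩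

noncomputable def WW (f : ℕ → ℝ) (j0 k : ℕ) (x : ℝ) : ℝ :=
  x / k + ∑ i ∈ Finset.Ico j0 k, min x (f (i + 1)) / ((i:ℝ) * (i + 1))

lemma telesc (j k : ℕ) (hj : 0 < j) (h : j ≤ k) :
    ∑ i ∈ Finset.Ico j k, 1 / ((i:ℝ) * (i + 1)) = 1 / j - 1 / k := by
  induction k, h using Nat.le_induction with
  | base => simp
  | succ k hk ih =>
    rw [Finset.sum_Ico_succ_top hk, ih]
    have : (0:ℝ) < k := by exact_mod_cast (by omega : 0 < k)
    have : (0:ℝ) < j := by exact_mod_cast hj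
    push_cast
    field_simp
    ring

lemma WW_step (f : ℕ → ℝ) (hf : Monotone f) (j0 k j : ℕ) (hj0 : 0 < j0) (h1 : j0 ≤ j) (h2 : j ≤ k)
    (x y : ℝ) (hy : 0 ≤ y) (h : j = k ∨ x ≤ f (j + 1)) :
    WW f j0 k (x - j * y) + y ≤ WW f j0 k x := by
  have hjR : (0:ℝ) < j := by exact_mod_cast (by omega : 0 < j)
  have hkR : (0:ℝ) < k := by exact_mod_cast (by omega : 0 < k)
  have hjy : 0 ≤ (j:ℝ) * y := by positivity
  have hsum : ∑ i ∈ Finset.Ico j0 k, min (x - j * y) (f (i + 1)) / ((i:ℝ) * (i + 1)) +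
      ∑ i ∈ Finset.Ico j k, (j * y) * (1 / ((i:ℝ) * (i + 1))) ≤
      ∑ i ∈ Finset.Ico j0 k, min x (f (i + 1)) / ((i:ℝ) * (i + 1)) := by
    rw [← Finset.sum_Ico_consecutive _ h1 h2, ← Finset.sum_Ico_consecutive (fun i : ℕ => min x (f (i + 1)) / ((i:ℝ) * (i + 1))) h1 h2, add_assoc, ← Finset.sum_add_distrib]
    refine add_le_add (sum_le_sum (fun i _ => ?_)) (sum_le_sum (fun i hi => ?_))
    · gcongr
      linarith
    · obtain ⟨hi1, hi2⟩ := Finset.mem_Ico.1 hi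
      have hx : x ≤ f (i + 1) := by
        rcases h with h | h
        · omega
        · exact h.trans (hf (by omega))
      rw [min_eq_left hx, min_eq_left (by linarith)]
      apply le_of_eq; ring
  rw [← mul_sum, telesc j k (by omega) h2] at hsum
  unfold WW
  have : (x - j * y) / k + y = x / k + (j * y) * (1 / j - 1 / k) := by
    field_simp; ring
  linarith

lemma geo (j0 k : ℕ) (h : j0 ≤ k) :
    ∑ i ∈ Finset.Ico j0 k, Real.sqrt 2 ^ (i + 1) ≤ (2 + Real.sqrt 2) * Real.sqrt 2 ^ k := by
  have hs2 : Real.sqrt 2 * Real.sqrt 2 = 2 := Real.mul_self_sqrt (by norm_num)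
  induction k, h using Nat.le_induction with
  | base => simp; positivity
  | succ k hk ih =>
    rw [Finset.sum_Ico_succ_top hk]
    have e : (2 + Real.sqrt 2) * Real.sqrt 2 ^ (k + 1) =
      (2 + Real.sqrt 2) * Real.sqrt 2 ^ k + Real.sqrt 2 ^ (k + 1) := by
      rw [pow_succ]
      linear_combination (Real.sqrt 2 ^ k) * hs2
    linarith

noncomputable def ff (j : ℕ) : ℝ := 0.3096 * j * Real.sqrt 2 ^ j

lemma ff_mono : Monotone ff := by
  intro a b hab
  unfold ff
  have : (1:ℝ) ≤ Real.sqrt 2 := Real.one_le_sqrt.2 (by norm_num)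
  gcongr

lemma WW_top (j0 k : ℕ) (hj0 : 0 < j0) (h : j0 ≤ k) (x : ℝ) :
    WW ff j0 k x ≤ x / k + 1.0571 * Real.sqrt 2 ^ k / j0 := by
  have hj0R : (0:ℝ) < j0 := by exact_mod_cast hj0
  unfold WW
  gcongr
  calc ∑ i ∈ Finset.Ico j0 k, min x (ff (i + 1)) / ((i:ℝ) * (i + 1))
      ≤ ∑ i ∈ Finset.Ico j0 k, (0.3096 / j0) * Real.sqrt 2 ^ (i + 1) := by
        refine sum_le_sum (fun i hi => ?_)
        obtain ⟨hi1, hi2⟩ := Finset.mem_Ico.1 hi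
        have hiR : (j0:ℝ) ≤ i := by exact_mod_cast hi1
        have hi0 : (0:ℝ) < i := by linarith
        calc min x (ff (i + 1)) / ((i:ℝ) * (i + 1)) ≤ ff (i + 1) / ((i:ℝ) * (i + 1)) := by
              gcongr; exact min_le_right _ _
          _ = (0.3096 / i) * Real.sqrt 2 ^ (i + 1) := by
              unfold ff; push_cast; field_simp
          _ ≤ _ := by gcongr
    _ = (0.3096 / j0) * ∑ i ∈ Finset.Ico j0 k, Real.sqrt 2 ^ (i + 1) := by rw [mul_sum]
    _ ≤ (0.3096 / j0) * ((2 + Real.sqrt 2) * Real.sqrt 2 ^ k) := by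
        gcongr; exact geo j0 k h
    _ = (0.3096 * (2 + Real.sqrt 2)) * Real.sqrt 2 ^ k / j0 := by ring
    _ ≤ _ := by
        gcongr
        have : Real.sqrt 2 ≤ 1.4143 := Real.sqrt_le_iff.2 ⟨by norm_num, by norm_num⟩
        linarith

/-- the induction -/
lemma climb (T : ℕ → ℕ) (n1 : ℕ) (hn1 : 1 ≤ n1) (c η : ℝ) (hc0 : 0 < c) (hc1 : c < 1/4)
    (hA : ∀ n ≥ n1, (T n : ℝ) ≤ n + (n:ℝ) ^ c)
    (hB : ∀ n ≥ n1, ∀ r a, Valid n r a → (T (n + r * a) : ℝ) ≤ T n + r + ((n + r * a : ℕ) : ℝ) ^ c)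
    (N b0 r j0 k : ℕ) (hj0 : 0 < j0) (hjk : j0 ≤ k) (hb : ff j0 ≤ b0) (hη : 0 ≤ η)
    (hbk : n1 + k * r ≤ b0) (hN : (N:ℝ) ^ c ≤ η * r)
    (hV : ∀ j p, j0 ≤ j → j ≤ k → b0 ≤ p + r * j → p + r * j ≤ N → ff j ≤ ((p + r * j : ℕ) : ℝ) →
      (j = k ∨ ((p + r * j : ℕ) : ℝ) ≤ ff (j + 1)) → Valid p r j) :
    ∀ n, n1 ≤ n → n ≤ N → (T n : ℝ) ≤ 2 * b0 + (1 + η) * WW ff j0 k n := by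
  intro n
  induction n using Nat.strong_induction_on with
  | _ n ih =>
  intro hn hnN
  have hnR : (1:ℝ) ≤ n := by exact_mod_cast hn1.trans hn
  by_cases hnb : n ≤ b0
  · have h1 := hA n hn
    have h2 : (n:ℝ) ^ c ≤ n := by
      calc (n:ℝ) ^ c ≤ (n:ℝ) ^ (1:ℝ) := Real.rpow_le_rpow_of_exponent_le hnR (by linarith)
        _ = n := Real.rpow_one _
    have h3 : (n:ℝ) ≤ b0 := by exact_mod_cast hnb
    have hW : 0 ≤ WW ff j0 k n := by
      unfold WW
      have : ∀ i : ℕ, 0 ≤ min (n:ℝ) (ff (i + 1)) := by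
        intro i; refine le_min (by positivity) (by unfold ff; positivity)
      have : 0 ≤ ∑ i ∈ Finset.Ico j0 k, min (n:ℝ) (ff (i + 1)) / ((i:ℝ) * (i + 1)) :=
        sum_nonneg (fun i _ => div_nonneg (this i) (by positivity))
      positivity
    have : 0 ≤ (1 + η) * WW ff j0 k n := by positivity
    linarith
  · push Not at hnb
    obtain ⟨j, h1, h2, h3, h4⟩ := find_j ff n j0 k hjk (hb.trans (by exact_mod_cast hnb.le))
    have hrj : r * j ≤ k * r := by rw [mul_comm]; exact Nat.mul_le_mul_right _ h2
    obtain ⟨p, hp⟩ : ∃ p, n = p + r * j := ⟨n - r * j, by omega⟩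
    by_cases hr0 : r = 0
    · subst hr0
      have hN0 : (0:ℝ) < (N:ℝ) ^ c := Real.rpow_pos_of_pos (by exact_mod_cast (by omega : 0 < N)) _
      simp at hN
      linarith
    have hv : Valid p r j := hV j p h1 h2 (by omega) (by omega) (by rw [← hp]; exact h3)
      (by rw [← hp]; exact h4)
    have hrj0 : 0 < r * j := Nat.mul_pos (by omega) (by omega)
    have i1 := ih p (by omega) (by omega) (by omega)
    have i2 := hB p (by omega) r j hv
    rw [← hp] at i2
    have i3 := WW_step ff ff_mono j0 k j hj0 h1 h2 (n:ℝ) r (by positivity) h4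
    have hpr : (n:ℝ) - j * r = p := by rw [hp]; push_cast; ring
    rw [hpr] at i3
    have i4 : (n:ℝ) ^ c ≤ (N:ℝ) ^ c :=
      Real.rpow_le_rpow (by positivity) (by exact_mod_cast hnN) hc0.le
    have i5 := mul_le_mul_of_nonneg_left i3 (by linarith : 0 ≤ 1 + η)
    rw [mul_add] at i5
    linarith

end NC

open Filter
namespace NC
open Finset
open scoped Classical

lemma sqrt_pow_two_mul (m : ℕ) : Real.sqrt 2 ^ (2 * m) = 2 ^ m := by
  rw [pow_mul, Real.sq_sqrt (by norm_num)]

lemma pow119 (K : ℕ) : (2:ℝ) ^ (2000 * K) * 1.5 ^ K ≤ 1.19 ^ (7992 * K) := by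
  obtain ⟨x, hx⟩ : ∃ x : ℝ, x = 1.002669605 := ⟨_, rfl⟩
  have h1 : (6:ℝ) ≤ x ^ 1998 := by
    have := one_add_mul_le_pow (a := x - 1) (by rw [hx]; norm_num) 1998
    rw [add_sub_cancel] at this
    refine le_trans ?_ this
    rw [hx]; norm_num
  have h2 : (1.19:ℝ) ^ (7992 * K) = (2 * x) ^ (1998 * K) := by
    have : 7992 * K = 4 * (1998 * K) := by ring
    rw [this, pow_mul]
    congr 1
    rw [hx]; norm_num
  rw [h2, mul_pow, pow_mul x]
  calc (2:ℝ) ^ (2000 * K) * 1.5 ^ K = 2 ^ (1998 * K) * 6 ^ K := by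
        have : 2000 * K = 1998 * K + 2 * K := by ring
        rw [this, pow_add, pow_mul 2 2, mul_assoc, ← mul_pow]; norm_num
    _ ≤ _ := by gcongr

lemma valid_K (K : ℕ) (hK : 1 ≤ K) (e1 : ∀ j : ℕ, K ≤ j → j ^ 40 ≤ 2 ^ j)
    (e2 : (6:ℝ) * (8000 * K) ^ 2 ≤ 1.5 ^ K) (e3 : 41 * (8000 * K) ^ 3 ≤ 2 ^ K) (j p : ℕ)
    (hj : 7992 * K ≤ j) (hjk : j ≤ 8000 * K)
    (hb : 8000 * K * 2 ^ (3996 * K) ≤ p + 2 ^ (1000 * K) * j)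
    (hN : p + 2 ^ (1000 * K) * j ≤ 3000 * K * 2 ^ (4000 * K))
    (hf : ff j ≤ ((p + 2 ^ (1000 * K) * j : ℕ) : ℝ))
    (hf2 : j = 8000 * K ∨ ((p + 2 ^ (1000 * K) * j : ℕ) : ℝ) ≤ ff (j + 1)) :
    Valid p (2 ^ (1000 * K)) j := by
  have hr1 : 1 ≤ 2 ^ (1000 * K) := Nat.one_le_two_pow
  have hr2 : (2 ^ (1000 * K)) ^ 2 = 2 ^ (2000 * K) := by rw [← pow_mul]; congr 1; ring
  have hr4 : (2 ^ (1000 * K)) ^ 4 = 2 ^ (4000 * K) := by rw [← pow_mul]; congr 1; ring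
  have hjR : (4:ℝ) ≤ j := by exact_mod_cast (by omega : 4 ≤ j)
  have hs2 : Real.sqrt 2 * Real.sqrt 2 = 2 := Real.mul_self_sqrt (by norm_num)
  have hs3 : Real.sqrt 2 ≤ 1.4143 := Real.sqrt_le_iff.2 ⟨by norm_num, by norm_num⟩
  have hsj : (Real.sqrt 2 ^ j) ^ 2 = 2 ^ j := by
    rw [← pow_mul, mul_comm, sqrt_pow_two_mul]
  have hspos : 0 < Real.sqrt 2 ^ j := by positivity
  -- size facts
  have k3 : j ^ 3 ≤ (8000 * K) ^ 3 := Nat.pow_le_pow_left hjk 3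
  have hjj : j ≤ j ^ 3 := Nat.le_self_pow (by norm_num) j
  have hjj2 : j ^ 2 ≤ j ^ 3 := Nat.pow_le_pow_right (by omega) (by norm_num)
  have big : ∀ e, e ≤ 2000 * K → 2 ^ e * (41 * j ^ 3) ≤ 8000 * K * 2 ^ (3996 * K) := by
    intro e he
    calc 2 ^ e * (41 * j ^ 3) ≤ 2 ^ (2000 * K) * 2 ^ K := by
          refine Nat.mul_le_mul (Nat.pow_le_pow_right (by norm_num) he) (by omega)
      _ = 2 ^ (2001 * K) := by rw [← pow_add]; congr 1; ring
      _ ≤ 2 ^ (3996 * K) := Nat.pow_le_pow_right (by norm_num) (by omega)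
      _ ≤ 8000 * K * 2 ^ (3996 * K) := Nat.le_mul_of_pos_left _ (by omega)
  have s1 : 40 * 2 ^ (1000 * K) * j ^ 3 ≤ p := by
    have h := big (1000 * K) (by omega)
    have : 2 ^ (1000 * K) * j ≤ 2 ^ (1000 * K) * j ^ 3 := Nat.mul_le_mul_left _ hjj
    have e : 2 ^ (1000 * K) * (41 * j ^ 3) = 40 * 2 ^ (1000 * K) * j ^ 3 + 2 ^ (1000 * K) * j ^ 3 := by ring
    omega
  have s2 : 2 * (2 ^ (1000 * K)) ^ 2 * j ^ 2 ≤ p := by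
    have h := big (2000 * K) (by omega)
    have h1 : 2 ^ (1000 * K) * j ≤ 2 ^ (2000 * K) * j ^ 3 :=
      Nat.mul_le_mul (Nat.pow_le_pow_right (by norm_num) (by omega)) hjj
    have h2 : 2 ^ (2000 * K) * j ^ 2 ≤ 2 ^ (2000 * K) * j ^ 3 := Nat.mul_le_mul_left _ hjj2
    have e : 2 ^ (2000 * K) * (41 * j ^ 3) = 41 * (2 ^ (2000 * K) * j ^ 3) := by ring
    rw [hr2]
    have e' : 2 * 2 ^ (2000 * K) * j ^ 2 = 2 * (2 ^ (2000 * K) * j ^ 2) := by ring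
    omega
  have s3 : 2 * j ^ 2 ≤ p := by
    refine le_trans ?_ s2
    have : 1 ≤ (2 ^ (1000 * K)) ^ 2 := Nat.one_le_pow _ _ (by omega)
    exact Nat.mul_le_mul_right _ (by omega)
  set n := p + 2 ^ (1000 * K) * j with hn
  have u1 : Real.sqrt 2 ^ j ≤ n := by
    refine le_trans ?_ hf
    unfold ff
    nlinarith
  have u2 : (n:ℝ) ≤ j * Real.sqrt 2 ^ j := by
    rcases hf2 with h | h
    · have : (n:ℝ) ≤ 3000 * K * 2 ^ (4000 * K) := by exact_mod_cast hN
      have e : Real.sqrt 2 ^ j = 2 ^ (4000 * K) := by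
        rw [h, ← sqrt_pow_two_mul]; congr 1; ring
      rw [e]
      refine this.trans ?_
      have : (3000:ℝ) * K ≤ j := by rw [h]; push_cast; nlinarith [(Nat.cast_nonneg K : (0:ℝ) ≤ K)]
      gcongr
    · refine h.trans ?_
      unfold ff
      push_cast
      rw [pow_succ]
      have : 0.3096 * ((j:ℝ) + 1) * Real.sqrt 2 ≤ j := by nlinarith
      calc _ = (0.3096 * ((j:ℝ) + 1) * Real.sqrt 2) * Real.sqrt 2 ^ j := by ring
        _ ≤ _ := by gcongr
  refine ⟨hr1, by omega, e1 j (by omega), ?_, ?_, ?_, ?_, s1, s2⟩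
  · have : (2:ℝ) ^ j ≤ (n:ℝ) ^ 2 := by rw [← hsj]; gcongr
    exact_mod_cast this
  · have : (n:ℝ) ^ 2 ≤ (j:ℝ) ^ 2 * 2 ^ j := by rw [← hsj, ← mul_pow]; gcongr
    exact_mod_cast this
  · rw [hr2]
    refine choose_lb n j _ (by omega) hf (by omega) ?_
    push_cast
    have hjkR : (j:ℝ) ≤ 8000 * K := by exact_mod_cast hjk
    calc (6:ℝ) * j ^ 2 * 2 ^ (2000 * K) ≤ 6 * (8000 * K) ^ 2 * 2 ^ (2000 * K) := by gcongr
      _ ≤ 1.5 ^ K * 2 ^ (2000 * K) := by gcongr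
      _ = 2 ^ (2000 * K) * 1.5 ^ K := by ring
      _ ≤ _ := pow119 K
      _ ≤ _ := pow_le_pow_right₀ (by norm_num) hj
  · rw [hr4]; exact Nat.pow_le_pow_right (by norm_num) (by omega)

lemma log3_le : Real.log 3 ≤ 65 / 41 * Real.log 2 := by
  have h : Real.log ((3:ℝ) ^ 41) ≤ Real.log ((2:ℝ) ^ 65) :=
    Real.log_le_log (by positivity) (by norm_num)
  rw [Real.log_pow, Real.log_pow] at h
  push_cast at h
  linarith

/-- numeric core of the first moment estimate -/
lemma fm_num (k M u N q d : ℝ) (hk : 50000 ≤ k) (hM : k ^ 2 ≤ M) (hu : u = k - 2.828)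
    (hN : N = 3 / 8 * k * M) (hlM : Real.log M = k / 2 * Real.log 2)
    (hd : 2 * d + N = N * u) (hq1 : 1 ≤ q) (hq : q ≤ N / u) (hq' : N / u < q + 1) :
    Real.log 2 + (N - q) * Real.log q + q < d * Real.log 2 := by
  have l1 := Real.log_two_gt_d9
  have l2 := Real.log_two_lt_d9
  have l3 := log3_le
  have hu0 : 40000 ≤ u := by rw [hu]; linarith
  have hM0 : 0 < M := by nlinarith
  have hk0 : 0 < k := by linarith
  have hN0 : 0 < N := by rw [hN]; positivity
  set Q := N / u with hQ
  have hQu : Q * u = N := by rw [hQ]; field_simp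
  have hQ0 : 0 < Q := by positivity
  have hL : Real.log Q = 0 + Real.log 3 - 3 * Real.log 2 + Real.log (k / u) + k / 2 * Real.log 2 := by
    have e : Q = 3 / 2 ^ 3 * (k / u) * M := by rw [hQ, hN]; field_simp; norm_num
    rw [e, Real.log_mul (by positivity) (by positivity), Real.log_mul (by positivity) (by positivity),
      Real.log_div (by norm_num) (by norm_num), Real.log_pow, hlM]
    push_cast; ring
  have hku : Real.log (k / u) ≤ 0.0001 := by
    have := Real.log_le_sub_one_of_pos (show 0 < k / u by positivity)
    refine this.trans ?_
    have : k / u ≤ 1 + 0.0001 := by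
      rw [div_le_iff₀ (by positivity)]; linarith
    linarith
  have hbr : 0.0002 ≤ u / 2 * Real.log 2 - Real.log Q := by
    have e : u / 2 * Real.log 2 = k / 2 * Real.log 2 - 1.414 * Real.log 2 := by rw [hu]; ring
    rw [hL, e]
    linarith
  have hlq : Real.log q ≤ Real.log Q := Real.log_le_log (by linarith) hq
  have hlq0 : 0 ≤ Real.log q := Real.log_nonneg hq1
  have hLk : Real.log Q ≤ k := by nlinarith
  have hQN : Q ≤ N / 40000 := by rw [le_div_iff₀ (by norm_num)]; nlinarith
  have h1 : (N - q) * Real.log q ≤ (N - Q + 1) * Real.log Q := by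
    have : 0 ≤ N - q := by linarith
    calc (N - q) * Real.log q ≤ (N - q) * Real.log Q := by gcongr
      _ ≤ (N - Q + 1) * Real.log Q := by
        have : 0 ≤ Real.log Q := hlq0.trans hlq
        gcongr; linarith
  have h2 : 2 * d = u * (N - Q) := by linarith
  have h3 : (N - Q) * 0.0002 ≤ (N - Q) * (u / 2 * Real.log 2 - Real.log Q) := by
    have : 0 ≤ N - Q := by linarith
    gcongr
  have h4 : d * Real.log 2 = (N - Q) * (u / 2 * Real.log 2) := by
    have : d = u * (N - Q) / 2 := by linarith
    rw [this]; ring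
  have h5 : 40000 * (k + 2) ≤ N := by
    rw [hN]; nlinarith
  rw [h4]
  nlinarith

lemma first_K (K : ℕ) (hK : 10 ≤ K) (e3 : 41 * (8000 * K) ^ 3 ≤ 2 ^ K) (q : ℕ)
    (hq : q = ⌊((3000 * K * 2 ^ (4000 * K) : ℕ) : ℝ) / ((8000 * K : ℕ) - 2.828 : ℝ)⌋₊) :
    2 * (cc (Fin (3000 * K * 2 ^ (4000 * K))) ((3000 * K * 2 ^ (4000 * K)) ^ 2 / 4) q : ℝ) <
      (((3000 * K * 2 ^ (4000 * K)).choose 2).choose ((3000 * K * 2 ^ (4000 * K)) ^ 2 / 4) : ℝ) := by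
  have hKR : (10:ℝ) ≤ K := by exact_mod_cast hK
  have hMe : 2 ^ K ≤ 2 ^ (4000 * K) := Nat.pow_le_pow_right (by norm_num) (by omega)
  have hlM : Real.log ((2 ^ (4000 * K) : ℕ) : ℝ) = (8000 * K : ℝ) / 2 * Real.log 2 := by
    push_cast; rw [Real.log_pow]; push_cast; ring
  generalize 2 ^ (4000 * K) = M at *
  set N := 3000 * K * M with hN
  have hMR : (8000 * K : ℝ) ^ 2 ≤ M := by
    have h : (8000 * K) ^ 2 ≤ M := by
      have : (8000 * K) ^ 2 ≤ (8000 * K) ^ 3 := Nat.pow_le_pow_right (by omega) (by norm_num)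
      omega
    exact_mod_cast h
  have hM1 : (1:ℝ) ≤ M := by nlinarith
  push_cast at hq
  set u : ℝ := 8000 * K - 2.828 with hu
  have hu0 : 40000 ≤ u := by rw [hu]; linarith
  have hNR : (N:ℝ) = 3 / 8 * (8000 * K) * M := by rw [hN]; push_cast; ring
  have hNR0 : (0:ℝ) < N := by rw [hNR]; positivity
  have hNu : 1 ≤ (N:ℝ) / u := by
    rw [le_div_iff₀ (by linarith), hNR, hu]; nlinarith
  have hq1 : (q:ℝ) ≤ (N:ℝ) / u := by rw [hq]; exact Nat.floor_le (by positivity)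
  have hq2 : (N:ℝ) / u < q + 1 := by rw [hq]; exact Nat.lt_floor_add_one _
  have hq0 : 1 ≤ q := by rw [hq]; exact Nat.one_le_floor_iff _ |>.2 hNu
  obtain ⟨d, hd⟩ : ∃ d : ℕ, d = K * M * (12000000 * K - 5742) := ⟨_, rfl⟩
  have hdR : 2 * (d:ℝ) + N = N * u := by
    rw [hd, hNR, hu]
    have : 5742 ≤ 12000000 * K := by omega
    push_cast [Nat.cast_sub this]
    ring
  have hqu : (q:ℝ) * u ≤ N := by rwa [le_div_iff₀ (by linarith)] at hq1
  have hqN : q ≤ N := by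
    have h0 : (0:ℝ) ≤ q := Nat.cast_nonneg q
    have : (q:ℝ) ≤ N := le_trans (le_mul_of_one_le_right h0 (by linarith only [hu0])) hqu
    exact_mod_cast this
  have hN2 : 2 ≤ N := by
    have : (2:ℝ) ≤ N := by rw [hNR]; nlinarith only [hKR, hM1]
    exact_mod_cast this
  clear_value N
  have hm : N.choose 2 ≤ 2 * (N ^ 2 / 4) := by
    have h1 := two_choose N
    have h2 := floor4 N
    omega
  have fm := first_moment (Fin N) (N ^ 2 / 4) q d (by simpa using hqN) (by simpa using hm) hq0 (by
    simp only [Fintype.card_fin]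
    have : (q:ℝ) * (2 * d + N) ≤ (N:ℝ) ^ 2 := by
      rw [hdR]
      calc (q:ℝ) * (N * u) = N * (q * u) := by ring
        _ ≤ N * N := mul_le_mul_of_nonneg_left hqu hNR0.le
        _ = _ := by ring
    exact_mod_cast this)
  simp only [Fintype.card_fin] at fm
  have num := fm_num (8000 * K) M u N q d (by linarith) hMR hu hNR hlM hdR (by exact_mod_cast hq0) hq1 hq2
  by_contra hcon
  push Not at hcon
  set C := (N.choose 2).choose (N ^ 2 / 4) with hC
  have hC0 : 0 < C := Nat.choose_pos (m_le N hN2)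
  set x := cc (Fin N) (N ^ 2 / 4) q with hx
  have hC0R : (0:ℝ) < C := by exact_mod_cast hC0
  have hx0 : (0:ℝ) < x := by linarith
  have fmR : (q.factorial : ℝ) * x * 2 ^ d ≤ (q:ℝ) ^ N * C := by exact_mod_cast fm
  have a1 : (q.factorial : ℝ) * 2 ^ d ≤ 2 * (q:ℝ) ^ N := by
    have : (q:ℝ) ^ N * C ≤ (q:ℝ) ^ N * (2 * x) := by gcongr
    have : x * ((q.factorial : ℝ) * 2 ^ d) ≤ x * (2 * (q:ℝ) ^ N) := by linarith
    exact le_of_mul_le_mul_left this hx0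
  have hqp : (0:ℝ) < q := by exact_mod_cast hq0
  have a2 : (q:ℝ) ^ q * 2 ^ d ≤ 2 * (q:ℝ) ^ N * Real.exp q := by
    calc (q:ℝ) ^ q * 2 ^ d ≤ (q.factorial * Real.exp q) * 2 ^ d := by gcongr; exact fact_lower q
      _ = (q.factorial * 2 ^ d) * Real.exp q := by ring
      _ ≤ _ := by gcongr
  have a3 := Real.log_le_log (by positivity) a2
  rw [Real.log_mul (by positivity) (by positivity), Real.log_mul (by positivity) (by positivity),
    Real.log_mul (by positivity) (by positivity), Real.log_pow, Real.log_pow, Real.log_pow, Real.log_exp] at a3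
  linarith

lemma final_num (k M u N b0 : ℝ) (hk : 50000 ≤ k) (hM : 0 < M) (hu : u = k - 2.828)
    (hN : N = 3 / 8 * k * M) (hb : 2 * b0 * k ^ 2 ≤ M)
    (h : N / u ≤ 2 * b0 + (1 + 1 / k ^ 2) * (N / k + 1.0571 * M / (0.999 * k))) : False := by
  have hk0 : 0 < k := by linarith
  have h1 : 3 / 8 * M + 1.0605 * M / k ≤ N / u := by
    rw [le_div_iff₀ (by linarith), hN, hu]
    have e : (3 / 8 * M + 1.0605 * M / k) * (k - 2.828) = 3 / 8 * M * k + 1.0605 * M - 1.0605 * M - 1.0605 * 2.828 * M / k := by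
      field_simp; ring
    rw [e]
    have : 0 ≤ 1.0605 * 2.828 * M / k := by positivity
    linarith
  have h2 : 2 * b0 ≤ M / k ^ 2 := by rw [le_div_iff₀ (by positivity)]; exact hb
  have e1 : N / k = 3 / 8 * M := by rw [hN]; field_simp
  have e2 : 1.0571 * M / (0.999 * k) ≤ 1.0582 * (M / k) := by
    rw [div_le_iff₀ (by positivity)]
    have : 1.0582 * (M / k) * (0.999 * k) = 1.0582 * 0.999 * M := by field_simp
    rw [this]; nlinarith
  have e3 : M / k ≤ M / 50000 := by gcongr
  have h3 : (1 + 1 / k ^ 2) * (N / k + 1.0571 * M / (0.999 * k)) ≤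
      (1 + 1 / k ^ 2) * (3 / 8 * M + 1.0582 * (M / k)) := by
    rw [e1]; gcongr
  have h4 : 1 / k ^ 2 * (3 / 8 * M + 1.0582 * (M / k)) ≤ 1 / k ^ 2 * M := by
    gcongr; linarith
  have h5 : M / k ^ 2 ≤ (M / k) / 50000 := by
    have : M / k ^ 2 = (M / k) / k := by field_simp
    rw [this]; gcongr
  have h6 : 0 < M / k := by positivity
  have h7 : 1 / k ^ 2 * M = M / k ^ 2 := by ring
  have h8 : 1.0605 * M / k = 1.0605 * (M / k) := by ring
  rw [add_mul (1:ℝ)] at h3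
  linarith

lemma ev_pow (e : ℕ) (A β : ℝ) (hA : 0 < A) (hβ : 1 < β) :
    ∀ᶠ K : ℕ in atTop, A * (K:ℝ) ^ e ≤ β ^ K := by
  have := tendsto_pow_const_div_const_pow_of_one_lt e hβ
  filter_upwards [this.eventually (gt_mem_nhds (show (0:ℝ) < 1 / A by positivity))] with K hK
  have hp : 0 < β ^ K := by positivity
  rw [div_lt_div_iff₀ hp hA] at hK
  linarith

lemma contra (c : ℝ) (hc0 : 0 < c) (hc : c < 1/4) (T : ℕ → ℕ) (n1 : ℕ)
    (hA : ∀ n ≥ n1, (T n : ℝ) ≤ n + (n:ℝ) ^ c)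
    (hB : ∀ n ≥ n1, ∀ r a, Valid n r a → (T (n + r * a) : ℝ) ≤ T n + r + ((n + r * a : ℕ) : ℝ) ^ c)
    (hC : ∀ n ≥ n1, ∀ k, 2 * (cc (Fin n) (n ^ 2 / 4) k : ℝ) < ((n.choose 2).choose (n ^ 2 / 4) : ℝ) → k < T n) :
    False := by
  obtain ⟨β, hβ⟩ : ∃ β : ℝ, β = 2 ^ (1000 - 4000 * c) := ⟨_, rfl⟩
  have hβ1 : 1 < β := by rw [hβ]; exact Real.one_lt_rpow (by norm_num) (by linarith)
  have E1 : ∀ᶠ K : ℕ in atTop, ∀ j : ℕ, K ≤ j → j ^ 40 ≤ 2 ^ j := by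
    obtain ⟨a, ha⟩ := eventually_atTop.1 (ev_pow 40 1 2 (by norm_num) (by norm_num))
    filter_upwards [eventually_ge_atTop a] with K hK j hj
    have := ha j (hK.trans hj)
    rw [one_mul] at this
    exact_mod_cast this
  obtain ⟨K, e1, e2, e3R, e4, hK10, hKn⟩ := (E1.and ((ev_pow 2 (6 * 8000 ^ 2) 1.5 (by norm_num) (by norm_num)).and
    ((ev_pow 3 (41 * 8000 ^ 3) 2 (by norm_num) (by norm_num)).and
    ((ev_pow 3 (8000 ^ 2 * 3000) β (by norm_num) hβ1).and
    ((eventually_ge_atTop 10).and (eventually_ge_atTop (max n1 1))))))).exists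
  have hKR : (10:ℝ) ≤ K := by exact_mod_cast hK10
  have e3 : 41 * (8000 * K) ^ 3 ≤ 2 ^ K := by
    have : (41:ℝ) * (8000 * K) ^ 3 ≤ 2 ^ K := by rw [mul_pow]; linarith
    exact_mod_cast this
  have e2' : (6:ℝ) * (8000 * K) ^ 2 ≤ 1.5 ^ K := by rw [mul_pow]; linarith
  have hK2 : K ≤ 2 ^ K := Nat.lt_two_pow_self.le
  have hM : Real.sqrt 2 ^ (8000 * K) = 2 ^ (4000 * K) := by
    rw [← sqrt_pow_two_mul]; congr 1; ring
  have hk3 : 8000 * K ≤ 2 ^ K := by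
    have : 8000 * K ≤ (8000 * K) ^ 3 := Nat.le_self_pow (by norm_num) _
    omega
  have cl := climb T (max n1 1) (le_max_right _ _) c (1 / (8000 * K : ℕ) ^ 2) hc0 hc
    (fun n hn => hA n (le_trans (le_max_left _ _) hn)) (fun n hn => hB n (le_trans (le_max_left _ _) hn))
    (3000 * K * 2 ^ (4000 * K)) (8000 * K * 2 ^ (3996 * K)) (2 ^ (1000 * K)) (7992 * K) (8000 * K)
    (by omega) (by omega)
    (by
      unfold ff
      have : Real.sqrt 2 ^ (7992 * K) = 2 ^ (3996 * K) := by
        rw [← sqrt_pow_two_mul]; congr 1; ring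
      rw [this]
      push_cast
      gcongr ?_ * _
      linarith)
    (by positivity)
    (by
      have h1 : 8000 * K * 2 ^ (1000 * K) ≤ 2 ^ (1001 * K) := by
        calc 8000 * K * 2 ^ (1000 * K) ≤ 2 ^ K * 2 ^ (1000 * K) := Nat.mul_le_mul_right _ hk3
          _ = _ := by rw [← pow_add]; congr 1; ring
      have h2 : 2 ^ (1001 * K) ≤ 2 ^ (3996 * K) := Nat.pow_le_pow_right (by norm_num) (by omega)
      have h3 : 2 ^ K ≤ 2 ^ (3996 * K) := Nat.pow_le_pow_right (by norm_num) (by omega)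
      have h4 : 2 * 2 ^ (3996 * K) ≤ 8000 * K * 2 ^ (3996 * K) := Nat.mul_le_mul_right _ (by omega)
      omega)
    (by
      have hp : ((2:ℝ) ^ (4000 * K)) ^ c = 2 ^ (4000 * c * K) := by
        rw [← Real.rpow_natCast, ← Real.rpow_mul (by norm_num)]
        congr 1; push_cast; ring
      have hβK : β ^ K * 2 ^ (4000 * c * K) = (2:ℝ) ^ (1000 * K) := by
        rw [hβ, ← Real.rpow_natCast, ← Real.rpow_mul (by norm_num), ← Real.rpow_add (by norm_num),
          ← Real.rpow_natCast]
        congr 1; push_cast; ring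
      have h3 : (3000 * K : ℝ) ^ c ≤ 3000 * K := by
        calc (3000 * K : ℝ) ^ c ≤ (3000 * K : ℝ) ^ (1:ℝ) :=
              Real.rpow_le_rpow_of_exponent_le (by linarith) (by linarith)
          _ = _ := Real.rpow_one _
      push_cast
      rw [Real.mul_rpow (by positivity) (by positivity), hp, ← hβK]
      have h0 : (0:ℝ) < 2 ^ (4000 * c * K) := by positivity
      calc (3000 * K : ℝ) ^ c * 2 ^ (4000 * c * K) ≤ 3000 * K * 2 ^ (4000 * c * K) := by gcongr
        _ = 1 / (8000 * K : ℝ) ^ 2 * ((8000 ^ 2 * 3000 * (K:ℝ) ^ 3) * 2 ^ (4000 * c * K)) := by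
            field_simp
        _ ≤ _ := by gcongr)
    (fun j p a1 a2 a3 a4 a5 a6 => valid_K K (by omega) e1 e2' e3 j p a1 a2 a3 a4 a5 a6)
  have hNn : max n1 1 ≤ 3000 * K * 2 ^ (4000 * K) := by
    have h1 : 1 ≤ 2 ^ (4000 * K) := Nat.one_le_two_pow
    calc max n1 1 ≤ K := hKn
      _ ≤ 3000 * K * 1 := by omega
      _ ≤ _ := Nat.mul_le_mul_left _ h1
  have c1 := cl _ hNn le_rfl
  have c2 := hC _ ((le_max_left _ _).trans hNn) _ (first_K K hK10 e3 _ rfl)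
  have c3 := Nat.lt_of_floor_lt c2
  have c4 := WW_top (7992 * K) (8000 * K) (by omega) (by omega) ((3000 * K * 2 ^ (4000 * K) : ℕ) : ℝ)
  rw [hM] at c4
  refine final_num (8000 * K) (2 ^ (4000 * K)) (8000 * K - 2.828) (3000 * K * 2 ^ (4000 * K))
    (8000 * K * 2 ^ (3996 * K)) (by linarith) (by positivity) rfl (by ring) ?_ ?_
  · have h1 : (2:ℝ) * (8000 * K) ^ 3 ≤ 2 ^ (4 * K) := by
      have : (2:ℝ) ^ K ≤ 2 ^ (4 * K) := pow_le_pow_right₀ (by norm_num) (by omega)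
      have h0 : (0:ℝ) ≤ (K:ℝ) ^ 3 := by positivity
      rw [mul_pow]; linarith
    calc 2 * (8000 * K * 2 ^ (3996 * K)) * (8000 * K : ℝ) ^ 2 = (2 * (8000 * K : ℝ) ^ 3) * 2 ^ (3996 * K) := by ring
      _ ≤ 2 ^ (4 * K) * 2 ^ (3996 * K) := by gcongr
      _ = _ := by rw [← pow_add]; congr 1; ring
  · have e : (0.999 * (8000 * K) : ℝ) = 7992 * K := by ring
    rw [e]
    push_cast at c1 c3 c4
    have h0 : (0:ℝ) ≤ 1 + 1 / (8000 * K) ^ 2 := by positivity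
    have := mul_le_mul_of_nonneg_left c4 h0
    linarith

end NC

theorem stmt1 (c : ℝ) (hc0 : 0 < c) (hc : c < 1/4)
    (s t : ℕ → ℝ) (hlen : ∀ n : ℕ, t n - s n ≤ (n : ℝ) ^ c) :
    ¬ Tendsto (fun n : ℕ => PrM n (n ^ 2 / 4) (fun G => (chi n G : ℝ) ∈ Set.Icc (s n) (t n)))
      atTop (nhds 1) := by
  intro h
  obtain ⟨T, n1, hA, hB, hC⟩ := NC.abstract_T c s t hlen h
  exact NC.contra c hc0 hc T n1 hA hB hC
end

section
/- With high probability, χ(G(n,1/2)) ∼ n/(2·log₂ n). Precisely: for every ε > 0, P( |χ(G(n,1/2)) · (2·log₂ n)/n − 1| ≤ ε ) → 1 as n → ∞. -/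
open Filter

/-- Probability of an event under `G(n,1/2)`, i.e. the uniform measure on all
simple graphs on `{1,…,n}` (each edge present independently with probability 1/2). -/
noncomputable def Pr (n : ℕ) (B : SimpleGraph (Fin n) → Prop) : ℝ :=
  (Nat.card {G : SimpleGraph (Fin n) // B G} : ℝ) / (Nat.card (SimpleGraph (Fin n)) : ℝ)


lemma mcd (t : ℝ) : ∀ (N : ℕ) (f : (Fin N → Bool) → ℝ)
    (_ : ∀ x i b, |f x - f (Function.update x i b)| ≤ 1),
    ∑ x, Real.exp (-t * f x) ≤ 2 ^ N * Real.exp (-t * ((∑ x, f x) / 2 ^ N) + t ^ 2 * N / 8) := by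
  intro N
  induction N with
  | zero =>
    intro f _
    simp
  | succ N ih =>
    intro f hf
    have key : ∀ g : (Fin (N+1) → Bool) → ℝ, ∑ x, g x =
        (∑ x : Fin N → Bool, g (Fin.cons true x)) + ∑ x : Fin N → Bool, g (Fin.cons false x) := by
      intro g
      rw [← (Fin.consEquiv (fun _ : Fin (N+1) => Bool)).sum_comp, Fintype.sum_prod_type]
      simp [Fin.consEquiv]
    have h1 := ih (fun x => f (Fin.cons true x)) (fun x i b => by
      have := hf (Fin.cons true x) i.succ b
      rwa [← Fin.cons_update] at this)
    have h0 := ih (fun x => f (Fin.cons false x)) (fun x i b => by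
      have := hf (Fin.cons false x) i.succ b
      rwa [← Fin.cons_update] at this)
    rw [key, key]
    set a := (∑ x : Fin N → Bool, f (Fin.cons true x)) with ha
    set b := (∑ x : Fin N → Bool, f (Fin.cons false x)) with hb
    have hp : (0:ℝ) < 2 ^ N := by positivity
    have hab : |a / 2 ^ N - b / 2 ^ N| ≤ 1 := by
      rw [← sub_div, abs_div, abs_of_pos hp, div_le_one hp, ha, hb, ← Finset.sum_sub_distrib]
      refine (Finset.abs_sum_le_sum_abs _ _).trans ?_
      refine (Finset.sum_le_sum (g := fun _ => (1:ℝ)) fun x _ => ?_).trans ?_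
      · have := hf (Fin.cons true x) 0 false
        rwa [Fin.update_cons_zero] at this
      · simp
    set u := a / 2 ^ N
    set v := b / 2 ^ N
    have hu : (a + b) / 2 ^ (N+1) = (u + v) / 2 := by
      simp only [u, v]; rw [pow_succ]; field_simp
    rw [hu]
    have hc : Real.cosh (t * (u - v) / 2) ≤ Real.exp (t ^ 2 / 8) := by
      refine (Real.cosh_le_exp_half_sq _).trans (Real.exp_le_exp.2 ?_)
      have : (u - v) ^ 2 ≤ 1 := by
        rw [← sq_abs]; exact pow_le_one₀ (abs_nonneg _) hab
      nlinarith [mul_le_mul_of_nonneg_left this (sq_nonneg t)]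
    have e1 : Real.exp (-t * u + t ^ 2 * N / 8) + Real.exp (-t * v + t ^ 2 * N / 8)
        = 2 * Real.exp (-t * ((u + v)/2) + t ^ 2 * N / 8) * Real.cosh (t * (u - v) / 2) := by
      rw [Real.cosh_eq]
      have : ∀ p q r : ℝ, 2 * p * ((q + r)/2) = p * q + p * r := by intros; ring
      rw [this, ← Real.exp_add, ← Real.exp_add, add_comm]
      congr 2 <;> ring
    calc _ ≤ 2 ^ N * (Real.exp (-t * u + t ^ 2 * N / 8) + Real.exp (-t * v + t ^ 2 * N / 8)) := by
          rw [mul_add]; exact add_le_add h1 h0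
      _ ≤ 2 ^ N * (2 * Real.exp (-t * ((u + v)/2) + t ^ 2 * N / 8) * Real.exp (t ^ 2 / 8)) := by
          rw [e1]; gcongr
      _ = _ := by
          rw [mul_assoc 2, ← Real.exp_add, pow_succ 2 N, mul_assoc (2 ^ N)]
          push_cast
          congr 3; ring

lemma mcd' {E : Type*} [Fintype E] [DecidableEq E] (t : ℝ) (f : (E → Bool) → ℝ)
    (hf : ∀ x i b, |f x - f (Function.update x i b)| ≤ 1) :
    ∑ x, Real.exp (-t * f x) ≤ 2 ^ (Fintype.card E) *
      Real.exp (-t * ((∑ x, f x) / 2 ^ (Fintype.card E)) + t ^ 2 * Fintype.card E / 8) := by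
  let e := Fintype.equivFin E
  let ψ : (Fin (Fintype.card E) → Bool) ≃ (E → Bool) := e.symm.arrowCongr (Equiv.refl _)
  have := mcd t (Fintype.card E) (fun x => f (ψ x)) (fun x i b => by
    have h := hf (ψ x) (e.symm i) b
    convert h using 4
    funext j
    by_cases hj : j = e.symm i
    · subst hj; simp [ψ]
    · have : e j ≠ i := fun h => hj (by simp [← h])
      simp [ψ, hj, this])
  rw [ψ.sum_comp f, ψ.sum_comp (fun x => Real.exp (-t * f x))] at this
  exact this

lemma mcd_tail {E : Type*} [Fintype E] [DecidableEq E] (f : (E → Bool) → ℝ)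
    (hf : ∀ x i b, |f x - f (Function.update x i b)| ≤ 1) (hE : 0 < Fintype.card E)
    (μ : ℝ) (hμ0 : 0 ≤ μ) (hμ : μ * 2 ^ (Fintype.card E) ≤ ∑ x, f x)
    (Z : Finset (E → Bool)) (hZ : ∀ x ∈ Z, f x ≤ 0) :
    (Z.card : ℝ) ≤ 2 ^ (Fintype.card E) * Real.exp (- (2 * μ ^ 2 / Fintype.card E)) := by
  have hN : (0:ℝ) < Fintype.card E := by exact_mod_cast hE
  set N : ℝ := (Fintype.card E : ℝ) with hNd
  set t : ℝ := 4 * μ / N with ht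
  have ht0 : 0 ≤ t := by positivity
  have h := mcd' t f hf
  have h1 : (Z.card : ℝ) ≤ ∑ x, Real.exp (-t * f x) := by
    rw [Finset.card_eq_sum_ones]
    push_cast
    refine (Finset.sum_le_sum (g := fun x => Real.exp (-t * f x)) fun x hx => ?_).trans
      (Finset.sum_le_univ_sum_of_nonneg fun x => (Real.exp_pos _).le)
    apply Real.one_le_exp
    nlinarith [hZ x hx]
  refine h1.trans (h.trans ?_)
  gcongr
  have : μ ≤ (∑ x, f x) / 2 ^ (Fintype.card E) := by rw [le_div_iff₀ (by positivity)]; exact hμ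
  have h2 : t * μ ≤ t * ((∑ x, f x) / 2 ^ (Fintype.card E)) := by gcongr
  have h3 : t * μ - t ^ 2 * N / 8 = 2 * μ ^ 2 / N := by
    rw [ht]; field_simp; ring
  rw [← h3]
  linarith

/-- number of zero configurations on `T` -/
lemma card_zero {E : Type*} [Fintype E] [DecidableEq E] (T : Finset E) :
    ((Finset.univ.filter (fun x : E → Bool => ∀ e ∈ T, x e = false)).card : ℝ)
      = 2 ^ (Fintype.card E) * (1/2) ^ T.card := by
  have h : (Finset.univ.filter (fun x : E → Bool => ∀ e ∈ T, x e = false))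
      = Fintype.piFinset (fun e => if e ∈ T then {false} else Finset.univ) := by
    ext x
    simp only [Finset.mem_filter, Finset.mem_univ, true_and, Fintype.mem_piFinset]
    refine forall_congr' fun e => ?_
    by_cases he : e ∈ T <;> simp [he]
  rw [h, Fintype.card_piFinset]
  have : ∀ e : E, (if e ∈ T then ({false} : Finset Bool) else Finset.univ).card = if e ∈ T then 1 else 2 := by
    intro e; split_ifs <;> simp
  simp only [this]
  rw [Finset.prod_ite]
  simp only [Finset.prod_const_one, one_mul, Finset.prod_const]
  have h2 : (Finset.univ.filter (fun e => e ∉ T)).card + T.card = Fintype.card E := by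
    rw [← Finset.card_compl_add_card T]
    congr 2; ext; simp
  rw [← h2, pow_add]
  push_cast
  rw [mul_assoc, ← mul_pow]; norm_num

set_option linter.unusedSectionVars false
section J
variable {E ι : Type*} [Fintype E] [DecidableEq E] [DecidableEq ι]

/-- quadratic functional -/
noncomputable def QQ (K : Finset ι) (T : ι → Finset E) (w : ι → ℝ) : ℝ :=
  ∑ A ∈ K, w A - (1/2) * ∑ A ∈ K, ∑ B ∈ K, if Disjoint (T A) (T B) then 0 else w A * w B

def Adm (K : Finset ι) (T : ι → Finset E) (x : E → Bool) (w : ι → ℝ) : Prop :=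
  (∀ A, 0 ≤ w A) ∧ ∀ A ∈ K, w A ≠ 0 → ∀ e ∈ T A, x e = false

noncomputable def FF (K : Finset ι) (T : ι → Finset E) (x : E → Bool) : ℝ :=
  sSup (QQ K T '' {w | Adm K T x w})

lemma QQ_le (K : Finset ι) (T : ι → Finset E) (hT : ∀ A ∈ K, (T A).Nonempty) (w : ι → ℝ)
    (hw : ∀ A, 0 ≤ w A) : QQ K T w ≤ K.card := by
  unfold QQ
  have : ∑ A ∈ K, (w A)^2 ≤ ∑ A ∈ K, ∑ B ∈ K, if Disjoint (T A) (T B) then 0 else w A * w B := by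
    refine Finset.sum_le_sum fun A hA => ?_
    refine le_trans ?_ (Finset.single_le_sum (f := fun B => if Disjoint (T A) (T B) then 0 else w A * w B) (fun B _ => ?_) hA)
    · have : ¬ Disjoint (T A) (T A) := by
        rw [disjoint_self]; exact (hT A hA).ne_empty
      simp only [this, if_false]; rw [sq]
    · split_ifs
      · rfl
      · exact mul_nonneg (hw _) (hw _)
  have h2 : ∑ A ∈ K, w A - (1/2) * ∑ A ∈ K, (w A)^2 ≤ K.card := by
    rw [Finset.mul_sum, ← Finset.sum_sub_distrib, Finset.card_eq_sum_ones]
    push_cast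
    exact Finset.sum_le_sum fun A _ => by nlinarith [sq_nonneg (w A - 1)]
  linarith

lemma FF_bdd (K : Finset ι) (T : ι → Finset E) (hT : ∀ A ∈ K, (T A).Nonempty) (x : E → Bool) :
    BddAbove (QQ K T '' {w | Adm K T x w}) := by
  refine ⟨K.card, ?_⟩
  rintro _ ⟨w, hw, rfl⟩
  exact QQ_le K T hT w hw.1

lemma FF_nonempty (K : Finset ι) (T : ι → Finset E) (x : E → Bool) :
    (QQ K T '' {w | Adm K T x w}).Nonempty :=
  ⟨_, 0, by simp [Adm], rfl⟩

lemma FF_lip1 (K : Finset ι) (T : ι → Finset E) (hT : ∀ A ∈ K, (T A).Nonempty) (x : E → Bool)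
    (i : E) (b : Bool) : FF K T x ≤ FF K T (Function.update x i b) + 1 := by
  apply csSup_le (FF_nonempty K T x)
  rintro _ ⟨w, hw, rfl⟩
  let w' : ι → ℝ := fun A => if i ∈ T A then 0 else w A
  let d : ι → ℝ := fun A => if i ∈ T A then w A else 0
  have hw' : Adm K T (Function.update x i b) w' := by
    refine ⟨fun A => ?_, fun A hA h e he => ?_⟩
    · simp only [w']; split_ifs
      · rfl
      · exact hw.1 A
    · by_cases hi : i ∈ T A
      · simp [w', hi] at h
      · simp only [w', hi, if_false] at h
        rw [Function.update_of_ne]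
        · exact hw.2 A hA h e he
        · rintro rfl; exact hi he
  have h1 : QQ K T w' ≤ FF K T (Function.update x i b) :=
    le_csSup (FF_bdd K T hT _) ⟨w', hw', rfl⟩
  have h2 : QQ K T w ≤ QQ K T w' + 1 := by
    have hs : ∑ A ∈ K, w A = ∑ A ∈ K, w' A + ∑ A ∈ K, d A := by
      rw [← Finset.sum_add_distrib]
      refine Finset.sum_congr rfl fun A _ => ?_
      simp only [w', d]; split_ifs <;> simp
    have hd : (∑ A ∈ K, ∑ B ∈ K, if Disjoint (T A) (T B) then 0 else w' A * w' B)
        + (∑ A ∈ K, d A) * (∑ B ∈ K, d B) ≤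
        ∑ A ∈ K, ∑ B ∈ K, if Disjoint (T A) (T B) then 0 else w A * w B := by
      rw [Finset.sum_mul_sum, ← Finset.sum_add_distrib]
      refine Finset.sum_le_sum fun A _ => ?_
      rw [← Finset.sum_add_distrib]
      refine Finset.sum_le_sum fun B _ => ?_
      have hwA := hw.1 A
      have hwB := hw.1 B
      have hAB := mul_nonneg hwA hwB
      by_cases hA : i ∈ T A <;> by_cases hB : i ∈ T B
      · have : ¬ Disjoint (T A) (T B) := Finset.not_disjoint_iff.2 ⟨i, hA, hB⟩
        simp [w', d, hA, hB, this]
      all_goals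
        simp only [w', d, hA, hB, if_true, if_false, mul_zero, zero_mul, ite_self, add_zero, le_refl]
      all_goals
        split_ifs
        · exact le_rfl
        · exact hAB
    unfold QQ
    nlinarith [sq_nonneg (∑ A ∈ K, d A - 1)]
  linarith

lemma FF_lip (K : Finset ι) (T : ι → Finset E) (hT : ∀ A ∈ K, (T A).Nonempty) (x : E → Bool)
    (i : E) (b : Bool) : |FF K T x - FF K T (Function.update x i b)| ≤ 1 := by
  have h1 := FF_lip1 K T hT x i b
  have h2 := FF_lip1 K T hT (Function.update x i b) i (x i)
  rw [Function.update_idem, Function.update_eq_self] at h2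
  rw [abs_le]; constructor <;> linarith

lemma FF_mean (K : Finset ι) (T : ι → Finset E) (hT : ∀ A ∈ K, (T A).Nonempty) (c : ℝ) (hc : 0 ≤ c) :
    (c * ∑ A ∈ K, (1/2:ℝ) ^ (T A).card - c^2/2 * ∑ A ∈ K, ∑ B ∈ K,
      if Disjoint (T A) (T B) then 0 else (1/2:ℝ) ^ (T A ∪ T B).card) * 2 ^ (Fintype.card E)
      ≤ ∑ x, FF K T x := by
  classical
  let w : (E → Bool) → ι → ℝ := fun x A => if ∀ e ∈ T A, x e = false then c else 0
  have h : ∑ x, QQ K T (w x) ≤ ∑ x, FF K T x := by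
    refine Finset.sum_le_sum fun x _ => le_csSup (FF_bdd K T hT _) ⟨w x, ⟨fun A => ?_, fun A hA h => ?_⟩, rfl⟩
    · simp only [w]; split_ifs
      · exact hc
      · rfl
    · by_contra h'
      simp [w, h'] at h
  refine le_of_eq_of_le ?_ h
  unfold QQ
  rw [Finset.sum_sub_distrib, ← Finset.mul_sum]
  have e1 : ∀ A, ∑ x, w x A = c * (1/2:ℝ) ^ (T A).card * 2 ^ (Fintype.card E) := by
    intro A
    simp only [w]
    rw [Finset.sum_ite]
    simp only [Finset.sum_const, nsmul_eq_mul, mul_zero, add_zero]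
    rw [card_zero]; ring
  have e2 : ∀ A B, ∑ x, w x A * w x B = c^2 * (1/2:ℝ) ^ (T A ∪ T B).card * 2 ^ (Fintype.card E) := by
    intro A B
    have : ∀ x, w x A * w x B = if ∀ e ∈ T A ∪ T B, x e = false then c^2 else 0 := by
      intro x
      by_cases hA : ∀ e ∈ T A, x e = false <;> by_cases hB : ∀ e ∈ T B, x e = false
      · have : ∀ e ∈ T A ∪ T B, x e = false := by
          intro e he; rcases Finset.mem_union.1 he with h | h
          · exact hA e h
          · exact hB e h
        simp only [w]; rw [if_pos hA, if_pos hB, if_pos this]; ring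
      · have : ¬ ∀ e ∈ T A ∪ T B, x e = false := fun h => hB fun e he => h e (Finset.mem_union_right _ he)
        simp only [w]; rw [if_neg hB, if_neg this]; ring
      all_goals
        have : ¬ ∀ e ∈ T A ∪ T B, x e = false := fun h => hA fun e he => h e (Finset.mem_union_left _ he)
        simp only [w]; rw [if_neg hA, if_neg this]; ring
    simp only [this]
    rw [Finset.sum_ite]
    simp only [Finset.sum_const, nsmul_eq_mul, mul_zero, add_zero]
    rw [card_zero]; ring
  have e3 : ∑ x, ∑ A ∈ K, ∑ B ∈ K, (if Disjoint (T A) (T B) then 0 else w x A * w x B)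
      = ∑ A ∈ K, ∑ B ∈ K, if Disjoint (T A) (T B) then 0 else c^2 * (1/2:ℝ) ^ (T A ∪ T B).card * 2 ^ (Fintype.card E) := by
    rw [Finset.sum_comm]
    refine Finset.sum_congr rfl fun A _ => ?_
    rw [Finset.sum_comm]
    refine Finset.sum_congr rfl fun B _ => ?_
    split_ifs
    · simp
    · exact e2 A B
  rw [e3, Finset.sum_comm (s := Finset.univ) (t := K), Finset.sum_congr rfl fun A _ => e1 A]
  rw [sub_mul]
  congr 1
  · simp only [Finset.mul_sum, Finset.sum_mul]
  · simp only [Finset.mul_sum, Finset.sum_mul]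
    refine Finset.sum_congr rfl fun A _ => Finset.sum_congr rfl fun B _ => ?_
    split_ifs <;> ring

lemma janson (K : Finset ι) (T : ι → Finset E) (hT : ∀ A ∈ K, (T A).Nonempty)
    (hE : 0 < Fintype.card E) (p ρ : ℝ) (hp : 0 < p) (hρ : 0 < ρ) (hK : 0 < K.card)
    (h1 : ∀ A ∈ K, (1/2:ℝ) ^ (T A).card = p)
    (h2 : ∑ A ∈ K, ∑ B ∈ K, (if Disjoint (T A) (T B) then 0 else (1/2:ℝ) ^ (T A ∪ T B).card)
      ≤ (K.card * p)^2 * ρ)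
    (Z : Finset (E → Bool)) (hZ : ∀ x ∈ Z, ∀ A ∈ K, ∃ e ∈ T A, x e = true) :
    (Z.card : ℝ) ≤ 2 ^ (Fintype.card E) * Real.exp (- (1 / (2 * ρ ^ 2 * Fintype.card E))) := by
  have hK' : (0:ℝ) < K.card := by exact_mod_cast hK
  have hN : (0:ℝ) < Fintype.card E := by exact_mod_cast hE
  have := mcd_tail (FF K T) (FF_lip K T hT) hE (1 / (2 * ρ)) (by positivity) ?_ Z ?_
  · convert this using 4
    field_simp
  · refine le_trans ?_ (FF_mean K T hT (1 / (K.card * p * ρ)) (by positivity))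
    gcongr
    rw [Finset.sum_congr rfl h1, Finset.sum_const, nsmul_eq_mul]
    have : (1 / (K.card * p * ρ))^2/2 * ∑ A ∈ K, ∑ B ∈ K, (if Disjoint (T A) (T B) then 0 else (1/2:ℝ) ^ (T A ∪ T B).card)
      ≤ (1 / (K.card * p * ρ))^2/2 * ((K.card * p)^2 * ρ) := by gcongr
    have e : 1 / (K.card * p * ρ) * (K.card * p) - (1 / (K.card * p * ρ))^2/2 * ((K.card * p)^2 * ρ) = 1 / (2 * ρ) := by
      field_simp; ring
    linarith
  · intro x hx
    apply csSup_le (FF_nonempty K T x)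
    rintro _ ⟨w, hw, rfl⟩
    have h0 : ∀ A ∈ K, w A = 0 := by
      intro A hA
      by_contra h
      obtain ⟨e, he, hxe⟩ := hZ x hx A hA
      simp [hw.2 A hA h e he] at hxe
    unfold QQ
    rw [Finset.sum_eq_zero h0, Finset.sum_eq_zero]
    · simp
    · intro A hA
      refine Finset.sum_eq_zero fun B hB => ?_
      simp [h0 A hA]
end J

lemma desc_le (k m : ℕ) (hkm : k ≤ m) (l : ℕ) :
    k.descFactorial l * m ^ l ≤ m.descFactorial l * k ^ l := by
  induction l with
  | zero => simp
  | succ l ih =>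
    rw [Nat.descFactorial_succ, Nat.descFactorial_succ, pow_succ, pow_succ]
    have h : (k - l) * m ≤ (m - l) * k := by
      rw [Nat.sub_mul, Nat.sub_mul, mul_comm m k]
      exact Nat.sub_le_sub_left (Nat.mul_le_mul_left _ hkm) _
    calc (k - l) * k.descFactorial l * (m ^ l * m) = (k.descFactorial l * m ^ l) * ((k - l) * m) := by ring
      _ ≤ (m.descFactorial l * k ^ l) * ((m - l) * k) := Nat.mul_le_mul ih h
      _ = _ := by ring

lemma choose_le (k m : ℕ) (hkm : k ≤ m) (l : ℕ) :
    k.choose l * m ^ l ≤ m.choose l * k ^ l := by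
  have := desc_le k m hkm l
  rw [Nat.descFactorial_eq_factorial_mul_choose, Nat.descFactorial_eq_factorial_mul_choose,
    mul_assoc, mul_assoc] at this
  exact Nat.le_of_mul_le_mul_left this (Nat.factorial_pos l)

lemma count_super {α : Type*} [DecidableEq α] (S T : Finset α) (k : ℕ) (hT : T ⊆ S) :
    ((S.powersetCard k).filter (fun B => T ⊆ B)).card ≤ (S.card - T.card).choose (k - T.card) := by
  rw [← Finset.card_sdiff_of_subset hT, ← Finset.card_powersetCard]
  refine Finset.card_le_card_of_injOn (fun B => B \ T) ?_ ?_
  · intro B hB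
    simp only [Finset.coe_filter, Finset.mem_powersetCard, Set.mem_ofPred_eq] at hB
    simp only [Finset.mem_coe, Finset.mem_powersetCard]
    exact ⟨Finset.sdiff_subset_sdiff hB.1.1 le_rfl, by rw [Finset.card_sdiff_of_subset hB.2, hB.1.2]⟩
  · intro B hB C hC h
    simp only [Finset.coe_filter, Finset.mem_powersetCard, Set.mem_ofPred_eq] at hB hC
    simp only at h
    rw [← Finset.sdiff_union_of_subset hB.2, ← Finset.sdiff_union_of_subset hC.2, h]

lemma count_inter {α : Type*} [DecidableEq α] (S A : Finset α) (k l : ℕ) (hk : k ≤ S.card)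
    (hl : l ≤ k) (hS : 0 < S.card)
    (hA : A ∈ S.powersetCard k) :
    (((S.powersetCard k).filter (fun B => (A ∩ B).card = l)).card : ℝ)
      ≤ (S.powersetCard k).card * ((k:ℝ)^2 / S.card) ^ l := by
  rw [Finset.mem_powersetCard] at hA
  have h1 : ((S.powersetCard k).filter (fun B => (A ∩ B).card = l)) ⊆
      (A.powersetCard l).biUnion (fun T => (S.powersetCard k).filter (fun B => T ⊆ B)) := by
    intro B hB
    rw [Finset.mem_filter] at hB
    rw [Finset.mem_biUnion]
    exact ⟨A ∩ B, Finset.mem_powersetCard.2 ⟨Finset.inter_subset_left, hB.2⟩,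
      Finset.mem_filter.2 ⟨hB.1, Finset.inter_subset_right⟩⟩
  have h2 : ((S.powersetCard k).filter (fun B => (A ∩ B).card = l)).card ≤
      k.choose l * (S.card - l).choose (k - l) := by
    refine (Finset.card_le_card h1).trans ?_
    refine (Finset.card_biUnion_le_card_mul _ _ ((S.card - l).choose (k - l)) ?_).trans ?_
    · intro T hT
      rw [Finset.mem_powersetCard] at hT
      have := count_super S T k (hT.1.trans hA.1)
      rwa [hT.2] at this
    · rw [Finset.card_powersetCard, hA.2]
  rw [Finset.card_powersetCard]
  set m := S.card
  have hm : (0:ℝ) < m := by exact_mod_cast hS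
  have h3 : m.choose k * k.choose l = m.choose l * (m - l).choose (k - l) := Nat.choose_mul hl
  have h4 := choose_le k m hk l
  have h5 : k.choose l ≤ k ^ l := Nat.choose_le_pow k l
  have hpos : 0 < m.choose l := Nat.choose_pos (hl.trans hk)
  have h6 : k.choose l * (m - l).choose (k - l) * m ^ l ≤ m.choose k * (k^2)^l := by
    refine Nat.le_of_mul_le_mul_left ?_ hpos
    calc m.choose l * (k.choose l * (m - l).choose (k - l) * m ^ l)
        = (m.choose l * (m - l).choose (k - l)) * (k.choose l * m ^ l) := by ring
      _ = m.choose k * k.choose l * (k.choose l * m ^ l) := by rw [h3]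
      _ ≤ m.choose k * k ^ l * (m.choose l * k ^ l) := by gcongr
      _ = _ := by rw [pow_right_comm, sq]; ring
  rw [div_pow, mul_div_assoc', le_div_iff₀ (by positivity)]
  have h7 := (Nat.mul_le_mul_right (m ^ l) h2).trans h6
  exact_mod_cast h7

abbrev EE (n : ℕ) := {e : Sym2 (Fin n) // ¬ e.IsDiag}

def TT (n : ℕ) (A : Finset (Fin n)) : Finset (EE n) :=
  Finset.univ.filter (fun e => ∀ v ∈ e.1, v ∈ A)

lemma TT_card (n : ℕ) (A : Finset (Fin n)) : (TT n A).card = A.card.choose 2 := by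
  rw [← Sym2.card_image_offDiag, ← Finset.card_map (Function.Embedding.subtype _)]
  congr 1
  ext e
  induction e with | _ a b =>
  simp only [TT, Finset.mem_map, Finset.mem_filter, Finset.mem_univ, true_and,
    Function.Embedding.subtype_apply, Subtype.exists, exists_and_right, exists_eq_right,
    Finset.mem_image, Finset.mem_offDiag, Prod.exists]
  constructor
  · rintro ⟨h1, h2⟩
    refine ⟨a, b, ⟨h2 a (by simp), h2 b (by simp), ?_⟩, rfl⟩
    simpa using h1
  · rintro ⟨c, d, ⟨h1, h2, h3⟩, h⟩
    rw [← h]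
    refine ⟨by simpa using h3, ?_⟩
    intro v hv
    rcases Sym2.mem_iff.1 hv with rfl | rfl <;> assumption

lemma TT_inter (n : ℕ) (A B : Finset (Fin n)) : TT n A ∩ TT n B = TT n (A ∩ B) := by
  ext e
  simp only [TT, Finset.mem_inter, Finset.mem_filter, Finset.mem_univ, true_and]
  exact ⟨fun h v hv => ⟨h.1 v hv, h.2 v hv⟩, fun h => ⟨fun v hv => (h v hv).1, fun v hv => (h v hv).2⟩⟩

lemma EE_card (n : ℕ) : Fintype.card (EE n) = n.choose 2 := by
  have := TT_card n Finset.univ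
  simpa [TT] using this

lemma bad_S (n k : ℕ) (S : Finset (Fin n)) (hk2 : 2 ≤ k) (hk : k ≤ S.card) (ρ : ℝ)
    (hρ : ∑ l ∈ Finset.Icc 2 k, ((k:ℝ)^2 / S.card) ^ l * 2 ^ (l.choose 2) ≤ ρ) (hρ0 : 0 < ρ)
    (Z : Finset (EE n → Bool)) (hZ : ∀ x ∈ Z, ∀ A ⊆ S, A.card = k → ∃ e ∈ TT n A, x e = true) :
    (Z.card : ℝ) ≤ 2 ^ (n.choose 2) * Real.exp (- (1 / (2 * ρ ^ 2 * (n.choose 2 : ℕ)))) := by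
  have hn : 2 ≤ n := by
    have := S.card_le_univ
    simp at this; omega
  have hE : 0 < Fintype.card (EE n) := by
    rw [EE_card]; exact Nat.choose_pos hn
  have hK : ∀ A ∈ S.powersetCard k, (TT n A).card = k.choose 2 := by
    intro A hA
    rw [TT_card, (Finset.mem_powersetCard.1 hA).2]
  set p : ℝ := (1/2:ℝ)^(k.choose 2) with hp
  have := janson (S.powersetCard k) (TT n) ?_ hE p ρ (by positivity) hρ0 ?_ ?_ ?_ Z ?_
  · rwa [EE_card] at this
  · intro A hA
    rw [← Finset.card_pos, hK A hA]
    exact Nat.choose_pos hk2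
  · rw [Finset.card_powersetCard]; exact Nat.choose_pos hk
  · intro A hA; rw [hK A hA]
  · have hA : ∀ A ∈ S.powersetCard k, ∑ B ∈ S.powersetCard k, (if Disjoint (TT n A) (TT n B) then 0 else (1/2:ℝ) ^ (TT n A ∪ TT n B).card)
        ≤ (S.powersetCard k).card * p^2 * ρ := by
      intro A hA
      calc _ ≤ ∑ B ∈ S.powersetCard k, ∑ l ∈ Finset.Icc 2 k, (if (A ∩ B).card = l then p^2 * 2 ^ (l.choose 2) else 0) := by
            refine Finset.sum_le_sum fun B hB => ?_
            rw [Finset.sum_ite_eq]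
            split_ifs with h1 h2 h2
            · positivity
            · rfl
            · have e1 := Finset.card_union_add_card_inter (TT n A) (TT n B)
              rw [TT_inter, hK A hA, hK B hB, TT_card] at e1
              have : (1/2:ℝ) ^ (TT n A ∪ TT n B).card * (1/2:ℝ)^((A ∩ B).card.choose 2) = p^2 := by
                rw [← pow_add, e1, hp, sq, pow_add]
              rw [← this, mul_assoc, ← mul_pow]; norm_num
            · exfalso
              apply h1
              rw [Finset.disjoint_iff_inter_eq_empty, TT_inter, ← Finset.card_eq_zero, TT_card]
              apply Nat.choose_eq_zero_of_lt
              by_contra h3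
              apply h2
              rw [Finset.mem_Icc]
              refine ⟨by omega, ?_⟩
              rw [← (Finset.mem_powersetCard.1 hA).2]
              exact Finset.card_le_card Finset.inter_subset_left
        _ = ∑ l ∈ Finset.Icc 2 k, ((S.powersetCard k).filter (fun B => (A ∩ B).card = l)).card * (p^2 * 2 ^ (l.choose 2)) := by
            rw [Finset.sum_comm]
            refine Finset.sum_congr rfl fun l _ => ?_
            rw [Finset.sum_ite]
            simp
        _ ≤ ∑ l ∈ Finset.Icc 2 k, ((S.powersetCard k).card * ((k:ℝ)^2 / S.card) ^ l) * (p^2 * 2 ^ (l.choose 2)) := by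
            refine Finset.sum_le_sum fun l hl => ?_
            gcongr
            exact count_inter S A k l hk (Finset.mem_Icc.1 hl).2 (by omega) hA
        _ = (S.powersetCard k).card * p^2 * ∑ l ∈ Finset.Icc 2 k, ((k:ℝ)^2 / S.card) ^ l * 2 ^ (l.choose 2) := by
            rw [Finset.mul_sum]
            exact Finset.sum_congr rfl fun l _ => by ring
        _ ≤ _ := by gcongr
    refine (Finset.sum_le_sum hA).trans ?_
    rw [Finset.sum_const, nsmul_eq_mul]
    apply le_of_eq; ring
  · intro x hx A hA
    rw [Finset.mem_powersetCard] at hA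
    exact hZ x hx A hA.1 hA.2

/-- first moment bound -/
lemma first_moment (n r : ℕ) (Z : Finset (EE n → Bool))
    (hZ : ∀ x ∈ Z, ∃ A : Finset (Fin n), A.card = r ∧ ∀ e ∈ TT n A, x e = false) :
    (Z.card : ℝ) ≤ 2 ^ (n.choose 2) * ((n:ℝ) ^ r * (1/2) ^ (r.choose 2)) := by
  have h1 : Z ⊆ (Finset.univ.powersetCard r).biUnion (fun A : Finset (Fin n) =>
      Finset.univ.filter (fun x : EE n → Bool => ∀ e ∈ TT n A, x e = false)) := by
    intro x hx
    obtain ⟨A, hA, h⟩ := hZ x hx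
    rw [Finset.mem_biUnion]
    exact ⟨A, by simp [hA], by simpa using h⟩
  have h2 : (Z.card : ℝ) ≤ ∑ A ∈ (Finset.univ.powersetCard r : Finset (Finset (Fin n))),
      ((Finset.univ.filter (fun x : EE n → Bool => ∀ e ∈ TT n A, x e = false)).card : ℝ) := by
    exact_mod_cast (Finset.card_le_card h1).trans Finset.card_biUnion_le
  refine h2.trans ?_
  have h3 : ∀ A ∈ (Finset.univ.powersetCard r : Finset (Finset (Fin n))),
      ((Finset.univ.filter (fun x : EE n → Bool => ∀ e ∈ TT n A, x e = false)).card : ℝ)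
      = 2 ^ (n.choose 2) * (1/2) ^ (r.choose 2) := by
    intro A hA
    rw [card_zero, EE_card, TT_card, (Finset.mem_powersetCard.1 hA).2]
  rw [Finset.sum_congr rfl h3, Finset.sum_const, nsmul_eq_mul, Finset.card_powersetCard]
  have : ((Finset.univ : Finset (Fin n)).card.choose r : ℝ) ≤ (n:ℝ)^r := by
    simp only [Finset.card_univ, Fintype.card_fin]
    exact_mod_cast Nat.choose_le_pow n r
  calc _ ≤ (n:ℝ)^r * (2 ^ (n.choose 2) * (1/2) ^ (r.choose 2)) := by gcongr
    _ = _ := by ring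
open Classical in
/-- graphs as points of the cube -/
noncomputable def gE (n : ℕ) : SimpleGraph (Fin n) ≃ (EE n → Bool) where
  toFun G e := decide (e.1 ∈ G.edgeSet)
  invFun x := SimpleGraph.fromEdgeSet {e | ∃ h : ¬ e.IsDiag, x ⟨e, h⟩ = true}
  left_inv G := by
    ext a b
    simp only [SimpleGraph.fromEdgeSet_adj, decide_eq_true_eq, Set.mem_ofPred_eq,
      SimpleGraph.mem_edgeSet]
    constructor
    · rintro ⟨⟨_, h⟩, _⟩; exact h
    · intro h; exact ⟨⟨by simpa using h.ne, h⟩, h.ne⟩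
  right_inv x := by
    funext e
    obtain ⟨e, he⟩ := e
    have : e ∈ (SimpleGraph.fromEdgeSet {e | ∃ h : ¬ e.IsDiag, x ⟨e, h⟩ = true}).edgeSet ↔ x ⟨e, he⟩ = true := by
      rw [SimpleGraph.edgeSet_fromEdgeSet]
      constructor
      · rintro ⟨⟨h, h'⟩, _⟩; exact h'
      · intro h; exact ⟨⟨he, h⟩, he⟩
    simp only [this]
    simp

lemma card_graphs (n : ℕ) : (Nat.card (SimpleGraph (Fin n)) : ℝ) = 2 ^ (n.choose 2) := by
  rw [Nat.card_congr (gE n), Nat.card_eq_fintype_card, Fintype.card_fun, EE_card]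
  simp

lemma Pr_le_of (n : ℕ) (B : SimpleGraph (Fin n) → Prop) (c : ℝ)
    (h : ∀ Z : Finset (EE n → Bool), (∀ x ∈ Z, B ((gE n).symm x)) → (Z.card : ℝ) ≤ 2 ^ (n.choose 2) * c) :
    Pr n B ≤ c := by
  classical
  unfold Pr
  rw [card_graphs, div_le_iff₀ (by positivity), mul_comm]
  have e : {G : SimpleGraph (Fin n) // B G} ≃ {x : EE n → Bool // B ((gE n).symm x)} :=
    (gE n).subtypeEquiv (by simp)
  rw [Nat.card_congr e, Nat.card_eq_fintype_card, Fintype.card_subtype]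
  exact h _ (by simp)

lemma Pr_le_one (n : ℕ) (B : SimpleGraph (Fin n) → Prop) : Pr n B ≤ 1 := by
  unfold Pr
  rw [div_le_one (by rw [card_graphs]; positivity)]
  exact_mod_cast Nat.card_le_card_of_injective _ Subtype.val_injective

lemma Pr_cover (n : ℕ) (B B1 B2 : SimpleGraph (Fin n) → Prop) (h : ∀ G, ¬ B1 G → ¬ B2 G → B G) :
    1 ≤ Pr n B + (Pr n B1 + Pr n B2) := by
  classical
  have hc := card_graphs n
  unfold Pr
  have hp : (0:ℝ) < Nat.card (SimpleGraph (Fin n)) := by rw [hc]; positivity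
  rw [← add_div, ← add_div, one_le_div hp]
  simp only [Nat.card_eq_fintype_card, Fintype.card_subtype]
  rw [← Finset.card_univ]
  norm_cast
  have : (Finset.univ : Finset (SimpleGraph (Fin n))) ⊆ Finset.univ.filter B ∪ (Finset.univ.filter B1 ∪ Finset.univ.filter B2) := by
    intro G _
    simp only [Finset.mem_union, Finset.mem_filter, Finset.mem_univ, true_and]
    by_cases h1 : B1 G
    · simp [h1]
    · by_cases h2 : B2 G
      · simp [h2]
      · simp [h G h1 h2]
  refine (Finset.card_le_card this).trans ((Finset.card_union_le _ _).trans ?_)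
  gcongr
  exact Finset.card_union_le _ _

def Bad1 (n r : ℕ) (G : SimpleGraph (Fin n)) : Prop :=
  ∃ A : Finset (Fin n), A.card = r ∧ ∀ u ∈ A, ∀ v ∈ A, ¬ G.Adj u v

def Bad2 (n k m : ℕ) (G : SimpleGraph (Fin n)) : Prop :=
  ∃ S : Finset (Fin n), S.card = m ∧ ∀ A ⊆ S, A.card = k → ∃ u ∈ A, ∃ v ∈ A, G.Adj u v

lemma gE_adj (n : ℕ) (x : EE n → Bool) (u v : Fin n) (h : ¬ (s(u,v)).IsDiag) :
    ((gE n).symm x).Adj u v ↔ x ⟨s(u,v), h⟩ = true := by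
  simp only [gE, Equiv.coe_fn_symm_mk, SimpleGraph.fromEdgeSet_adj, Set.mem_ofPred_eq]
  constructor
  · rintro ⟨⟨_, h⟩, _⟩; exact h
  · intro h'; exact ⟨⟨h, h'⟩, by simpa using h⟩

lemma Pr_bad1 (n r : ℕ) : Pr n (Bad1 n r) ≤ (n:ℝ) ^ r * (1/2) ^ (r.choose 2) := by
  refine Pr_le_of _ _ _ fun Z hZ => first_moment n r Z fun x hx => ?_
  obtain ⟨A, hA, h⟩ := hZ x hx
  refine ⟨A, hA, ?_⟩
  rintro ⟨e, he⟩ heA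
  induction e with | _ a b =>
  simp only [TT, Finset.mem_filter, Finset.mem_univ, true_and] at heA
  have := h a (heA a (by simp)) b (heA b (by simp))
  rw [gE_adj n x a b he] at this
  simpa using this

lemma Pr_bad2 (n k m : ℕ) (hk2 : 2 ≤ k) (hk : k ≤ m) (ρ : ℝ)
    (hρ : ∑ l ∈ Finset.Icc 2 k, ((k:ℝ)^2 / m) ^ l * 2 ^ (l.choose 2) ≤ ρ) (hρ0 : 0 < ρ) :
    Pr n (Bad2 n k m) ≤ 2 ^ n * Real.exp (- (1 / (2 * ρ ^ 2 * (n.choose 2 : ℕ)))) := by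
  classical
  refine Pr_le_of _ _ _ fun Z hZ => ?_
  let P : Finset (Fin n) → (EE n → Bool) → Prop := fun S x => S.card = m ∧
    ∀ A ⊆ S, A.card = k → ∃ u ∈ A, ∃ v ∈ A, ((gE n).symm x).Adj u v
  have h1 : Z ⊆ (Finset.univ : Finset (Finset (Fin n))).biUnion (fun S => Finset.univ.filter (P S)) := by
    intro x hx
    obtain ⟨S, hS⟩ := hZ x hx
    rw [Finset.mem_biUnion]
    exact ⟨S, by simp, by simpa [P] using hS⟩
  have h2 : (Z.card : ℝ) ≤ ∑ S : Finset (Fin n), ((Finset.univ.filter (P S)).card : ℝ) := by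
    exact_mod_cast (Finset.card_le_card h1).trans Finset.card_biUnion_le
  refine h2.trans ?_
  have h3 : ∀ S ∈ (Finset.univ : Finset (Finset (Fin n))), ((Finset.univ.filter (P S)).card : ℝ)
      ≤ 2 ^ (n.choose 2) * Real.exp (- (1 / (2 * ρ ^ 2 * (n.choose 2 : ℕ)))) := by
    intro S _
    by_cases hS : S.card = m
    · subst hS
      refine bad_S n k S hk2 hk ρ hρ hρ0 _ ?_
      intro x hx A hA hAk
      simp only [P, Finset.mem_filter, Finset.mem_univ, true_and] at hx
      obtain ⟨u, hu, v, hv, huv⟩ := hx A hA hAk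
      have hd : ¬ (s(u,v)).IsDiag := by simpa using huv.ne
      refine ⟨⟨s(u,v), hd⟩, ?_, (gE_adj n x u v hd).1 huv⟩
      simp only [TT, Finset.mem_filter, Finset.mem_univ, true_and]
      intro w hw
      rcases Sym2.mem_iff.1 hw with rfl | rfl <;> assumption
    · have : Finset.univ.filter (P S) = ∅ := by
        ext x; simp [P, hS]
      rw [this]; simp; positivity
  refine (Finset.sum_le_sum h3).trans ?_
  rw [Finset.sum_const, nsmul_eq_mul]
  simp only [Finset.card_univ, Fintype.card_finset, Fintype.card_fin]
  push_cast
  apply le_of_eq; ring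

lemma chi_colorable (n : ℕ) (G : SimpleGraph (Fin n)) : G.Colorable (chi n G) := by
  unfold chi
  have h : G.chromaticNumber ≠ ⊤ := by
    rw [SimpleGraph.chromaticNumber_ne_top_iff_exists]
    exact ⟨_, G.colorable_of_fintype⟩
  rw [← SimpleGraph.chromaticNumber_le_iff_colorable, ENat.natCast_toNat h]

lemma chi_le (n : ℕ) (G : SimpleGraph (Fin n)) (c : ℕ) (h : G.Colorable c) : chi n G ≤ c := by
  unfold chi
  exact ENat.toNat_le_of_le_natCast h.chromaticNumber_le

lemma chi_lower (n r : ℕ) (G : SimpleGraph (Fin n)) (h : ¬ Bad1 n r G) : n ≤ chi n G * r := by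
  classical
  obtain ⟨c⟩ := chi_colorable n G
  have h1 : ∀ a : Fin (chi n G), (Finset.univ.filter (fun v => c v = a)).card ≤ r := by
    intro a
    by_contra h'
    push Not at h'
    obtain ⟨A, hA, hr⟩ := Finset.exists_subset_card_eq h'.le
    apply h
    refine ⟨A, hr, fun u hu v hv huv => c.valid huv ?_⟩
    have h1 := hA hu
    have h2 := hA hv
    simp at h1 h2
    rw [h1, h2]
  have := Finset.card_le_mul_card_image_of_maps_to (s := (Finset.univ : Finset (Fin n)))
    (t := (Finset.univ : Finset (Fin (chi n G)))) (f := c) (fun _ _ => Finset.mem_univ _) r (fun a _ => h1 a)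
  simpa [mul_comm] using this

lemma chi_upper (n k m : ℕ) (hk : 0 < k) (G : SimpleGraph (Fin n)) (h : ¬ Bad2 n k m G) :
    chi n G ≤ n / k + m := by
  classical
  have key : ∀ N, ∀ S : Finset (Fin n), S.card = N → ∃ c : Fin n → ℕ, (∀ v ∈ S, c v < N / k + m) ∧
      ∀ u ∈ S, ∀ v ∈ S, G.Adj u v → c u ≠ c v := by
    intro N
    induction N using Nat.strong_induction_on with
    | _ N ih =>
      intro S hS
      by_cases hm : N < m
      · let e := S.equivFin
        refine ⟨fun v => if hv : v ∈ S then e ⟨v, hv⟩ else 0, ?_, ?_⟩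
        · intro v hv
          simp only [hv, dif_pos]
          exact lt_of_lt_of_le ((lt_of_lt_of_eq (e ⟨v, hv⟩).2 hS).trans hm) (Nat.le_add_left _ _)
        · intro u hu v hv huv h
          simp only [hu, hv, dif_pos] at h
          have := e.injective (Fin.ext h)
          simp at this
          exact huv.ne this
      · push Not at hm
        obtain ⟨S', hS', hcard⟩ := Finset.exists_subset_card_eq (hm.trans hS.ge)
        have : ∃ A ⊆ S', A.card = k ∧ ∀ u ∈ A, ∀ v ∈ A, ¬ G.Adj u v := by
          by_contra h'
          apply h
          refine ⟨S', hcard, fun A hA hAk => ?_⟩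
          by_contra h''
          apply h'
          exact ⟨A, hA, hAk, fun u hu v hv huv => h'' ⟨u, hu, v, hv, huv⟩⟩
        obtain ⟨A, hA, hAk, hi⟩ := this
        have hAS : A ⊆ S := hA.trans hS'
        have hc : (S \ A).card = N - k := by rw [Finset.card_sdiff_of_subset hAS, hS, hAk]
        have hkN : k ≤ N := by rw [← hS, ← hAk]; exact Finset.card_le_card hAS
        obtain ⟨c, hc1, hc2⟩ := ih (N - k) (by omega) (S \ A) hc
        have hdiv : N / k = (N - k) / k + 1 := by
          rw [Nat.div_eq_sub_div hk hkN]
        refine ⟨fun v => if v ∈ A then (N - k) / k + m else c v, ?_, ?_⟩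
        · intro v hv
          simp only
          split_ifs with hvA
          · omega
          · have := hc1 v (Finset.mem_sdiff.2 ⟨hv, hvA⟩)
            omega
        · intro u hu v hv huv
          simp only
          split_ifs with h1 h2 h2
          · exact absurd huv (hi u h1 v h2)
          · exact (hc1 v (Finset.mem_sdiff.2 ⟨hv, h2⟩)).ne'
          · exact (hc1 u (Finset.mem_sdiff.2 ⟨hu, h1⟩)).ne
          · exact hc2 u (Finset.mem_sdiff.2 ⟨hu, h1⟩) v (Finset.mem_sdiff.2 ⟨hv, h2⟩) huv
  obtain ⟨c, hc1, hc2⟩ := key n Finset.univ (by simp)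
  apply chi_le
  exact ⟨SimpleGraph.Coloring.mk (fun v => ⟨c v, hc1 v (Finset.mem_univ _)⟩) (fun {u v} huv h => by
    exact hc2 u (Finset.mem_univ _) v (Finset.mem_univ _) huv (by simpa using h))⟩

lemma rho_bound (L δ η : ℝ) (k m : ℕ) (hδ : 0 < δ) (hδ1 : δ ≤ 1) (hη : η ≤ 1/16)
    (hηδ : η ≤ δ / 4) (hk1 : (2 - δ) * L ≤ k) (hk2 : (k:ℝ) ≤ (2 - δ) * L + 1)
    (hm : (2:ℝ) ^ L / L ^ 2 ≤ m) (h9 : 9 * L ^ 4 ≤ (2:ℝ) ^ (η * L)) (h3 : 3 * L ≤ (2:ℝ) ^ (L / 4))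
    (hL : 8 ≤ L) (hLδ : 8 ≤ δ * L) :
    ∑ l ∈ Finset.Icc 2 k, ((k:ℝ)^2 / m) ^ l * 2 ^ (l.choose 2) ≤ (2:ℝ) ^ (-(3/2) * L) := by
  have hL0 : 0 < L := by linarith
  have hm0 : (0:ℝ) < m := lt_of_lt_of_le (by positivity) hm
  have hkL : L ≤ k := by nlinarith
  have hk3 : (k:ℝ) ≤ 3 * L := by nlinarith
  have hq : (k:ℝ)^2 / m ≤ (2:ℝ) ^ ((η - 1) * L) := by
    rw [div_le_iff₀ hm0]
    calc (k:ℝ)^2 ≤ (3 * L)^2 := by gcongr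
      _ = 9 * L^4 / L^2 := by field_simp; ring
      _ ≤ (2:ℝ) ^ (η * L) / L ^ 2 := by gcongr
      _ = (2:ℝ) ^ ((η - 1) * L) * ((2:ℝ) ^ L / L ^ 2) := by
          rw [mul_div_assoc', ← Real.rpow_add (by norm_num)]; congr 2; ring
      _ ≤ _ := by gcongr
  have hterm : ∀ l ∈ Finset.Icc 2 k, ((k:ℝ)^2 / m) ^ l * 2 ^ (l.choose 2) ≤ (2:ℝ) ^ (-(7/4) * L) := by
    intro l hl
    rw [Finset.mem_Icc] at hl
    have hl2 : (2:ℝ) ≤ l := by exact_mod_cast hl.1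
    have hlk : (l:ℝ) ≤ k := by exact_mod_cast hl.2
    calc ((k:ℝ)^2 / m) ^ l * 2 ^ (l.choose 2) ≤ ((2:ℝ) ^ ((η - 1) * L)) ^ l * 2 ^ (l.choose 2) := by gcongr
      _ = (2:ℝ) ^ ((η - 1) * L * l + l * (l - 1) / 2) := by
          rw [← Real.rpow_natCast, ← Real.rpow_natCast, ← Real.rpow_mul (by norm_num),
            ← Real.rpow_add (by norm_num), Nat.cast_choose_two]
      _ ≤ _ := by
          apply Real.rpow_le_rpow_of_exponent_le (by norm_num)
          have ha : (η - 1) * L * 2 + 1 ≤ -(7/4) * L := by nlinarith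
          have hb : (η - 1) * L * k + k * (k - 1) / 2 ≤ -(7/4) * L := by
            have h1 : (η - 1) * L + (k - 1) / 2 ≤ - (δ * L) / 4 := by nlinarith
            have h2 : (η - 1) * L + (k - 1) / 2 ≤ - 2 := by linarith
            nlinarith
          have hk0 : (0:ℝ) < k - 2 := by linarith
          refine le_of_mul_le_mul_left ?_ hk0
          have e1 := mul_le_mul_of_nonneg_left ha (sub_nonneg.2 hlk)
          have e2 := mul_le_mul_of_nonneg_left hb (sub_nonneg.2 hl2)
          have e3 := mul_nonneg (mul_nonneg (sub_nonneg.2 hlk) (sub_nonneg.2 hl2)) hk0.le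
          nlinarith
  refine (Finset.sum_le_sum hterm).trans ?_
  rw [Finset.sum_const, nsmul_eq_mul]
  have hc : ((Finset.Icc 2 k).card : ℝ) ≤ (2:ℝ) ^ (L / 4) := by
    refine le_trans ?_ (hk3.trans h3)
    rw [Nat.card_Icc]
    exact_mod_cast (by omega : k + 1 - 2 ≤ k)
  calc _ ≤ (2:ℝ) ^ (L / 4) * (2:ℝ) ^ (-(7/4) * L) := by gcongr
    _ = _ := by rw [← Real.rpow_add (by norm_num)]; congr 1; ring

lemma first_bound (L δ : ℝ) (n r : ℕ) (hn : (n:ℝ) = (2:ℝ) ^ L) (hL : 0 ≤ L) (hδ : 0 < δ)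
    (hr : (2 + δ) * L + 1 ≤ r) :
    (n:ℝ) ^ r * (1/2) ^ (r.choose 2) ≤ (2:ℝ) ^ (-(δ / 2) * L) := by
  have e : (1/2:ℝ) = (2:ℝ) ^ (-1:ℝ) := by rw [Real.rpow_neg_one]; norm_num
  rw [hn, e, ← Real.rpow_natCast, ← Real.rpow_natCast, ← Real.rpow_mul (by norm_num),
    ← Real.rpow_mul (by norm_num), ← Real.rpow_add (by norm_num), Nat.cast_choose_two]
  apply Real.rpow_le_rpow_of_exponent_le (by norm_num)
  have hr1 : (1:ℝ) ≤ r := by nlinarith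
  have h1 : L - (r - 1) / 2 ≤ - (δ * L) / 2 := by linarith
  nlinarith [mul_nonneg hδ.le hL]

lemma second_bound (L : ℝ) (n : ℕ) (hn : (n:ℝ) = (2:ℝ) ^ L) (hn2 : 2 ≤ n) :
    (2:ℝ) ^ n * Real.exp (- (1 / (2 * ((2:ℝ) ^ (-(3/2) * L)) ^ 2 * (n.choose 2 : ℕ)))) ≤
      (2 * Real.exp (-1)) ^ n := by
  have hn0 : (0:ℝ) < n := by positivity
  rw [mul_pow, ← Real.exp_nat_mul]
  gcongr
  have e : ((2:ℝ) ^ (-(3/2) * L)) ^ 2 = ((n:ℝ)^3)⁻¹ := by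
    rw [hn, ← Real.rpow_natCast, ← Real.rpow_natCast, ← Real.rpow_mul (by norm_num),
      ← Real.rpow_mul (by norm_num), ← Real.rpow_neg (by norm_num)]
    congr 1; push_cast; ring
  have hc : (0:ℝ) < (n.choose 2 : ℕ) := by exact_mod_cast Nat.choose_pos hn2
  have hc2 : 2 * ((n.choose 2 : ℕ) : ℝ) ≤ n ^ 2 := by
    rw [Nat.cast_choose_two]; nlinarith
  rw [e]
  have : (n:ℝ) ≤ 1 / (2 * ((n:ℝ)^3)⁻¹ * (n.choose 2 : ℕ)) := by
    rw [le_div_iff₀ (by positivity)]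
    calc (n:ℝ) * (2 * ((n:ℝ)^3)⁻¹ * (n.choose 2 : ℕ)) = (n:ℝ) * ((n:ℝ)^3)⁻¹ * (2 * (n.choose 2 : ℕ)) := by ring
      _ ≤ (n:ℝ) * ((n:ℝ)^3)⁻¹ * n ^ 2 := by gcongr
      _ = 1 := by field_simp
  linarith

lemma final_det (L δ ε : ℝ) (n k m r χ : ℕ) (hδ : 0 < δ) (hδ1 : δ ≤ 1) (hε : 2 * δ ≤ ε)
    (hn : 0 < n) (hL : 1 ≤ L) (hLδ : 8 ≤ δ * L) (hnL : L ^ 2 ≤ n)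
    (hk1 : (2 - δ) * L ≤ k) (hm : (m:ℝ) ≤ n / L ^ 2 + 1) (hr : (r:ℝ) ≤ (2 + δ) * L + 2)
    (h1 : n ≤ χ * r) (h2 : χ ≤ n / k + m) :
    |(χ:ℝ) * (2 * L) / n - 1| ≤ ε := by
  have hn0 : (0:ℝ) < n := by exact_mod_cast hn
  have hL0 : 0 < L := by linarith
  have h1' : (n:ℝ) ≤ χ * r := by exact_mod_cast h1
  have h2' : (χ:ℝ) ≤ n / k + m := by
    have : (χ:ℝ) ≤ (n / k : ℕ) + m := by exact_mod_cast h2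
    have := @Nat.cast_div_le ℝ _ _ _ n k
    linarith
  have hk0 : (0:ℝ) < k := by nlinarith
  rw [abs_le]
  constructor
  · have : 1 - δ ≤ (χ:ℝ) * (2 * L) / n := by
      rw [le_div_iff₀ hn0]
      have h3 : (1 - δ) * r ≤ 2 * L := by
        have : (1 - δ) * r ≤ (1 - δ) * ((2 + δ) * L + 2) := by
          apply mul_le_mul_of_nonneg_left hr; linarith
        nlinarith
      calc (1 - δ) * n ≤ (1 - δ) * (χ * r) := by
            apply mul_le_mul_of_nonneg_left h1'; linarith
        _ = χ * ((1 - δ) * r) := by ring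
        _ ≤ _ := by gcongr
    linarith
  · have : (χ:ℝ) * (2 * L) / n ≤ 1 + 2 * δ := by
      calc (χ:ℝ) * (2 * L) / n ≤ (n / k + (n / L ^ 2 + 1)) * (2 * L) / n := by
            gcongr; linarith
        _ = 2 * L / k + 2 / L + 2 * L / n := by field_simp; ring
        _ ≤ (1 + δ) + δ / 2 + δ / 2 := by
            have a : 2 * L / k ≤ 1 + δ := by
              rw [div_le_iff₀ hk0]
              have : (1 + δ) * ((2 - δ) * L) ≤ (1 + δ) * k := by gcongr
              nlinarith [mul_nonneg (mul_nonneg hδ.le (sub_nonneg.2 hδ1)) hL0.le]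
            have b : 2 / L ≤ δ / 2 := by
              rw [div_le_iff₀ hL0]; linarith
            have c : 2 * L / n ≤ δ / 2 := by
              refine le_trans ?_ b
              rw [div_le_div_iff₀ hn0 hL0]; nlinarith
            linarith
        _ = _ := by ring
    linarith

lemma pow_ev (a c : ℝ) (ha : 0 < a) (hc : 0 < c) (j : ℕ) :
    ∀ᶠ L : ℝ in atTop, c * L ^ j ≤ (2:ℝ) ^ (a * L) := by
  have hb : 0 < a * Real.log 2 := mul_pos ha (Real.log_pos (by norm_num))
  have h := isLittleO_pow_exp_pos_mul_atTop j hb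
  have := h.bound (inv_pos.2 hc)
  filter_upwards [this, eventually_ge_atTop 0] with L hL hL0
  rw [Real.rpow_def_of_pos (by norm_num)]
  rw [Real.norm_of_nonneg (by positivity), Real.norm_of_nonneg (by positivity), inv_mul_eq_div, le_div_iff₀ hc] at hL
  have e : Real.log 2 * (a * L) = a * Real.log 2 * L := by ring
  rw [mul_comm c, e]
  exact hL

/-- Whp, `χ(G(n,1/2)) ∼ n / (2 log₂ n)`. -/
theorem stmt2 (ε : ℝ) (hε : 0 < ε) :
    Tendsto (fun n : ℕ =>
        Pr n (fun G => |(chi n G : ℝ) * (2 * Real.logb 2 n) / n - 1| ≤ ε))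
      atTop (nhds 1) := by
  obtain ⟨δ, hδ, hδ1, hδε⟩ : ∃ δ : ℝ, 0 < δ ∧ δ ≤ 1 ∧ 2 * δ ≤ ε :=
    ⟨min 1 (ε / 2), by positivity, min_le_left _ _, by linarith [min_le_right 1 (ε/2)]⟩
  obtain ⟨η, hη, hη1, hηδ⟩ : ∃ η : ℝ, 0 < η ∧ η ≤ 1/16 ∧ η ≤ δ / 4 :=
    ⟨min (1/16) (δ / 4), by positivity, min_le_left _ _, min_le_right _ _⟩
  have hLt : Tendsto (fun n : ℕ => Real.logb 2 (n:ℝ)) atTop atTop :=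
    (Real.tendsto_logb_atTop (by norm_num)).comp tendsto_natCast_atTop_atTop
  have hlow : ∀ᶠ n : ℕ in atTop, 1 - ((2:ℝ) ^ (-(δ / 2) * Real.logb 2 (n:ℝ)) + (2 * Real.exp (-1)) ^ n)
      ≤ Pr n (fun G => |(chi n G : ℝ) * (2 * Real.logb 2 n) / n - 1| ≤ ε) := by
    filter_upwards [eventually_ge_atTop 2, hLt.eventually (eventually_ge_atTop 8),
      hLt.eventually (eventually_ge_atTop (8 / δ)), hLt.eventually (pow_ev η 9 hη (by norm_num) 4),
      hLt.eventually (pow_ev (1/4) 3 (by norm_num) (by norm_num) 1)] with n hn2 h8 h8δ h9 h3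
    set L := Real.logb 2 (n:ℝ) with hLdef
    have hnL : (n:ℝ) = (2:ℝ) ^ L := by
      rw [hLdef, Real.rpow_logb (by norm_num) (by norm_num) (by positivity)]
    have hL0 : 0 < L := by linarith
    have hLδ : 8 ≤ δ * L := by rw [div_le_iff₀ hδ] at h8δ; linarith
    have h3' : 3 * L ≤ (2:ℝ) ^ (L / 4) := by
      rw [pow_one] at h3; convert h3 using 2; ring
    have hk1 := Nat.le_ceil ((2 - δ) * L)
    have hk2 := (Nat.ceil_lt_add_one (a := (2 - δ) * L) (by nlinarith)).le
    have hm1 := Nat.le_ceil ((n:ℝ) / L ^ 2)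
    have hm2 := (Nat.ceil_lt_add_one (a := (n:ℝ) / L ^ 2) (by positivity)).le
    have hr1 := Nat.le_ceil ((2 + δ) * L)
    have hr2 := (Nat.ceil_lt_add_one (a := (2 + δ) * L) (by positivity)).le
    set k := ⌈(2 - δ) * L⌉₊
    set m := ⌈(n:ℝ) / L ^ 2⌉₊
    set r := ⌈(2 + δ) * L⌉₊ + 1 with hr
    have h9n : 9 * L ^ 4 ≤ n := by
      rw [hnL]
      refine h9.trans (Real.rpow_le_rpow_of_exponent_le (by norm_num) ?_)
      nlinarith
    have hkL : L ≤ k := by nlinarith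
    have hk3 : (k:ℝ) ≤ 3 * L := by nlinarith
    have hkm : k ≤ m := by
      have : (k:ℝ) ≤ m := by
        refine le_trans ?_ hm1
        rw [le_div_iff₀ (by positivity)]
        refine le_trans ?_ h9n
        calc (k:ℝ) * L ^ 2 ≤ (3 * L) * L ^ 2 := by gcongr
          _ ≤ (3 * L) * L ^ 2 * (3 * L) := le_mul_of_one_le_right (by positivity) (by linarith)
          _ = _ := by ring
      exact_mod_cast this
    have hk2' : 2 ≤ k := by
      have : (2:ℝ) ≤ k := by linarith
      exact_mod_cast this
    have hnL2 : L ^ 2 ≤ n := by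
      refine le_trans ?_ h9n
      nlinarith [sq_nonneg (L^2), sq_nonneg L, mul_le_mul h8 h8 (by norm_num) hL0.le]
    have hb1 := (Pr_bad1 n r).trans (first_bound L δ n r hnL hL0.le hδ (by rw [hr]; push_cast; linarith))
    have hrho := rho_bound L δ η k m hδ hδ1 hη1 hηδ hk1 hk2 (by rw [← hnL]; exact hm1) h9 h3' h8 hLδ
    have hb2 := (Pr_bad2 n k m hk2' hkm _ hrho (by positivity)).trans (second_bound L n hnL hn2)
    have hc := Pr_cover n (fun G => |(chi n G : ℝ) * (2 * L) / n - 1| ≤ ε) (Bad1 n r) (Bad2 n k m)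
      (fun G g1 g2 => final_det L δ ε n k m r (chi n G) hδ hδ1 hδε (by omega) (by linarith) hLδ hnL2 hk1 hm2
        (by rw [hr]; push_cast; linarith) (chi_lower n r G g1) (chi_upper n k m (by omega) G g2))
    linarith
  refine tendsto_of_tendsto_of_tendsto_of_le_of_le' ?_ tendsto_const_nhds hlow
    (Eventually.of_forall fun n => Pr_le_one n _)
  have t1 : Tendsto (fun n : ℕ => (2:ℝ) ^ (-(δ / 2) * Real.logb 2 (n:ℝ))) atTop (nhds 0) := by
    have : Tendsto (fun x : ℝ => (2:ℝ) ^ x) atBot (nhds 0) :=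
      tendsto_rpow_atBot_of_base_gt_one 2 (by norm_num)
    exact this.comp (hLt.const_mul_atTop_of_neg (by linarith))
  have t2 : Tendsto (fun n : ℕ => (2 * Real.exp (-1)) ^ n) atTop (nhds 0) := by
    apply tendsto_pow_atTop_nhds_zero_of_lt_one (by positivity)
    rw [Real.exp_neg, ← div_eq_mul_inv, div_lt_one (Real.exp_pos _)]
    have := Real.exp_one_gt_d9
    linarith
  simpa using (tendsto_const_nhds (x := (1:ℝ))).sub (t1.add t2)
end
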